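/- arXiv:2512.20930 — 4 statements merged into one kernel-verified Lean document; each statement's English description precedes it below -/
import Mathlib

section
/- Let S₁, S₂, T₁, …, T_k be pairwise commuting contractions on a complex Hilbert space H. Suppose that for each i = 1, 2 there exist a Hilbert space K_i containing H as a closed subspace and pairwise doubly commuting isometries A_i, B₁, …, B_k on K_i such that H is invariant under A_i* and under each B_j*, with A_i*|_H = S_i* and B_j*|_H = T_j* for all j (i.e., (A_i, B₁, …, B_k) is a doubly commuting isometric co-extension of (S_i, T₁, …, T_k)). Then there exist a Hilbert space K containing H as a closed subspace and pairwise commuting isometries V₁, V₂, W₁, …, W_k on K such that: (1) P_H V₁^{n₁} V₂^{n₂} W₁^{m₁} ⋯ W_k^{m_k}|_H = S₁^{n₁} S₂^{n₂} T₁^{m₁} ⋯ T_k^{m_k} for all n₁, n₂, m₁, …, m_k ∈ ℕ; (2) for each i = 1, 2, the isometries V_i, W₁, …, W_k are pairwise doubly commuting, H is invariant under V_i* and each W_j*, and V_i*|_H = S_i*, W_j*|_H = T_j* for all j. -/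
open ContinuousLinearMap

universe u

set_option linter.unusedSectionVars false


namespace BD
open scoped InnerProductSpace

section rel
variable {X Y : Type u} [NormedAddCommGroup X] [InnerProductSpace ℂ X] [CompleteSpace X]
  [NormedAddCommGroup Y] [InnerProductSpace ℂ Y] [CompleteSpace Y]

theorem ds_ext {x y : WithLp 2 (X × Y)} (h : x.fst = y.fst) (h' : x.snd = y.snd) : x = y :=
  WithLp.ofLp_injective 2 (Prod.ext h h')

theorem exists_partial_iso (R : Submodule ℂ (WithLp 2 (X × Y)))
    (hR : ∀ p ∈ R, ∀ q ∈ R, ⟪p.fst, q.fst⟫_ℂ = ⟪p.snd, q.snd⟫_ℂ) :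
    ∃ u : X →L[ℂ] Y, (∀ p ∈ R, u p.fst = p.snd ∧ adjoint u p.snd = p.fst) ∧
      (∀ x, u (adjoint u (u x)) = u x) ∧
      (∀ x, (∀ p ∈ R, ⟪p.fst, x⟫_ℂ = 0) → u x = 0) ∧
      ∀ (a : X →L[ℂ] X) (b : Y →L[ℂ] Y),
        (∀ p ∈ R, WithLp.toLp 2 (a p.fst, b p.snd) ∈ R) →
        (∀ p ∈ R, WithLp.toLp 2 (adjoint a p.fst, adjoint b p.snd) ∈ R) →
        ∀ x, u (a x) = b (u x) := by
  set M := Rᗮᗮ with hMdef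
  have hMc : CompleteSpace M := (Submodule.isClosed_orthogonal Rᗮ).completeSpace_coe
  have hMp : M.HasOrthogonalProjection := Submodule.HasOrthogonalProjection.ofCompleteSpace M
  set P := M.starProjection with hP
  have hRM : R ≤ M := Submodule.le_orthogonal_orthogonal R
  have hMo : Mᗮ = Rᗮ := by
    rw [hMdef, Submodule.triorthogonal_eq_orthogonal]
  -- the flipped vectors are orthogonal
  have h1 : ∀ p ∈ R, WithLp.toLp 2 (p.fst, -p.snd) ∈ Rᗮ := by
    intro p hp
    rw [Submodule.mem_orthogonal]
    intro q hq
    simp [WithLp.prod_inner_apply, hR q hq p hp]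
  have h2 : ∀ q ∈ M, WithLp.toLp 2 (q.fst, -q.snd) ∈ Mᗮ := by
    intro q hq
    rw [hMo, Submodule.mem_orthogonal]
    intro p hp
    have := (Submodule.mem_orthogonal _ _).1 hq _ (h1 p hp)
    simpa [WithLp.prod_inner_apply] using this
  have hfst : ∀ q ∈ M, P (WithLp.toLp 2 (q.fst, 0)) = (2⁻¹ : ℂ) • q := by
    intro q hq
    refine (Submodule.eq_starProjection_of_mem_orthogonal' (M.smul_mem _ hq)
      (Mᗮ.smul_mem (2⁻¹ : ℂ) (h2 q hq)) ?_)
    apply ds_ext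
    · simp [← add_smul]; norm_num
    · simp
  have hsnd : ∀ q ∈ M, P (WithLp.toLp 2 (0, q.snd)) = (2⁻¹ : ℂ) • q := by
    intro q hq
    refine (Submodule.eq_starProjection_of_mem_orthogonal' (M.smul_mem _ hq)
      (Mᗮ.smul_mem (-2⁻¹ : ℂ) (h2 q hq)) ?_)
    apply ds_ext
    · simp
    · simp [← add_smul]; norm_num
  let inl : X →L[ℂ] WithLp 2 (X × Y) :=
    (WithLp.prodContinuousLinearEquiv 2 ℂ X Y).symm.toContinuousLinearMap ∘L
      (ContinuousLinearMap.inl ℂ X Y)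
  let sn : WithLp 2 (X × Y) →L[ℂ] Y := WithLp.sndL 2 ℂ X Y
  let u : X →L[ℂ] Y := (2 : ℂ) • (sn ∘L P ∘L inl)
  have hu : ∀ x, u x = (2 : ℂ) • (P (WithLp.toLp 2 (x, 0))).snd := fun x => rfl
  have hua : ∀ y, adjoint u y = (2 : ℂ) • (P (WithLp.toLp 2 (0, y))).fst := by
    intro y
    apply ext_inner_right ℂ
    intro x
    rw [adjoint_inner_left, hu, inner_smul_right, inner_smul_left]
    have := Submodule.inner_starProjection_left_eq_right M (WithLp.toLp 2 ((0:X), y)) (WithLp.toLp 2 (x, (0:Y)))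
    simp [WithLp.prod_inner_apply] at this
    rw [hP, this, Complex.conj_ofNat]
  have hM1 : ∀ q ∈ M, u q.fst = q.snd := by
    intro q hq; rw [hu, hfst q hq]; simp
  have hM2 : ∀ q ∈ M, adjoint u q.snd = q.fst := by
    intro q hq; rw [hua, hsnd q hq]; simp
  refine ⟨u, fun p hp => ⟨hM1 p (hRM hp), hM2 p (hRM hp)⟩, ?_, ?_, ?_⟩
  · intro x
    have hq : (2:ℂ) • P (WithLp.toLp 2 (x, 0)) ∈ M :=
      M.smul_mem _ (Submodule.starProjection_apply_mem _ _)
    have e : u x = ((2:ℂ) • P (WithLp.toLp 2 (x, 0))).snd := rfl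
    rw [e, hM2 _ hq, hM1 _ hq]
  · intro x hx
    rw [hu]
    have : P (WithLp.toLp 2 (x, 0)) = 0 := by
      rw [hP, Submodule.starProjection_apply_eq_zero_iff, hMo, Submodule.mem_orthogonal]
      intro p hp
      simp [WithLp.prod_inner_apply, hx p hp]
    rw [this]; simp
  · intro a b hab hab' x
    have k1 : ∀ q ∈ Rᗮ, WithLp.toLp 2 (a q.fst, b q.snd) ∈ Rᗮ := by
      intro q hq
      rw [Submodule.mem_orthogonal] at hq ⊢
      intro p hp
      have := hq _ (hab' p hp)
      simpa [WithLp.prod_inner_apply, adjoint_inner_left] using this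
    have k2 : ∀ q ∈ Rᗮ, WithLp.toLp 2 (adjoint a q.fst, adjoint b q.snd) ∈ Rᗮ := by
      intro q hq
      rw [Submodule.mem_orthogonal] at hq ⊢
      intro p hp
      have := hq _ (hab p hp)
      simpa [WithLp.prod_inner_apply, adjoint_inner_right] using this
    have k3 : ∀ q ∈ M, WithLp.toLp 2 (a q.fst, b q.snd) ∈ M := by
      intro q hq
      rw [hMdef, Submodule.mem_orthogonal] at hq ⊢
      intro p hp
      have := hq _ (k2 p hp)
      simpa [WithLp.prod_inner_apply, adjoint_inner_left] using this
    set v : WithLp 2 (X × Y) := WithLp.toLp 2 (x, 0) with hv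
    have hPv : P v ∈ M := Submodule.starProjection_apply_mem _ _
    have hPv' : v - P v ∈ Rᗮ := by
      rw [← hMo]; exact Submodule.sub_starProjection_mem_orthogonal _
    have : P (WithLp.toLp 2 (a x, 0)) = WithLp.toLp 2 (a (P v).fst, b (P v).snd) := by
      refine Submodule.eq_starProjection_of_mem_orthogonal' (k3 _ hPv) (hMo ▸ k1 _ hPv') ?_
      apply ds_ext <;> simp [hv]
    rw [hu, hu, this]
    simp [hv]

theorem ext_of_orth {f g : X →L[ℂ] Y} (s : Set X) (h : ∀ x ∈ s, f x = g x)
    (h' : ∀ x, (∀ y ∈ s, ⟪y, x⟫_ℂ = 0) → f x = g x) : f = g := by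
  have hcl : IsClosed ((LinearMap.ker ((f - g : X →L[ℂ] Y) : X →ₗ[ℂ] Y) : Submodule ℂ X) : Set X) :=
    (f - g).isClosed_ker
  set N := LinearMap.ker ((f - g : X →L[ℂ] Y) : X →ₗ[ℂ] Y)
  have : CompleteSpace N := hcl.completeSpace_coe
  have hN : ∀ x, x ∈ N ↔ f x = g x := by intro x; simp [N, sub_eq_zero]
  have : N = ⊤ := by
    rw [← Submodule.orthogonal_eq_bot_iff, Submodule.eq_bot_iff]
    intro x hx
    have hx' : x ∈ N := by
      rw [hN]; apply h'
      intro y hy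
      exact (Submodule.mem_orthogonal _ _).1 hx y ((hN y).2 (h y hy))
    have := (Submodule.mem_orthogonal _ _).1 hx x hx'
    simpa using this
  ext x
  rw [← hN, this]; trivial
end rel
section blk
variable {X Y : Type u} [NormedAddCommGroup X] [InnerProductSpace ℂ X] [CompleteSpace X]
  [NormedAddCommGroup Y] [InnerProductSpace ℂ Y] [CompleteSpace Y]
/-- 2 × 2 block operators on the Hilbert direct sum. -/
noncomputable def blk (a : X →L[ℂ] X) (b : Y →L[ℂ] X) (c : X →L[ℂ] Y) (d : Y →L[ℂ] Y) :
    WithLp 2 (X × Y) →L[ℂ] WithLp 2 (X × Y) :=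
  (WithLp.prodContinuousLinearEquiv 2 ℂ X Y).symm.toContinuousLinearMap ∘L
    ((a ∘L WithLp.fstL 2 ℂ X Y + b ∘L WithLp.sndL 2 ℂ X Y).prod
      (c ∘L WithLp.fstL 2 ℂ X Y + d ∘L WithLp.sndL 2 ℂ X Y))

theorem blk_fst (a : X →L[ℂ] X) (b : Y →L[ℂ] X) (c : X →L[ℂ] Y) (d : Y →L[ℂ] Y)
    (x : WithLp 2 (X × Y)) : (blk a b c d x).fst = a x.fst + b x.snd := rfl

theorem blk_snd (a : X →L[ℂ] X) (b : Y →L[ℂ] X) (c : X →L[ℂ] Y) (d : Y →L[ℂ] Y)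
    (x : WithLp 2 (X × Y)) : (blk a b c d x).snd = c x.fst + d x.snd := rfl

theorem blk_mul (a a' : X →L[ℂ] X) (b b' : Y →L[ℂ] X) (c c' : X →L[ℂ] Y) (d d' : Y →L[ℂ] Y) :
    blk a b c d * blk a' b' c' d' =
      blk (a * a' + b ∘L c') (a ∘L b' + b ∘L d') (c ∘L a' + d ∘L c') (c ∘L b' + d * d') := by
  ext x
  apply ds_ext <;> simp [blk_fst, blk_snd] <;> abel

theorem blk_one : blk (1 : X →L[ℂ] X) 0 0 (1 : Y →L[ℂ] Y) = 1 := by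
  ext x
  apply ds_ext <;> simp [blk_fst, blk_snd]

theorem blk_adjoint (a : X →L[ℂ] X) (b : Y →L[ℂ] X) (c : X →L[ℂ] Y) (d : Y →L[ℂ] Y) :
    adjoint (blk a b c d) = blk (adjoint a) (adjoint c) (adjoint b) (adjoint d) := by
  symm
  rw [eq_adjoint_iff]
  intro x y
  simp [WithLp.prod_inner_apply, blk_fst, blk_snd, inner_add_left, inner_add_right,
    adjoint_inner_left]
  abel

/-- The first-coordinate embedding. -/
noncomputable def inl : X →ₗᵢ[ℂ] WithLp 2 (X × Y) where
  toLinearMap := ((WithLp.prodContinuousLinearEquiv 2 ℂ X Y).symm.toContinuousLinearMap ∘L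
      (ContinuousLinearMap.inl ℂ X Y)).toLinearMap
  norm_map' x := by
    simp

theorem inl_fst (x : X) : (inl x : WithLp 2 (X × Y)).fst = x := rfl
theorem inl_snd (x : X) : (inl x : WithLp 2 (X × Y)).snd = 0 := rfl
end blk

section amp
variable {F : Type u} [NormedAddCommGroup F] [InnerProductSpace ℂ F] [CompleteSpace F]

/-- Square summable sequences. -/
abbrev Sq (F : Type u) [NormedAddCommGroup F] : Type u := lp (fun _ : ℕ => F) 2

theorem memlp_amp (T : F →L[ℂ] F) (f : Sq F) : Memℓp (fun n => T (f n)) 2 := by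
  have h := (lp.memℓp f).summable (by norm_num)
  apply memℓp_gen
  refine Summable.of_nonneg_of_le (fun i => by positivity) (fun i => ?_) (h.mul_left (‖T‖ ^ (2:ENNReal).toReal))
  rw [← Real.mul_rpow (norm_nonneg _) (norm_nonneg _)]
  exact Real.rpow_le_rpow (norm_nonneg _) (T.le_opNorm _) (by norm_num)

theorem sq_norm (f : Sq F) : HasSum (fun n => ‖f n‖ ^ 2) (‖f‖ ^ 2) := by
  have := lp.hasSum_norm (p := 2) (by norm_num) f
  simpa using this

/-- Ampliation of an operator to sequences. -/
noncomputable def amp (T : F →L[ℂ] F) : Sq F →L[ℂ] Sq F :=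
  LinearMap.mkContinuous
    { toFun := fun f => ⟨fun n => T (f n), memlp_amp T f⟩
      map_add' := fun f g => by ext n; exact map_add T _ _
      map_smul' := fun c f => by ext n; simp } ‖T‖ (by
    intro f
    refine le_of_sq_le_sq ?_ (by positivity)
    rw [mul_pow]
    refine hasSum_le (fun n => ?_) (sq_norm _) ((sq_norm f).mul_left _)
    rw [← mul_pow]
    exact pow_le_pow_left₀ (norm_nonneg _) (T.le_opNorm _) 2)

theorem amp_apply (T : F →L[ℂ] F) (f : Sq F) (n : ℕ) : amp T f n = T (f n) := rfl

theorem amp_mul (S T : F →L[ℂ] F) : amp (S * T) = amp S * amp T := by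
  ext f n; simp [amp_apply]

theorem amp_add (S T : F →L[ℂ] F) : amp (S + T) = amp S + amp T := by
  ext f n; simp [amp_apply]

theorem amp_zero : amp (0 : F →L[ℂ] F) = 0 := by
  ext f n; simp [amp_apply]

theorem amp_one : amp (1 : F →L[ℂ] F) = 1 := by
  ext f n; simp [amp_apply]

theorem amp_adjoint (T : F →L[ℂ] F) : adjoint (amp T) = amp (adjoint T) := by
  symm
  rw [eq_adjoint_iff]
  intro f g
  simp [lp.inner_eq_tsum, amp_apply, adjoint_inner_left]

/-- The shifted sequence. -/
def shFun (f : ℕ → F) : ℕ → F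
  | 0 => 0
  | n + 1 => f n

theorem hasSum_sh (f : Sq F) : HasSum (fun n => ‖shFun f n‖ ^ 2) (‖f‖ ^ 2) := by
  rw [← hasSum_nat_add_iff' 1]
  simpa [shFun] using sq_norm f

theorem memlp_sh (f : Sq F) : Memℓp (shFun (f : ℕ → F)) 2 := by
  apply memℓp_gen
  simpa using (hasSum_sh f).summable

/-- The unilateral shift. -/
noncomputable def shI : Sq F →ₗᵢ[ℂ] Sq F where
  toFun f := ⟨shFun f, memlp_sh f⟩
  map_add' f g := by
    ext n
    cases n
    · exact (add_zero (0 : F)).symm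
    · rfl
  map_smul' c f := by ext n; cases n <;> simp [shFun]
  norm_map' f := by
    have h1 := sq_norm (F := F) ⟨shFun f, memlp_sh f⟩
    have h2 := h1.unique (hasSum_sh f)
    exact (sq_eq_sq₀ (norm_nonneg _) (norm_nonneg _)).1 h2

/-- The unilateral shift as an operator. -/
noncomputable def sh : Sq F →L[ℂ] Sq F := shI.toContinuousLinearMap

theorem sh_zero (f : Sq F) : sh f 0 = 0 := rfl
theorem sh_succ (f : Sq F) (n : ℕ) : sh f (n + 1) = f n := rfl

/-- Embedding at index zero. -/
noncomputable def em : F →L[ℂ] Sq F := lp.singleContinuousLinearMap ℂ (fun _ : ℕ => F) 2 0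

theorem em_apply (x : F) : em x = lp.single 2 0 x := rfl

theorem sh_iso : adjoint (sh : Sq F →L[ℂ] Sq F) * sh = 1 := by
  ext1 f
  apply ext_inner_right ℂ
  intro g
  change ⟪adjoint sh (sh f), g⟫_ℂ = ⟪f, g⟫_ℂ
  rw [adjoint_inner_left]
  exact (shI : Sq F →ₗᵢ[ℂ] Sq F).inner_map_map f g

theorem em_iso (x : F) : adjoint (em : F →L[ℂ] Sq F) (em x) = x := by
  apply ext_inner_right ℂ
  intro g
  simp only [adjoint_inner_left, em_apply]
  simp [lp.inner_single_left]

theorem em_sh (f : Sq F) : adjoint (em : F →L[ℂ] Sq F) (sh f) = 0 := by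
  apply ext_inner_right ℂ
  intro g
  simp only [adjoint_inner_left, em_apply]
  simp [lp.inner_single_right, sh_zero]

theorem sh_amp (T : F →L[ℂ] F) : sh * amp T = amp T * sh := by
  ext f n
  cases n <;> simp [sh_zero, sh_succ, amp_apply]

theorem sha_amp (T : F →L[ℂ] F) : adjoint sh * amp T = amp T * adjoint sh := by
  have := congrArg adjoint (sh_amp (adjoint T))
  change adjoint (sh ∘L amp (adjoint T)) = adjoint (amp (adjoint T) ∘L sh) at this
  rw [adjoint_comp, adjoint_comp, amp_adjoint, adjoint_adjoint] at this
  exact this.symm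

theorem em_amp (T : F →L[ℂ] F) : amp T ∘L em = em ∘L T := by
  ext x n
  by_cases h : n = 0
  · subst h; simp [amp_apply, em_apply]
  · simp [amp_apply, em_apply, h]

theorem ema_amp (T : F →L[ℂ] F) : adjoint em ∘L amp T = T ∘L adjoint em := by
  have := congrArg adjoint (em_amp (adjoint T))
  simpa [adjoint_comp, amp_adjoint] using this
end amp

section ando
variable {K F : Type u} [NormedAddCommGroup K] [InnerProductSpace ℂ K] [CompleteSpace K]
  [NormedAddCommGroup F] [InnerProductSpace ℂ F] [CompleteSpace F]

/-- The Ando type isometry. -/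
noncomputable def Vop (X : K →L[ℂ] K) (α : K →L[ℂ] F) (p q : F →L[ℂ] F) :
    WithLp 2 (K × Sq F) →L[ℂ] WithLp 2 (K × Sq F) :=
  blk X 0 (em ∘L α) (amp p + sh * amp q)

/-- The diagonal operator. -/
noncomputable def Wop (b : K →L[ℂ] K) (c : F →L[ℂ] F) :
    WithLp 2 (K × Sq F) →L[ℂ] WithLp 2 (K × Sq F) :=
  blk b 0 0 (amp c)

theorem Wop_mul (b b' : K →L[ℂ] K) (c c' : F →L[ℂ] F) :
    Wop b c * Wop b' c' = Wop (b * b') (c * c') := by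
  simp [Wop, blk_mul, amp_mul]

theorem Wop_one : Wop (1 : K →L[ℂ] K) (1 : F →L[ℂ] F) = 1 := by
  simp [Wop, amp_one, blk_one]

theorem Wop_adjoint (b : K →L[ℂ] K) (c : F →L[ℂ] F) :
    adjoint (Wop b c) = Wop (adjoint b) (adjoint c) := by
  simp [Wop, blk_adjoint, amp_adjoint]

theorem Vop_iso (X : K →L[ℂ] K) (α : K →L[ℂ] F) (p q : F →L[ℂ] F)
    (h1 : adjoint X * X + adjoint α ∘L α = 1) (h2 : adjoint p * p + adjoint q * q = 1)
    (h3 : adjoint p * q = 0) (h4 : adjoint q * p = 0) (h5 : adjoint α ∘L p = 0)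
    (h6 : adjoint p ∘L α = 0) :
    adjoint (Vop X α p q) * Vop X α p q = 1 := by
  rw [Vop, blk_adjoint, blk_mul, ← blk_one]
  have e4 : adjoint (amp p + sh * amp q) = amp (adjoint p) + amp (adjoint q) * adjoint sh := by
    rw [map_add, amp_adjoint, ← star_eq_adjoint (sh * amp q), star_mul, star_eq_adjoint,
      star_eq_adjoint, amp_adjoint]
  have shs : ∀ x : Sq F, adjoint sh (sh x) = x := fun x => by
    simpa using congrArg (fun T => T x) (sh_iso (F := F))
  have shem : ∀ x : F, adjoint (sh : Sq F →L[ℂ] Sq F) (em x) = 0 := fun x => by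
    apply ext_inner_right ℂ
    intro g
    rw [adjoint_inner_left, ← adjoint_inner_right, em_sh]; simp
  have C1 : ∀ (T : F →L[ℂ] F) x, amp T (em x) = em (T x) := fun T x => by
    simpa using congrArg (fun S => S x) (em_amp T)
  have C2 : ∀ (T : F →L[ℂ] F) x, adjoint em (amp T x) = T (adjoint em x) := fun T x => by
    simpa using congrArg (fun S => S x) (ema_amp T)
  have C3 : ∀ (T : F →L[ℂ] F) x, amp T (sh x) = sh (amp T x) := fun T x => by
    simpa using congrArg (fun S => S x) (sh_amp T).symm
  have C4 : ∀ (T : F →L[ℂ] F) x, adjoint sh (amp T x) = amp T (adjoint sh x) := fun T x => by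
    simpa using congrArg (fun S => S x) (sha_amp T)
  have C5 : ∀ (S T : F →L[ℂ] F) x, amp S (amp T x) = amp (S * T) x := fun S T x => by
    rw [amp_mul]; rfl
  congr 1
  · rw [← h1]; ext x; simp [adjoint_comp, em_iso]
  · ext x
    have := congrArg (fun S => S (adjoint em x)) h5
    simp at this
    simp [adjoint_comp, C2, this, em_sh]
  · ext1 x
    have := congrArg (fun S => S x) h6
    simp at this
    rw [e4]
    simp [C1, this, shem]
  · rw [e4]
    ext1 x
    have h2' : amp (adjoint p * p) x + amp (adjoint q * q) x = x := by
      rw [← add_apply, ← amp_add, h2, amp_one]; rfl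
    simp [C3, C4, C5, shs, h3, h4, amp_zero, h2']

theorem Vop_comm (X₁ X₂ : K →L[ℂ] K) (α₁ α₂ : K →L[ℂ] F) (p₁ p₂ q₁ q₂ : F →L[ℂ] F)
    (hX : X₁ * X₂ = X₂ * X₁) (h1 : α₁ ∘L X₂ + p₁ ∘L α₂ = α₂ ∘L X₁ + p₂ ∘L α₁)
    (h2 : q₁ ∘L α₂ = q₂ ∘L α₁) (h3 : p₁ * p₂ = p₂ * p₁) (h4 : q₁ * q₂ = q₂ * q₁)
    (h5 : p₁ * q₂ + q₁ * p₂ = p₂ * q₁ + q₂ * p₁) :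
    Vop X₁ α₁ p₁ q₁ * Vop X₂ α₂ p₂ q₂ = Vop X₂ α₂ p₂ q₂ * Vop X₁ α₁ p₁ q₁ := by
  have C1 : ∀ (T : F →L[ℂ] F) x, amp T (em x) = em (T x) := fun T x => by
    simpa using congrArg (fun S => S x) (em_amp T)
  have C3 : ∀ (T : F →L[ℂ] F) x, amp T (sh x) = sh (amp T x) := fun T x => by
    simpa using congrArg (fun S => S x) (sh_amp T).symm
  have C5 : ∀ (S T : F →L[ℂ] F) x, amp S (amp T x) = amp (S * T) x := fun S T x => by
    rw [amp_mul]; rfl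
  rw [Vop, Vop, blk_mul, blk_mul]
  congr 1
  · simpa using hX
  · simp
  · ext1 x
    have h1' := congrArg (fun S => em (S x)) h1
    have h2' := congrArg (fun S => S x) h2
    simp at h1' h2'
    simp [C1, h2', ← add_assoc, h1']
  · ext1 x
    have h5' := congrArg (fun S => sh (amp S x)) h5
    simp [amp_add] at h5'
    simp [C3, C5, h3, h4]
    rw [add_assoc, ← add_assoc (sh _) (sh _), h5']
    simp only [add_assoc]

theorem Vop_Wop (X : K →L[ℂ] K) (α : K →L[ℂ] F) (p q : F →L[ℂ] F)
    (b : K →L[ℂ] K) (c : F →L[ℂ] F) (h1 : X * b = b * X) (h2 : α ∘L b = c ∘L α)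
    (h3 : p * c = c * p) (h4 : q * c = c * q) :
    Vop X α p q * Wop b c = Wop b c * Vop X α p q := by
  have C1 : ∀ (T : F →L[ℂ] F) x, amp T (em x) = em (T x) := fun T x => by
    simpa using congrArg (fun S => S x) (em_amp T)
  rw [Vop, Wop, blk_mul, blk_mul]
  congr 1
  · simpa using h1
  · simp
  · ext1 x
    have h2' := congrArg (fun S => S x) h2
    simp at h2'
    simp [C1, h2']
  · rw [add_mul, mul_add, mul_assoc, ← amp_mul, ← amp_mul, ← amp_mul, h3, h4,
      ← mul_assoc, ← sh_amp, mul_assoc, ← amp_mul]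
    simp

theorem Vop_inl (X : K →L[ℂ] K) (α : K →L[ℂ] F) (p q : F →L[ℂ] F) (h : K) :
    adjoint (Vop X α p q) (inl h) = inl (adjoint X h) := by
  rw [Vop, blk_adjoint]
  apply ds_ext <;> simp [blk_fst, blk_snd, inl_fst, inl_snd]

theorem Wop_inl (b : K →L[ℂ] K) (c : F →L[ℂ] F) (h : K) :
    adjoint (Wop b c) (inl h) = inl (adjoint b h) := by
  rw [Wop, blk_adjoint]
  apply ds_ext <;> simp [blk_fst, blk_snd, inl_fst, inl_snd]

end ando
end BD



namespace BD
open scoped InnerProductSpace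

section ando2
variable {K F : Type u} [NormedAddCommGroup K] [InnerProductSpace ℂ K] [CompleteSpace K]
  [NormedAddCommGroup F] [InnerProductSpace ℂ F] [CompleteSpace F]

theorem ando_aux (X₁ X₂ : K →L[ℂ] K) (δ₁ δ₂ : K →L[ℂ] F) (G Q : F →L[ℂ] F)
    (hX : X₁ * X₂ = X₂ * X₁)
    (hG : adjoint G * G = 1) (hG' : G * adjoint G = 1) (hQ : adjoint Q = Q) (hQQ : Q * Q = Q)
    (h1 : Q ∘L δ₁ = 0) (h2 : Q ∘L δ₂ = δ₂)
    (d1 : adjoint X₁ * X₁ + adjoint δ₁ ∘L δ₁ = 1)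
    (d2 : adjoint X₂ * X₂ + adjoint δ₂ ∘L δ₂ = 1)
    (hGδ : G ∘L (δ₂ + δ₁ ∘L X₂) = δ₂ ∘L X₁ + δ₁) :
    ∃ V₁ V₂ : WithLp 2 (K × Sq F) →L[ℂ] WithLp 2 (K × Sq F),
      adjoint V₁ * V₁ = 1 ∧ adjoint V₂ * V₂ = 1 ∧ V₁ * V₂ = V₂ * V₁ ∧
      (∀ h : K, adjoint V₁ (inl h) = inl (adjoint X₁ h)) ∧
      (∀ h : K, adjoint V₂ (inl h) = inl (adjoint X₂ h)) ∧
      (∀ (b : K →L[ℂ] K) (c : F →L[ℂ] F), X₁ * b = b * X₁ → X₂ * b = b * X₂ →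
        G * c = c * G → adjoint G * c = c * adjoint G → Q * c = c * Q →
        δ₁ ∘L b = c ∘L δ₁ → δ₂ ∘L b = c ∘L δ₂ →
        V₁ * Wop b c = Wop b c * V₁ ∧ V₂ * Wop b c = Wop b c * V₂) := by
  have eG : ∀ x, adjoint G (G x) = x := fun x => by
    simpa using congrArg (fun T => T x) hG
  have eG' : ∀ x, G (adjoint G x) = x := fun x => by
    simpa using congrArg (fun T => T x) hG'
  have eQ : ∀ x, Q (Q x) = Q x := fun x => by
    simpa using congrArg (fun T => T x) hQQ
  have e1 : ∀ x, Q (δ₁ x) = 0 := fun x => by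
    simpa using congrArg (fun T => T x) h1
  have e2 : ∀ x, Q (δ₂ x) = δ₂ x := fun x => by
    simpa using congrArg (fun T => T x) h2
  have e1' : ∀ x, adjoint δ₁ (Q x) = 0 := fun x => by
    have := congrArg (fun T => adjoint T x) h1
    simpa [adjoint_comp, hQ] using this
  have e2' : ∀ x, adjoint δ₂ (Q x) = adjoint δ₂ x := fun x => by
    have := congrArg (fun T => adjoint T x) h2
    simpa [adjoint_comp, hQ] using this
  have a1 : adjoint (G * Q) = Q * adjoint G := by
    change adjoint (G ∘L Q) = _
    rw [adjoint_comp, hQ]; rfl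
  have a2 : adjoint (G * (1 - Q)) = (1 - Q) * adjoint G := by
    change adjoint (G ∘L (1 - Q)) = _
    rw [adjoint_comp, map_sub, hQ, ← star_eq_adjoint 1, star_one]; rfl
  have a3 : adjoint ((1 - Q) * adjoint G) = G * (1 - Q) := by rw [← a2, adjoint_adjoint]
  have a4 : adjoint (Q * adjoint G) = G * Q := by rw [← a1, adjoint_adjoint]
  refine ⟨Vop X₁ (G ∘L δ₁) (G * Q) (G * (1 - Q)), Vop X₂ δ₂ ((1 - Q) * adjoint G) (Q * adjoint G),
    ?_, ?_, ?_, fun h => Vop_inl _ _ _ _ h, fun h => Vop_inl _ _ _ _ h, ?_⟩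
  · apply Vop_iso
    · rw [← d1]; ext x; simp [adjoint_comp, eG]
    · rw [a1, a2]; ext x; simp [eG, eQ]
    · rw [a1]; ext x; simp [eG, eQ]
    · rw [a2]; ext x; simp [eG, eQ]
    · ext x; simp [adjoint_comp, eG, e1']
    · rw [a1]; ext x; simp [eG, e1]
  · apply Vop_iso
    · rw [← d2]
    · rw [a3, a4]; ext x; simp [eG', eQ]
    · rw [a3]; ext x; simp [eQ]
    · rw [a4]; ext x; simp [eQ]
    · ext x; simp [e2']
    · rw [a3]; ext x; simp [e2]
  · apply Vop_comm
    · exact hX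
    · ext x
      have := congrArg (fun T => T x) hGδ
      simp at this
      simp [e1, e2, eG, ← this, add_comm]
    · ext x; simp [e1, e2, eG]
    · ext x; simp [eG, eQ]
    · ext x; simp [eG, eQ]
    · ext x; simp [eG, eG', eQ]
  · intro b c k1 k2 k3 k4 k5 k6 k7
    have k5' : (1 - Q) * c = c * (1 - Q) := by rw [sub_mul, mul_sub, k5]; simp
    have e3 : ∀ x, G (c x) = c (G x) := fun x => by
      simpa using congrArg (fun T => T x) k3
    constructor
    · apply Vop_Wop
      · exact k1
      · rw [comp_assoc, k6]; ext x; simp [e3]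
      · rw [mul_assoc, k5, ← mul_assoc, k3, mul_assoc]
      · rw [mul_assoc, k5', ← mul_assoc, k3, mul_assoc]
    · apply Vop_Wop
      · exact k2
      · exact k7
      · rw [mul_assoc, k4, ← mul_assoc, k5', mul_assoc]
      · rw [mul_assoc, k4, ← mul_assoc, k5, mul_assoc]

theorem defect (X : K →L[ℂ] K) (hX : ∀ x, ‖X x‖ ≤ ‖x‖) :
    ∃ D : K →L[ℂ] K, adjoint X * X + adjoint D * D = 1 ∧
      ∀ b : K →L[ℂ] K, X * b = b * X → adjoint X * b = b * adjoint X → D * b = b * D := by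
  have hpos : (0 : K →L[ℂ] K) ≤ 1 - adjoint X * X := by
    rw [ContinuousLinearMap.nonneg_iff_isPositive, ContinuousLinearMap.isPositive_def']
    constructor
    · rw [IsSelfAdjoint, star_sub, star_one, ← star_eq_adjoint, star_mul, star_star]
    · intro x
      simp only [reApplyInnerSelf_apply, sub_apply, inner_sub_left]
      have : ⟪(adjoint X * X) x, x⟫_ℂ = ⟪X x, X x⟫_ℂ := by
        change ⟪adjoint X (X x), x⟫_ℂ = _
        rw [adjoint_inner_left]
      rw [this, show (1 : K →L[ℂ] K) x = x from rfl, inner_self_eq_norm_sq_to_K, inner_self_eq_norm_sq_to_K]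
      have h2 := pow_le_pow_left₀ (norm_nonneg _) (hX x) 2
      norm_cast
      simpa using h2
  refine ⟨CFC.sqrt (1 - adjoint X * X), ?_, ?_⟩
  · have hs : IsSelfAdjoint (CFC.sqrt (1 - adjoint X * X)) :=
      IsSelfAdjoint.of_nonneg (CFC.sqrt_nonneg _)
    rw [hs.adjoint_eq, CFC.sqrt_mul_sqrt_self _ hpos]
    abel
  · intro b h1 h2
    have : Commute (1 - adjoint X * X) b := by
      change _ * _ = _ * _
      rw [sub_mul, mul_sub, one_mul, mul_one, mul_assoc, h1, ← mul_assoc, h2, mul_assoc]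
    exact Commute.cfcₙ_nnreal this _
end ando2
end BD



namespace BD
open scoped InnerProductSpace


section ando3
variable {K X Y : Type u} [NormedAddCommGroup K] [InnerProductSpace ℂ K] [CompleteSpace K]
  [NormedAddCommGroup X] [InnerProductSpace ℂ X] [CompleteSpace X]
  [NormedAddCommGroup Y] [InnerProductSpace ℂ Y] [CompleteSpace Y]

/-- Pairing of two operators into a direct sum. -/
noncomputable def prL (a : K →L[ℂ] X) (b : K →L[ℂ] Y) : K →L[ℂ] WithLp 2 (X × Y) :=
  (WithLp.prodContinuousLinearEquiv 2 ℂ X Y).symm.toContinuousLinearMap ∘L (a.prod b)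

theorem prL_fst (a : K →L[ℂ] X) (b : K →L[ℂ] Y) (x : K) : (prL a b x).fst = a x := rfl
theorem prL_snd (a : K →L[ℂ] X) (b : K →L[ℂ] Y) (x : K) : (prL a b x).snd = b x := rfl

theorem prL_adj (a : K →L[ℂ] X) (b : K →L[ℂ] Y) :
    adjoint (prL a b) ∘L prL a b = adjoint a ∘L a + adjoint b ∘L b := by
  ext x
  apply ext_inner_right ℂ
  intro y
  simp [adjoint_inner_left, WithLp.prod_inner_apply, prL_fst, prL_snd, inner_add_left]

/-- Diagonal operator on `K ⊕ K`. -/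
noncomputable abbrev dg (b : K →L[ℂ] K) : WithLp 2 (K × K) →L[ℂ] WithLp 2 (K × K) := blk b 0 0 b

/-- Diagonal operator on four copies. -/
noncomputable abbrev dg4 (b : K →L[ℂ] K) :
    WithLp 2 (WithLp 2 (K × K) × WithLp 2 (K × K)) →L[ℂ]
      WithLp 2 (WithLp 2 (K × K) × WithLp 2 (K × K)) := dg (dg b)

theorem dg_mul (b c : K →L[ℂ] K) : dg b * dg c = dg (b * c) := by
  simp [dg, blk_mul]

theorem dg_one : dg (1 : K →L[ℂ] K) = 1 := blk_one

theorem dg_adjoint (b : K →L[ℂ] K) : adjoint (dg b) = dg (adjoint b) := by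
  simp [dg, blk_adjoint]

theorem halmos (u : X →L[ℂ] X) (U1 : ∀ x, u (adjoint u (u x)) = u x) :
    ∃ G : WithLp 2 (X × X) →L[ℂ] WithLp 2 (X × X), adjoint G * G = 1 ∧ G * adjoint G = 1 ∧
      (∀ x, adjoint u (u x) = x → G (prL 1 0 x) = prL u 0 x) ∧
      ∀ b, u * b = b * u → adjoint u * b = b * adjoint u →
        G * dg b = dg b * G ∧ adjoint G * dg b = dg b * adjoint G := by
  have U1 : u * adjoint u * u = u := by ext1 x; exact U1 x
  have U2 : adjoint u * u * adjoint u = adjoint u := by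
    have := congrArg adjoint U1
    simpa [← star_eq_adjoint, mul_assoc] using this
  have a1 : adjoint (1 - u * adjoint u) = 1 - u * adjoint u := by
    simp [← star_eq_adjoint]
  have a2 : adjoint (1 - adjoint u * u) = 1 - adjoint u * u := by
    simp [← star_eq_adjoint]
  have Gadj : adjoint (blk u (1 - u * adjoint u) (1 - adjoint u * u) (adjoint u)) =
      blk (adjoint u) (1 - adjoint u * u) (1 - u * adjoint u) u := by
    rw [blk_adjoint, a1, a2, adjoint_adjoint]
  have U3 : u * (adjoint u * u) = u := by rw [← mul_assoc, U1]
  have U4 : adjoint u * (u * adjoint u) = adjoint u := by rw [← mul_assoc, U2]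
  refine ⟨blk u (1 - u * adjoint u) (1 - adjoint u * u) (adjoint u), ?_, ?_, ?_, ?_⟩
  · rw [Gadj, blk_mul]
    refine Eq.trans ?_ blk_one
    simp only [← mul_def]
    congr 1 <;> simp only [mul_sub, sub_mul, mul_one, one_mul, mul_assoc, U3, U4] <;> abel
  · rw [Gadj, blk_mul]
    refine Eq.trans ?_ blk_one
    simp only [← mul_def]
    congr 1 <;> simp only [mul_sub, sub_mul, mul_one, one_mul, mul_assoc, U3, U4] <;> abel
  · intro x hx
    apply ds_ext
    · simp [blk_fst, prL_fst, prL_snd]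
    · simp [blk_snd, prL_fst, prL_snd, hx]
  · intro b uc ua
    have z1 : (1 - u * adjoint u) * b = b * (1 - u * adjoint u) := by
      rw [sub_mul, mul_sub, one_mul, mul_one, mul_assoc, ua, ← mul_assoc, uc, mul_assoc]
    have z2 : (1 - adjoint u * u) * b = b * (1 - adjoint u * u) := by
      rw [sub_mul, mul_sub, one_mul, mul_one, mul_assoc, uc, ← mul_assoc, ua, mul_assoc]
    constructor
    · rw [blk_mul, blk_mul]
      simp only [← mul_def, uc, ua, z1, z2]
      simp
    · rw [Gadj, blk_mul, blk_mul]
      simp only [← mul_def, uc, ua, z1, z2]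
      simp

/-- Four copies of `K`. -/
abbrev Four (K : Type u) : Type u := WithLp 2 (WithLp 2 (K × K) × WithLp 2 (K × K))

/-- The dilation space. -/
abbrev Big (K : Type u) [NormedAddCommGroup K] : Type u := WithLp 2 (K × Sq (Four K))

/-- Diagonal ampliation to the dilation space. -/
noncomputable def rho (b : K →L[ℂ] K) : Big K →L[ℂ] Big K := Wop b (dg4 b)

theorem rho_mul (b c : K →L[ℂ] K) : rho b * rho c = rho (b * c) := by
  rw [rho, rho, rho, Wop_mul, dg_mul, dg_mul]

theorem rho_one : rho (1 : K →L[ℂ] K) = 1 := by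
  rw [rho, dg4, dg_one, dg_one, Wop_one]

theorem rho_adjoint (b : K →L[ℂ] K) : adjoint (rho b) = rho (adjoint b) := by
  rw [rho, rho, Wop_adjoint, dg_adjoint, dg_adjoint]

theorem rho_inl (b : K →L[ℂ] K) (h : K) : adjoint (rho b) (inl h) = inl (adjoint b h) :=
  Wop_inl _ _ _

set_option maxHeartbeats 400000 in
theorem ando (X₁ X₂ : K →L[ℂ] K) (hX : X₁ * X₂ = X₂ * X₁)
    (n1 : ∀ x, ‖X₁ x‖ ≤ ‖x‖) (n2 : ∀ x, ‖X₂ x‖ ≤ ‖x‖) :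
    ∃ (V₁ V₂ : Big K →L[ℂ] Big K),
      adjoint V₁ * V₁ = 1 ∧ adjoint V₂ * V₂ = 1 ∧ V₁ * V₂ = V₂ * V₁ ∧
      (∀ h : K, adjoint V₁ (inl h) = inl (adjoint X₁ h)) ∧
      (∀ h : K, adjoint V₂ (inl h) = inl (adjoint X₂ h)) ∧
      (∀ b, X₁ * b = b * X₁ → X₂ * b = b * X₂ → adjoint X₁ * b = b * adjoint X₁ →
        adjoint X₂ * b = b * adjoint X₂ →
        V₁ * rho b = rho b * V₁ ∧ V₂ * rho b = rho b * V₂) := by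
  obtain ⟨D₁, hD₁, cD₁⟩ := defect X₁ n1
  obtain ⟨D₂, hD₂, cD₂⟩ := defect X₂ n2
  let C₁ : K →L[ℂ] WithLp 2 (K × K) := prL D₂ (D₁ ∘L X₂)
  let C₂ : K →L[ℂ] WithLp 2 (K × K) := prL (D₂ ∘L X₁) D₁
  have ip1 : ∀ x y, ⟪D₁ x, D₁ y⟫_ℂ = ⟪x, y⟫_ℂ - ⟪X₁ x, X₁ y⟫_ℂ := by
    intro x y
    have := congrArg (fun T => ⟪T x, y⟫_ℂ) hD₁
    simp [adjoint_inner_left] at this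
    rw [← this]; ring
  have ip2 : ∀ x y, ⟪D₂ x, D₂ y⟫_ℂ = ⟪x, y⟫_ℂ - ⟪X₂ x, X₂ y⟫_ℂ := by
    intro x y
    have := congrArg (fun T => ⟪T x, y⟫_ℂ) hD₂
    simp [adjoint_inner_left] at this
    rw [← this]; ring
  have eX : ∀ x, X₁ (X₂ x) = X₂ (X₁ x) := fun x => by
    simpa using congrArg (fun T => T x) hX
  let R : Submodule ℂ (WithLp 2 (WithLp 2 (K × K) × WithLp 2 (K × K))) :=
    LinearMap.range (prL C₁ C₂ : K →ₗ[ℂ] WithLp 2 (WithLp 2 (K × K) × WithLp 2 (K × K)))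
  obtain ⟨u, hu1, hu2, -, hu4⟩ := exists_partial_iso R (by
    rintro _ ⟨x, rfl⟩ _ ⟨y, rfl⟩
    change ⟪C₁ x, C₁ y⟫_ℂ = ⟪C₂ x, C₂ y⟫_ℂ
    simp [C₁, C₂, WithLp.prod_inner_apply, prL_fst, prL_snd, ip1, ip2, eX])
  have hu1' : ∀ x, u (C₁ x) = C₂ x := fun x => (hu1 _ ⟨x, rfl⟩).1
  have hu1a : ∀ x, adjoint u (C₂ x) = C₁ x := fun x => (hu1 _ ⟨x, rfl⟩).2
  obtain ⟨G, hG, hG', hGx, hGc⟩ := halmos u hu2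
  let Q : WithLp 2 (WithLp 2 (K × K) × WithLp 2 (K × K)) →L[ℂ]
      WithLp 2 (WithLp 2 (K × K) × WithLp 2 (K × K)) := blk (blk 1 0 0 0) 0 0 0
  have one_adj : adjoint (1 : K →L[ℂ] K) = 1 := by rw [← star_eq_adjoint, star_one]
  have hQ : adjoint Q = Q := by simp [Q, blk_adjoint, one_adj]
  have hQQ : Q * Q = Q := by simp [Q, blk_mul]
  let δ₁ : K →L[ℂ] WithLp 2 (WithLp 2 (K × K) × WithLp 2 (K × K)) := prL (prL 0 D₁) 0
  let δ₂ : K →L[ℂ] WithLp 2 (WithLp 2 (K × K) × WithLp 2 (K × K)) := prL (prL D₂ 0) 0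
  obtain ⟨V₁, V₂, v1, v2, v3, v4, v5, v6⟩ := ando_aux X₁ X₂ δ₁ δ₂ G Q hX hG hG' hQ hQQ
    (by ext x; apply ds_ext <;> try apply ds_ext
        all_goals simp [Q, δ₁, blk_fst, blk_snd, prL_fst, prL_snd])
    (by ext x; apply ds_ext <;> try apply ds_ext
        all_goals simp [Q, δ₂, blk_fst, blk_snd, prL_fst, prL_snd])
    (by rw [← hD₁]; simp [δ₁, prL_adj, mul_def])
    (by rw [← hD₂]; simp [δ₂, prL_adj, mul_def])
    (by
      ext x
      have e1 : (δ₂ + δ₁ ∘L X₂) x = prL C₁ 0 x := by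
        apply ds_ext <;> try apply ds_ext
        all_goals simp [δ₁, δ₂, C₁, prL_fst, prL_snd]
      have e2 : (δ₂ ∘L X₁ + δ₁) x = prL C₂ 0 x := by
        apply ds_ext <;> try apply ds_ext
        all_goals simp [δ₁, δ₂, C₂, prL_fst, prL_snd]
      rw [comp_apply, e1, e2]
      have := hGx (C₁ x) (by rw [hu1', hu1a])
      change G (prL 1 0 (C₁ x)) = _
      rw [this]
      apply ds_ext
      · exact hu1' x
      · rfl)
  refine ⟨V₁, V₂, v1, v2, v3, v4, v5, ?_⟩
  · intro b k1 k2 k3 k4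
    have s1 : X₁ * adjoint b = adjoint b * X₁ := by
      have := congrArg adjoint k3
      simpa [← star_eq_adjoint] using this.symm
    have s2 : X₂ * adjoint b = adjoint b * X₂ := by
      have := congrArg adjoint k4
      simpa [← star_eq_adjoint] using this.symm
    have s3 : adjoint X₁ * adjoint b = adjoint b * adjoint X₁ := by
      have := congrArg adjoint k1
      simpa [← star_eq_adjoint] using this.symm
    have s4 : adjoint X₂ * adjoint b = adjoint b * adjoint X₂ := by
      have := congrArg adjoint k2
      simpa [← star_eq_adjoint] using this.symm
    have key : ∀ c : K →L[ℂ] K, X₁ * c = c * X₁ → X₂ * c = c * X₂ →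
        adjoint X₁ * c = c * adjoint X₁ → adjoint X₂ * c = c * adjoint X₂ →
        ∀ x, dg c (C₁ x) = C₁ (c x) ∧ dg c (C₂ x) = C₂ (c x) := by
      intro c t1 t2 t3 t4 x
      have w1 := fun y => congrArg (fun T => T y) (cD₁ c t1 t3)
      have w2 := fun y => congrArg (fun T => T y) (cD₂ c t2 t4)
      have w3 := fun y => congrArg (fun T => T y) t1
      have w4 := fun y => congrArg (fun T => T y) t2
      simp at w1 w2 w3 w4
      constructor <;> apply ds_ext <;>
        simp [C₁, C₂, blk_fst, blk_snd, prL_fst, prL_snd, w1, w2, w3, w4]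
    have uc : u * dg b = dg b * u := by
      ext1 x
      refine hu4 (dg b) (dg b) ?_ ?_ x
      · rintro _ ⟨x, rfl⟩
        refine ⟨b x, ?_⟩
        obtain ⟨r1, r2⟩ := key b k1 k2 k3 k4 x
        exact ds_ext r1.symm r2.symm
      · rw [dg_adjoint]
        rintro _ ⟨x, rfl⟩
        refine ⟨adjoint b x, ?_⟩
        obtain ⟨r1, r2⟩ := key _ s1 s2 s3 s4 x
        exact ds_ext r1.symm r2.symm
    have uc' : u * dg (adjoint b) = dg (adjoint b) * u := by
      ext1 x
      refine hu4 (dg (adjoint b)) (dg (adjoint b)) ?_ ?_ x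
      · rintro _ ⟨x, rfl⟩
        refine ⟨adjoint b x, ?_⟩
        obtain ⟨r1, r2⟩ := key _ s1 s2 s3 s4 x
        exact ds_ext r1.symm r2.symm
      · rw [dg_adjoint, adjoint_adjoint]
        rintro _ ⟨x, rfl⟩
        refine ⟨b x, ?_⟩
        obtain ⟨r1, r2⟩ := key b k1 k2 k3 k4 x
        exact ds_ext r1.symm r2.symm
    have ua : adjoint u * dg b = dg b * adjoint u := by
      have := congrArg adjoint uc'
      rw [mul_def, mul_def, adjoint_comp, adjoint_comp, dg_adjoint, adjoint_adjoint] at this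
      exact this.symm
    apply v6 b (dg4 b) k1 k2
    · exact (hGc _ uc ua).1
    · exact (hGc _ uc ua).2
    · simp [Q, dg4, dg, blk_mul]
    · have w1 := fun y => congrArg (fun T => T y) (cD₁ b k1 k3)
      simp at w1
      ext x
      apply ds_ext <;> try apply ds_ext
      all_goals simp [δ₁, blk_fst, blk_snd, prL_fst, prL_snd, w1]
    · have w1 := fun y => congrArg (fun T => T y) (cD₂ b k2 k4)
      simp at w1
      ext x
      apply ds_ext <;> try apply ds_ext
      all_goals simp [δ₂, blk_fst, blk_snd, prL_fst, prL_snd, w1]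
end ando3
end BD



namespace BD
open scoped InnerProductSpace



section words
variable {H K L : Type u} [NormedAddCommGroup H] [InnerProductSpace ℂ H] [CompleteSpace H]
  [NormedAddCommGroup K] [InnerProductSpace ℂ K] [CompleteSpace K]
  [NormedAddCommGroup L] [InnerProductSpace ℂ L] [CompleteSpace L] {k : ℕ}

/-- Product of the operators along a word. -/
noncomputable def wd (B : Fin k → (K →L[ℂ] K)) (w : List (Fin k)) : K →L[ℂ] K := (w.map B).prod

theorem wd_nil (B : Fin k → (K →L[ℂ] K)) (x : K) : wd B [] x = x := rfl

theorem wd_cons (B : Fin k → (K →L[ℂ] K)) (j : Fin k) (w : List (Fin k)) (x : K) :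
    wd B (j :: w) x = B j (wd B w x) := by
  simp [wd]

theorem wd_comm (B : Fin k → (K →L[ℂ] K)) (A : K →L[ℂ] K) (hA : ∀ j, A * B j = B j * A)
    (w : List (Fin k)) (x : K) : A (wd B w x) = wd B w (A x) := by
  induction w with
  | nil => rfl
  | cons j w ih =>
    rw [wd_cons, wd_cons, ← ih]
    exact congrArg (fun T => T (wd B w x)) (hA j)

theorem wd_adj (B : Fin k → (K →L[ℂ] K)) (T : Fin k → (H →L[ℂ] H)) (ι : H →ₗᵢ[ℂ] K)
    (hB : ∀ j, adjoint (B j) * B j = 1)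
    (hBB : ∀ j j', j ≠ j' → B j * B j' = B j' * B j ∧
      adjoint (B j) * B j' = B j' * adjoint (B j))
    (hT : ∀ (j : Fin k) (h : H), adjoint (B j) (ι h) = ι (adjoint (T j) h))
    (j : Fin k) (v : List (Fin k)) (g : H) :
    adjoint (B j) (wd B v (ι g)) =
      wd B (v.erase j) (ι (if j ∈ v then g else adjoint (T j) g)) := by
  induction v with
  | nil => simp [wd_nil, hT]
  | cons i v ih =>
    by_cases hij : i = j
    · subst hij
      rw [wd_cons]
      have := congrArg (fun S => S (wd B v (ι g))) (hB i)
      simpa using this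
    · have h1 := congrArg (fun S => S (wd B v (ι g))) (hBB j i (Ne.symm hij)).2
      change adjoint (B j) (B i (wd B v (ι g))) = B i (adjoint (B j) (wd B v (ι g))) at h1
      rw [wd_cons, h1, ih, List.erase_cons_tail (by simpa using hij), wd_cons]
      simp [Ne.symm hij]

theorem gram (B : Fin k → (K →L[ℂ] K)) (B' : Fin k → (L →L[ℂ] L))
    (T : Fin k → (H →L[ℂ] H)) (ι : H →ₗᵢ[ℂ] K) (ι' : H →ₗᵢ[ℂ] L)
    (hB : ∀ j, adjoint (B j) * B j = 1)
    (hBB : ∀ j j', j ≠ j' → B j * B j' = B j' * B j ∧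
      adjoint (B j) * B j' = B j' * adjoint (B j))
    (hT : ∀ (j : Fin k) (h : H), adjoint (B j) (ι h) = ι (adjoint (T j) h))
    (hB' : ∀ j, adjoint (B' j) * B' j = 1)
    (hBB' : ∀ j j', j ≠ j' → B' j * B' j' = B' j' * B' j ∧
      adjoint (B' j) * B' j' = B' j' * adjoint (B' j))
    (hT' : ∀ (j : Fin k) (h : H), adjoint (B' j) (ι' h) = ι' (adjoint (T j) h))
    (w v : List (Fin k)) (h g : H) :
    ⟪wd B w (ι h), wd B v (ι g)⟫_ℂ = ⟪wd B' w (ι' h), wd B' v (ι' g)⟫_ℂ := by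
  induction w generalizing v g with
  | nil =>
    simp only [wd_nil]
    induction v generalizing h with
    | nil => simp [wd_nil]
    | cons j v ih =>
      rw [wd_cons, wd_cons, ← adjoint_inner_left (B j), ← adjoint_inner_left (B' j), hT, hT', ih]
  | cons j w ih =>
    rw [wd_cons, wd_cons, ← adjoint_inner_right (B j), ← adjoint_inner_right (B' j),
      wd_adj B T ι hB hBB hT, wd_adj B' T ι' hB' hBB' hT', ih]

theorem transfer (S₁ S₂ : H →L[ℂ] H) (T : Fin k → (H →L[ℂ] H)) (hS : S₁ * S₂ = S₂ * S₁)
    (ι : H →ₗᵢ[ℂ] K) (A : K →L[ℂ] K) (B : Fin k → (K →L[ℂ] K))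
    (hA : adjoint A * A = 1) (hB : ∀ j, adjoint (B j) * B j = 1)
    (hAB : ∀ j, A * B j = B j * A ∧ adjoint A * B j = B j * adjoint A)
    (hBB : ∀ j j', j ≠ j' → B j * B j' = B j' * B j ∧
      adjoint (B j) * B j' = B j' * adjoint (B j))
    (hS₁ : ∀ h : H, adjoint A (ι h) = ι (adjoint S₁ h))
    (hT : ∀ (j : Fin k) (h : H), adjoint (B j) (ι h) = ι (adjoint (T j) h))
    (ι' : H →ₗᵢ[ℂ] L) (A' : L →L[ℂ] L) (B' : Fin k → (L →L[ℂ] L))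
    (hA' : adjoint A' * A' = 1) (hB' : ∀ j, adjoint (B' j) * B' j = 1)
    (hAB' : ∀ j, A' * B' j = B' j * A' ∧ adjoint A' * B' j = B' j * adjoint A')
    (hBB' : ∀ j j', j ≠ j' → B' j * B' j' = B' j' * B' j ∧
      adjoint (B' j) * B' j' = B' j' * adjoint (B' j))
    (hS₂ : ∀ h : H, adjoint A' (ι' h) = ι' (adjoint S₂ h))
    (hT' : ∀ (j : Fin k) (h : H), adjoint (B' j) (ι' h) = ι' (adjoint (T j) h)) :
    ∃ X₁ X₂ : K →L[ℂ] K, X₁ * X₂ = X₂ * X₁ ∧ (∀ x, ‖X₁ x‖ ≤ ‖x‖) ∧ (∀ x, ‖X₂ x‖ ≤ ‖x‖) ∧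
      (∀ j, X₁ * B j = B j * X₁ ∧ adjoint X₁ * B j = B j * adjoint X₁) ∧
      (∀ j, X₂ * B j = B j * X₂ ∧ adjoint X₂ * B j = B j * adjoint X₂) ∧
      (∀ h : H, adjoint X₁ (ι h) = ι (adjoint S₁ h)) ∧
      (∀ h : H, adjoint X₂ (ι h) = ι (adjoint S₂ h)) := by
  let s : Set (WithLp 2 (K × L)) :=
    {p | ∃ w h, p = WithLp.toLp 2 (wd B w (ι h), wd B' w (ι' h))}
  let R := Submodule.span ℂ s
  obtain ⟨u, hu1, hu2, hu3, hu4⟩ := exists_partial_iso R (by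
    intro p hp q hq
    induction hp, hq using Submodule.span_induction₂ with
    | mem_mem x y hx hy =>
      obtain ⟨w, h, rfl⟩ := hx
      obtain ⟨v, g, rfl⟩ := hy
      exact gram B B' T ι ι' hB hBB hT hB' hBB' hT' w v h g
    | zero_left y hy => simp
    | zero_right x hx => simp
    | add_left x y z hx hy hz h1 h2 => simp [inner_add_left, h1, h2]
    | add_right x y z hx hy hz h1 h2 => simp [inner_add_right, h1, h2]
    | smul_left r x y hx hy h1 => simp [inner_smul_left, h1]
    | smul_right r x y hx hy h1 => simp [inner_smul_right, h1])
  have g1 : ∀ w h, u (wd B w (ι h)) = wd B' w (ι' h) := fun w h =>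
    (hu1 _ (Submodule.subset_span ⟨w, h, rfl⟩)).1
  have g2 : ∀ w h, adjoint u (wd B' w (ι' h)) = wd B w (ι h) := fun w h =>
    (hu1 _ (Submodule.subset_span ⟨w, h, rfl⟩)).2
  have orth : ∀ x, (∀ y ∈ {y | ∃ w h, y = wd B w (ι h)}, ⟪y, x⟫_ℂ = 0) → u x = 0 := by
    intro x hx
    apply hu3
    intro p hp
    induction hp using Submodule.span_induction with
    | mem p hp =>
      obtain ⟨w, h, rfl⟩ := hp
      exact hx _ ⟨w, h, rfl⟩
    | zero => simp
    | add p q hp hq h1 h2 => simp [inner_add_left, h1, h2]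
    | smul a p hp h1 => simp [inner_smul_left, h1]
  -- invariance of `R`
  have inv : ∀ (a : K →L[ℂ] K) (b : L →L[ℂ] L),
      (∀ w h, WithLp.toLp 2 (a (wd B w (ι h)), b (wd B' w (ι' h))) ∈ R) →
      ∀ p ∈ R, WithLp.toLp 2 (a p.fst, b p.snd) ∈ R := by
    intro a b hab p hp
    induction hp using Submodule.span_induction with
    | mem p hp =>
      obtain ⟨w, h, rfl⟩ := hp
      exact hab w h
    | zero =>
      convert R.zero_mem using 1
      apply ds_ext <;> simp
    | add p q hp hq h1 h2 =>
      convert R.add_mem h1 h2 using 1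
      apply ds_ext <;> simp
    | smul c p hp h1 =>
      convert R.smul_mem c h1 using 1
      apply ds_ext <;> simp
  have inv1 : ∀ j, ∀ p ∈ R, WithLp.toLp 2 (B j p.fst, B' j p.snd) ∈ R := fun j =>
    inv _ _ fun w h => Submodule.subset_span ⟨j :: w, h, by rw [wd_cons, wd_cons]⟩
  have inv2 : ∀ j, ∀ p ∈ R, WithLp.toLp 2 (adjoint (B j) p.fst, adjoint (B' j) p.snd) ∈ R :=
    fun j => inv _ _ fun w h => Submodule.subset_span ⟨w.erase j, _, by
      rw [wd_adj B T ι hB hBB hT, wd_adj B' T ι' hB' hBB' hT']⟩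
  have c1 : ∀ j x, u (B j x) = B' j (u x) := fun j => hu4 _ _ (inv1 j) (inv2 j)
  have c2 : ∀ j x, u (adjoint (B j) x) = adjoint (B' j) (u x) := fun j =>
    hu4 _ _ (inv2 j) (by simpa using inv1 j)
  have c3 : ∀ j y, adjoint u (B' j y) = B j (adjoint u y) := by
    intro j y
    apply ext_inner_right ℂ
    intro x
    rw [adjoint_inner_left, ← adjoint_inner_right, ← c2, ← adjoint_inner_left,
      ← adjoint_inner_right (B j)]
  have nu : ∀ x, ‖u x‖ ≤ ‖x‖ := by
    intro x
    have h1 : ‖adjoint u (u x)‖ = ‖u x‖ := by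
      have : ⟪adjoint u (u x), adjoint u (u x)⟫_ℂ = ⟪u x, u x⟫_ℂ := by
        rw [adjoint_inner_left, hu2]
      rw [inner_self_eq_norm_sq_to_K, inner_self_eq_norm_sq_to_K] at this
      norm_cast at this
      exact (sq_eq_sq₀ (norm_nonneg _) (norm_nonneg _)).1 this
    have h2 : ‖u x‖ * ‖u x‖ ≤ ‖u x‖ * ‖x‖ := by
      have h3 : ⟪u x, u x⟫_ℂ = ⟪adjoint u (u x), x⟫_ℂ := by rw [adjoint_inner_left]
      have h4 := norm_inner_le_norm (𝕜 := ℂ) (adjoint u (u x)) x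
      rw [← h3, h1, inner_self_eq_norm_sq_to_K] at h4
      simpa [sq] using h4
    by_contra hc
    push Not at hc
    have : 0 < ‖u x‖ := lt_of_le_of_lt (norm_nonneg _) hc
    nlinarith
  have nu' : ∀ y, ‖adjoint u y‖ ≤ ‖y‖ := by
    intro y
    have h1 : ‖u‖ ≤ 1 := u.opNorm_le_bound zero_le_one (by simpa using nu)
    have h2 : ‖adjoint u‖ ≤ 1 := by rwa [LinearIsometryEquiv.norm_map]
    simpa using (adjoint u).le_of_opNorm_le h2 y
  have iso : ∀ {Z : Type u} [NormedAddCommGroup Z] [InnerProductSpace ℂ Z] [CompleteSpace Z]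
      (V : Z →L[ℂ] Z), adjoint V * V = 1 → ∀ x, ‖V x‖ ≤ ‖x‖ := by
    intro Z _ _ _ V hV x
    have : ⟪V x, V x⟫_ℂ = ⟪x, x⟫_ℂ := by
      rw [← adjoint_inner_left]
      have := congrArg (fun S => ⟪S x, x⟫_ℂ) hV
      simpa using this
    rw [inner_self_eq_norm_sq_to_K, inner_self_eq_norm_sq_to_K] at this
    norm_cast at this
    exact ((sq_eq_sq₀ (norm_nonneg _) (norm_nonneg _)).1 this).le
  let X₁ : K →L[ℂ] K := adjoint u ∘L u ∘L A ∘L adjoint u ∘L u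
  let X₂ : K →L[ℂ] K := adjoint u ∘L A' ∘L u
  have x1 : ∀ x, X₁ x = adjoint u (u (A (adjoint u (u x)))) := fun x => rfl
  have x2 : ∀ x, X₂ x = adjoint u (A' (u x)) := fun x => rfl
  have x1a : ∀ x, adjoint X₁ x = adjoint u (u (adjoint A (adjoint u (u x)))) := fun x => by
    simp [X₁, adjoint_comp]
  have x2a : ∀ x, adjoint X₂ x = adjoint u (adjoint A' (u x)) := fun x => by
    simp [X₂, adjoint_comp]
  have y1 : ∀ w h, adjoint X₁ (wd B w (ι h)) = wd B w (ι (adjoint S₁ h)) := by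
    intro w h
    rw [x1a, g1, g2, wd_comm B _ (fun j => (hAB j).2), hS₁, g1, g2]
  have y2 : ∀ w h, adjoint X₂ (wd B w (ι h)) = wd B w (ι (adjoint S₂ h)) := by
    intro w h
    rw [x2a, g1, wd_comm B' _ (fun j => (hAB' j).2), hS₂, g2]
  have hS' : ∀ h, adjoint S₁ (adjoint S₂ h) = adjoint S₂ (adjoint S₁ h) := by
    intro h
    have := congrArg (fun S => adjoint S h) hS
    simp only [mul_def, adjoint_comp] at this
    exact this.symm
  have comm' : adjoint X₁ * adjoint X₂ = adjoint X₂ * adjoint X₁ := by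
    refine ext_of_orth {y | ∃ w h, y = wd B w (ι h)} ?_ ?_
    · rintro _ ⟨w, h, rfl⟩
      change adjoint X₁ (adjoint X₂ _) = adjoint X₂ (adjoint X₁ _)
      rw [y1, y2, y1, y2, hS']
    · intro x hx
      have h0 := orth x hx
      change adjoint X₁ (adjoint X₂ _) = adjoint X₂ (adjoint X₁ _)
      rw [x1a x, x2a x, h0]
      simp
  have ap : ∀ {Z : Type u} [NormedAddCommGroup Z] [InnerProductSpace ℂ Z] [CompleteSpace Z]
      {P Q : Z →L[ℂ] Z}, P * Q = Q * P → ∀ x, P (Q x) = Q (P x) := by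
    intro Z _ _ _ P Q h x
    exact congrArg (fun S => S x) h
  refine ⟨X₁, X₂, ?_, ?_, ?_, ?_, ?_, fun h => y1 [] h, fun h => y2 [] h⟩
  · have := congrArg adjoint comm'
    simp only [mul_def, adjoint_comp, adjoint_adjoint] at this
    exact this.symm
  · intro x
    rw [x1]
    exact (nu' _).trans ((nu _).trans ((iso A hA _).trans ((nu' _).trans (nu _))))
  · intro x
    rw [x2]
    exact (nu' _).trans ((iso A' hA' _).trans (nu _))
  · intro j
    constructor
    · ext x
      change X₁ (B j x) = B j (X₁ x)
      rw [x1, x1, c1, c3, ap (hAB j).1, c1, c3]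
    · ext x
      change adjoint X₁ (B j x) = B j (adjoint X₁ x)
      rw [x1a, x1a, c1, c3, ap (hAB j).2, c1, c3]
  · intro j
    constructor
    · ext x
      change X₂ (B j x) = B j (X₂ x)
      rw [x2, x2, c1, ap (hAB' j).1, c3]
    · ext x
      change adjoint X₂ (B j x) = B j (adjoint X₂ x)
      rw [x2a, x2a, c1, ap (hAB' j).2, c3]

theorem compress_pow (P : K →L[ℂ] H) (V : K →L[ℂ] K) (S : H →L[ℂ] H) (h : P ∘L V = S ∘L P)
    (n : ℕ) : P ∘L (V ^ n) = (S ^ n) ∘L P := by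
  induction n with
  | zero => ext x; simp
  | succ n ih =>
    rw [pow_succ, pow_succ, mul_def, mul_def, ← comp_assoc, ih, comp_assoc, h, comp_assoc]

theorem compress_mul (P : K →L[ℂ] H) (V V' : K →L[ℂ] K) (S S' : H →L[ℂ] H)
    (h : P ∘L V = S ∘L P) (h' : P ∘L V' = S' ∘L P) : P ∘L (V * V') = (S * S') ∘L P := by
  rw [mul_def, mul_def, ← comp_assoc, h, comp_assoc, h', comp_assoc]

theorem compress_list (P : K →L[ℂ] H) {n : ℕ} (V : Fin n → (K →L[ℂ] K)) (S : Fin n → (H →L[ℂ] H))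
    (h : ∀ j, P ∘L V j = S j ∘L P) :
    P ∘L (List.ofFn V).prod = (List.ofFn S).prod ∘L P := by
  induction n with
  | zero => ext x; simp
  | succ n ih =>
    rw [List.ofFn_succ, List.ofFn_succ, List.prod_cons, List.prod_cons]
    exact compress_mul _ _ _ _ _ (h 0) (ih _ _ fun j => h j.succ)

theorem compress_of (ι : H →ₗᵢ[ℂ] K) (V : K →L[ℂ] K) (S : H →L[ℂ] H)
    (h : ∀ x, adjoint V (ι x) = ι (adjoint S x)) :
    adjoint ι.toContinuousLinearMap ∘L V = S ∘L adjoint ι.toContinuousLinearMap := by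
  have h1 : adjoint V ∘L ι.toContinuousLinearMap = ι.toContinuousLinearMap ∘L adjoint S := by
    ext x; exact h x
  have := congrArg adjoint h1
  simpa only [adjoint_comp, adjoint_adjoint] using this
end words
end BD

/-- Barik–Das type dilation: let `S₁, S₂, T₁, …, T_k` be pairwise commuting contractions on
`H` such that for each `i = 1, 2` the tuple `(Sᵢ, T₁, …, T_k)` admits a pairwise doubly
commuting isometric co-extension.  Then there are pairwise commuting isometries
`V₁, V₂, W₁, …, W_k` on some `K ⊇ H` dilating `S₁, S₂, T₁, …, T_k`, such that, for each
`i = 1, 2`, the tuple `(Vᵢ, W₁, …, W_k)` is a pairwise doubly commuting isometric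
co-extension of `(Sᵢ, T₁, …, T_k)`. -/
theorem barik_das_dilation {H : Type u} [NormedAddCommGroup H] [InnerProductSpace ℂ H]
    [CompleteSpace H] {k : ℕ}
    (S₁ S₂ : H →L[ℂ] H) (T : Fin k → (H →L[ℂ] H))
    (hS₁ : ‖S₁‖ ≤ 1) (hS₂ : ‖S₂‖ ≤ 1) (hT : ∀ j, ‖T j‖ ≤ 1)
    (hS₁S₂ : S₁ * S₂ = S₂ * S₁)
    (hS₁T : ∀ j, S₁ * T j = T j * S₁) (hS₂T : ∀ j, S₂ * T j = T j * S₂)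
    (hTT : ∀ j j', T j * T j' = T j' * T j)
    (hcoext₁ : ∃ (K₁ : Type u) (_ : NormedAddCommGroup K₁) (_ : InnerProductSpace ℂ K₁)
        (_ : CompleteSpace K₁) (ι₁ : H →ₗᵢ[ℂ] K₁) (A : K₁ →L[ℂ] K₁)
        (B : Fin k → (K₁ →L[ℂ] K₁)),
      adjoint A * A = 1 ∧ (∀ j, adjoint (B j) * B j = 1) ∧
      (∀ j, A * B j = B j * A ∧ adjoint A * B j = B j * adjoint A) ∧
      (∀ j j', j ≠ j' → B j * B j' = B j' * B j ∧ adjoint (B j) * B j' = B j' * adjoint (B j)) ∧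
      (∀ h : H, adjoint A (ι₁ h) = ι₁ (adjoint S₁ h)) ∧
      (∀ (j : Fin k) (h : H), adjoint (B j) (ι₁ h) = ι₁ (adjoint (T j) h)))
    (hcoext₂ : ∃ (K₂ : Type u) (_ : NormedAddCommGroup K₂) (_ : InnerProductSpace ℂ K₂)
        (_ : CompleteSpace K₂) (ι₂ : H →ₗᵢ[ℂ] K₂) (A : K₂ →L[ℂ] K₂)
        (B : Fin k → (K₂ →L[ℂ] K₂)),
      adjoint A * A = 1 ∧ (∀ j, adjoint (B j) * B j = 1) ∧
      (∀ j, A * B j = B j * A ∧ adjoint A * B j = B j * adjoint A) ∧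
      (∀ j j', j ≠ j' → B j * B j' = B j' * B j ∧ adjoint (B j) * B j' = B j' * adjoint (B j)) ∧
      (∀ h : H, adjoint A (ι₂ h) = ι₂ (adjoint S₂ h)) ∧
      (∀ (j : Fin k) (h : H), adjoint (B j) (ι₂ h) = ι₂ (adjoint (T j) h))) :
    ∃ (K : Type u) (_ : NormedAddCommGroup K) (_ : InnerProductSpace ℂ K) (_ : CompleteSpace K)
      (ι : H →ₗᵢ[ℂ] K) (V₁ V₂ : K →L[ℂ] K) (W : Fin k → (K →L[ℂ] K)),
      -- pairwise commuting isometries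
      adjoint V₁ * V₁ = 1 ∧ adjoint V₂ * V₂ = 1 ∧ (∀ j, adjoint (W j) * W j = 1) ∧
      V₁ * V₂ = V₂ * V₁ ∧
      (∀ j, V₁ * W j = W j * V₁) ∧ (∀ j, V₂ * W j = W j * V₂) ∧
      (∀ j j', W j * W j' = W j' * W j) ∧
      -- (1) compressions of monomials equal the corresponding monomials
      (∀ (n₁ n₂ : ℕ) (m : Fin k → ℕ),
        adjoint ι.toContinuousLinearMap ∘L
            ((V₁ ^ n₁ * V₂ ^ n₂ * (List.ofFn fun j => W j ^ m j).prod) ∘L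
              ι.toContinuousLinearMap) =
          S₁ ^ n₁ * S₂ ^ n₂ * (List.ofFn fun j => T j ^ m j).prod) ∧
      -- (2) for each i = 1, 2, (Vᵢ, W₁, …, W_k) is a pairwise doubly commuting isometric
      -- co-extension of (Sᵢ, T₁, …, T_k)
      (∀ j, V₁ * W j = W j * V₁ ∧ adjoint V₁ * W j = W j * adjoint V₁) ∧
      (∀ j, V₂ * W j = W j * V₂ ∧ adjoint V₂ * W j = W j * adjoint V₂) ∧
      (∀ j j', j ≠ j' → W j * W j' = W j' * W j ∧ adjoint (W j) * W j' = W j' * adjoint (W j)) ∧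
      (∀ h : H, adjoint V₁ (ι h) = ι (adjoint S₁ h)) ∧
      (∀ h : H, adjoint V₂ (ι h) = ι (adjoint S₂ h)) ∧
      (∀ (j : Fin k) (h : H), adjoint (W j) (ι h) = ι (adjoint (T j) h)) := by
  obtain ⟨K₁, i1, i2, i3, ι₁, A, B, hA, hB, hAB, hBB, hAS, hBT⟩ := hcoext₁
  obtain ⟨K₂, j1, j2, j3, ι₂, A', B', hA', hB', hAB', hBB', hAS', hBT'⟩ := hcoext₂
  obtain ⟨X₁, X₂, hX, n1, n2, hXB1, hXB2, hXS1, hXS2⟩ :=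
    BD.transfer S₁ S₂ T hS₁S₂ ι₁ A B hA hB hAB hBB hAS hBT ι₂ A' B' hA' hB' hAB' hBB' hAS' hBT'
  obtain ⟨V₁, V₂, v1, v2, v3, v4, v5, v6⟩ := BD.ando X₁ X₂ hX n1 n2
  have adjc : ∀ {P Q : K₁ →L[ℂ] K₁}, adjoint P * Q = Q * adjoint P →
      P * adjoint Q = adjoint Q * P := by
    intro P Q h
    have := congrArg adjoint h
    simp only [mul_def, adjoint_comp, adjoint_adjoint] at this
    exact this.symm
  have adjc' : ∀ {P Q : K₁ →L[ℂ] K₁}, P * Q = Q * P →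
      adjoint P * adjoint Q = adjoint Q * adjoint P := by
    intro P Q h
    have := congrArg adjoint h
    simp only [mul_def, adjoint_comp] at this
    exact this.symm
  have w1 := fun j => v6 (B j) (hXB1 j).1 (hXB2 j).1 (hXB1 j).2 (hXB2 j).2
  have w2 := fun j => v6 (adjoint (B j)) (adjc (hXB1 j).2) (adjc (hXB2 j).2)
    (adjc' (hXB1 j).1) (adjc' (hXB2 j).1)
  have flip : ∀ (V : BD.Big K₁ →L[ℂ] BD.Big K₁) (j : Fin k),
      V * BD.rho (adjoint (B j)) = BD.rho (adjoint (B j)) * V →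
      adjoint V * BD.rho (B j) = BD.rho (B j) * adjoint V := by
    intro V j h
    have := congrArg adjoint h
    rw [mul_def, mul_def, adjoint_comp, adjoint_comp, BD.rho_adjoint, adjoint_adjoint] at this
    exact this.symm
  have hWW : ∀ j j', BD.rho (B j) * BD.rho (B j') = BD.rho (B j') * BD.rho (B j) := by
    intro j j'
    by_cases h : j = j'
    · rw [h]
    · rw [BD.rho_mul, BD.rho_mul, (hBB j j' h).1]
  have z1 : ∀ h : H, adjoint V₁ (BD.inl (ι₁ h)) = BD.inl (ι₁ (adjoint S₁ h)) := by
    intro h; rw [v4, hXS1]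
  have z2 : ∀ h : H, adjoint V₂ (BD.inl (ι₁ h)) = BD.inl (ι₁ (adjoint S₂ h)) := by
    intro h; rw [v5, hXS2]
  have z3 : ∀ (j : Fin k) (h : H),
      adjoint (BD.rho (B j)) (BD.inl (ι₁ h)) = BD.inl (ι₁ (adjoint (T j) h)) := by
    intro j h; rw [BD.rho_inl, hBT]
  let ι : H →ₗᵢ[ℂ] BD.Big K₁ := (BD.inl : K₁ →ₗᵢ[ℂ] BD.Big K₁).comp ι₁
  refine ⟨BD.Big K₁, inferInstance, inferInstance, inferInstance, ι, V₁, V₂,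
    fun j => BD.rho (B j), v1, v2, ?_, v3, fun j => (w1 j).1, fun j => (w1 j).2, hWW, ?_,
    fun j => ⟨(w1 j).1, flip _ _ (w2 j).1⟩, fun j => ⟨(w1 j).2, flip _ _ (w2 j).2⟩, ?_, z1, z2, z3⟩
  · intro j
    rw [BD.rho_adjoint, BD.rho_mul, hB, BD.rho_one]
  · intro m₁ m₂ m
    have q1 := BD.compress_pow _ _ _ (BD.compress_of ι V₁ S₁ z1) m₁
    have q2 := BD.compress_pow _ _ _ (BD.compress_of ι V₂ S₂ z2) m₂
    have q3 := BD.compress_list _ (fun j => BD.rho (B j) ^ m j) (fun j => T j ^ m j)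
      (fun j => BD.compress_pow _ _ _ (BD.compress_of ι (BD.rho (B j)) (T j) (z3 j)) (m j))
    have q := BD.compress_mul _ _ _ _ _ (BD.compress_mul _ _ _ _ _ q1 q2) q3
    rw [← comp_assoc, q, comp_assoc]
    have : adjoint ι.toContinuousLinearMap ∘L ι.toContinuousLinearMap = 1 := by
      ext x
      apply ext_inner_right ℂ
      intro y
      rw [comp_apply, adjoint_inner_left]
      exact ι.inner_map_map x y
    rw [this]
    rfl
  · intro j j' h
    refine ⟨hWW j j', ?_⟩
    rw [BD.rho_adjoint, BD.rho_mul, BD.rho_mul, (hBB j j' h).2]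
end

section
/- Let T₁, …, T_k be contractions on a complex Hilbert space H with ∑_{j=1}^k T_jT_j* ≤ I (a row contraction), and let S₁, S₂ be contractions on H with S₁S₂ = S₂S₁ and S_iT_j = T_jS_i for i = 1, 2 and all j. Suppose that for each i = 1, 2 the operator inequality I − S_iS_i* − ∑_{j=1}^k T_jT_j* + ∑_{j=1}^k S_iT_jT_j*S_i* ≥ 0 holds. Then there exist a Hilbert space K containing H as a closed subspace, commuting isometries V₁, V₂ on K, and isometries W₁, …, W_k on K with ∑_{j=1}^k W_jW_j* ≤ I (a row isometry) such that: (1) for each i = 1, 2 and each j, V_i and W_j doubly commute (V_iW_j = W_jV_i and V_i*W_j = W_jV_i*); (2) H is invariant under V₁*, V₂* and each W_j*, with V_i*|_H = S_i* and W_j*|_H = T_j*; in particular, P_H V₁^n V₂^m W_{j₁} ⋯ W_{j_l}|_H = S₁^n S₂^m T_{j₁} ⋯ T_{j_l} for all n, m ∈ ℕ and all words j₁, …, j_l in {1, …, k}. -/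
open ContinuousLinearMap

universe u

/-! ### Step A: completion of pre-Hilbert spaces -/

/-- Completion of a pre-inner product space, with extension of contractive operators. -/
theorem exists_hilbert_completion {P : Type u} [AddCommGroup P] [Module ℂ P]
    (c : PreInnerProductSpace.Core ℂ P) :
    ∃ (K : Type u) (_ : NormedAddCommGroup K) (_ : InnerProductSpace ℂ K) (_ : CompleteSpace K)
      (e : P →ₗ[ℂ] K), DenseRange e ∧ ∀ x y, inner ℂ (e x) (e y) = c.inner x y := by
  let _ : SeminormedAddCommGroup P :=
    @InnerProductSpace.Core.toSeminormedAddCommGroup ℂ P _ _ _ c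
  let _ : InnerProductSpace ℂ P := InnerProductSpace.ofCore c
  refine ⟨UniformSpace.Completion P, inferInstance, inferInstance, inferInstance,
    (UniformSpace.Completion.toComplL : P →L[ℂ] UniformSpace.Completion P).toLinearMap, ?_, ?_⟩
  · exact UniformSpace.Completion.denseRange_coe
  · intro x y
    exact UniformSpace.Completion.inner_coe x y

theorem exists_extend_contraction {P K : Type u} [AddCommGroup P] [Module ℂ P]
    [NormedAddCommGroup K] [InnerProductSpace ℂ K] [CompleteSpace K]
    (e : P →ₗ[ℂ] K) (he : DenseRange e) (A : P →ₗ[ℂ] P)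
    (hA : ∀ x, (inner ℂ (e (A x)) (e (A x))).re ≤ (inner ℂ (e x) (e x)).re) :
    ∃ B : K →L[ℂ] K, ‖B‖ ≤ 1 ∧ ∀ x, B (e x) = e (A x) := by
  have hn : ∀ x, ‖(e ∘ₗ A) x‖ ≤ 1 * ‖e x‖ := by
    intro x
    have h := hA x
    have h1 := inner_self_eq_norm_sq (𝕜 := ℂ) (e (A x))
    have h2 := inner_self_eq_norm_sq (𝕜 := ℂ) (e x)
    simp only [RCLike.re_to_complex] at h1 h2
    rw [h1, h2] at h
    rw [one_mul]
    exact (sq_le_sq₀ (norm_nonneg _) (norm_nonneg _)).1 h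
  exact ⟨(e ∘ₗ A).extendOfNorm e, LinearMap.opNorm_extendOfNorm_le he zero_le_one hn,
    fun x => LinearMap.extendOfNorm_eq he ⟨1, hn⟩ x⟩

theorem clm_ext_dense {P K : Type u} [AddCommGroup P] [Module ℂ P]
    [NormedAddCommGroup K] [InnerProductSpace ℂ K]
    {e : P →ₗ[ℂ] K} (he : DenseRange e) {A B : K →L[ℂ] K} (h : ∀ x, A (e x) = B (e x)) :
    A = B := by
  ext y
  exact congrFun (he.equalizer A.continuous B.continuous (funext h)) y

theorem adjoint_ext_dense {P K : Type u} [AddCommGroup P] [Module ℂ P]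
    [NormedAddCommGroup K] [InnerProductSpace ℂ K] [CompleteSpace K]
    {e : P →ₗ[ℂ] K} (he : DenseRange e) {A B : K →L[ℂ] K}
    (h : ∀ x y, inner ℂ (A (e x)) (e y) = inner ℂ (e x) (B (e y))) :
    adjoint A = B := by
  apply clm_ext_dense he
  intro y
  refine he.eq_of_inner_right (𝕜 := ℂ) ?_
  intro x
  rw [adjoint_inner_right, h]

section Words

variable {H : Type u} [NormedAddCommGroup H] [InnerProductSpace ℂ H] {k : ℕ}

/-- The truncated forms. -/
noncomputable def wForm (D : H →L[ℂ] H) : ℕ → (List (Fin k) → H) → (List (Fin k) → H) → ℂ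
  | 0, x, y => inner ℂ (x []) (y [])
  | n + 1, x, y => inner ℂ (D (x [])) (y []) +
      ∑ j, wForm D n (fun w => x (j :: w)) (fun w => y (j :: w))

/-- Sequences indexed by words satisfying the recursion from length `n` on. -/
def WEv (t : Fin k → H →L[ℂ] H) (n : ℕ) (x : List (Fin k) → H) : Prop :=
  ∀ w : List (Fin k), n ≤ w.length → ∀ j, x (w ++ [j]) = t j (x w)

theorem WEv.mono {t : Fin k → H →L[ℂ] H} {n m : ℕ} (h : n ≤ m) {x : List (Fin k) → H}
    (hx : WEv t n x) : WEv t m x := fun w hw j => hx w (h.trans hw) j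

theorem WEv.tail {t : Fin k → H →L[ℂ] H} {n : ℕ} {x : List (Fin k) → H}
    (hx : WEv t (n + 1) x) (j : Fin k) : WEv t n (fun w => x (j :: w)) := by
  intro w hw i
  have := hx (j :: w) (by simpa using hw) i
  simpa using this

theorem wForm_succ {D : H →L[ℂ] H} {t : Fin k → H →L[ℂ] H}
    (hD : ∀ h g, inner ℂ (D h) g + ∑ j, inner ℂ (t j h) (t j g) = inner ℂ h g) (n : ℕ) :
    ∀ x y : List (Fin k) → H, WEv t n x → WEv t n y → wForm D (n + 1) x y = wForm D n x y := by
  induction n with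
  | zero =>
    intro x y hx hy
    simp only [wForm]
    rw [← hD (x [])]
    refine congrArg (inner ℂ (D (x [])) (y []) + ·) ?_
    refine Finset.sum_congr rfl fun j _ => ?_
    have h1 := hx [] le_rfl j
    have h2 := hy [] le_rfl j
    simp only [List.nil_append] at h1 h2
    rw [h1, h2]
  | succ n ih =>
    intro x y hx hy
    rw [wForm, wForm]
    congr 1
    exact Finset.sum_congr rfl fun j _ => ih _ _ (hx.tail j) (hy.tail j)

theorem wForm_stable {D : H →L[ℂ] H} {t : Fin k → H →L[ℂ] H}
    (hD : ∀ h g, inner ℂ (D h) g + ∑ j, inner ℂ (t j h) (t j g) = inner ℂ h g) {n m : ℕ}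
    (hnm : n ≤ m) {x y : List (Fin k) → H} (hx : WEv t n x) (hy : WEv t n y) :
    wForm D m x y = wForm D n x y := by
  induction m, hnm using Nat.le_induction with
  | base => rfl
  | succ m hm ih => rw [wForm_succ hD m x y (hx.mono hm) (hy.mono hm), ih]

theorem wForm_add_left (D : H →L[ℂ] H) (n : ℕ) : ∀ x x' y : List (Fin k) → H,
    wForm D n (x + x') y = wForm D n x y + wForm D n x' y := by
  induction n with
  | zero => intro x x' y; simp [wForm]
  | succ n ih =>
    intro x x' y
    have : ∀ j, wForm D n (fun w => (x + x') (j :: w)) (fun w => y (j :: w)) =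
        wForm D n (fun w => x (j :: w)) (fun w => y (j :: w)) +
        wForm D n (fun w => x' (j :: w)) (fun w => y (j :: w)) := fun j => ih _ _ _
    rw [wForm, Finset.sum_congr rfl fun j _ => this j, wForm, wForm, Finset.sum_add_distrib,
      Pi.add_apply, map_add, inner_add_left]
    ring

theorem wForm_smul_left (D : H →L[ℂ] H) (n : ℕ) : ∀ (r : ℂ) (x y : List (Fin k) → H),
    wForm D n (r • x) y = (starRingEnd ℂ) r * wForm D n x y := by
  induction n with
  | zero => intro r x y; simp only [wForm, Pi.smul_apply, inner_smul_left]
  | succ n ih =>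
    intro r x y
    have : ∀ j, wForm D n (fun w => (r • x) (j :: w)) (fun w => y (j :: w)) =
        (starRingEnd ℂ) r * wForm D n (fun w => x (j :: w)) (fun w => y (j :: w)) :=
      fun j => ih _ _ _
    rw [wForm, Finset.sum_congr rfl fun j _ => this j, wForm, ← Finset.mul_sum, Pi.smul_apply,
      map_smul, inner_smul_left]
    ring

theorem wForm_symm {D : H →L[ℂ] H} (hD : ∀ h g, inner ℂ (D h) g = inner ℂ h (D g)) (n : ℕ) :
    ∀ (x y : List (Fin k) → H), (starRingEnd ℂ) (wForm D n y x) = wForm D n x y := by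
  induction n with
  | zero => intro x y; simp [wForm]
  | succ n ih =>
    intro x y
    simp only [wForm, map_add, map_sum, ih, inner_conj_symm, hD]

theorem wForm_le {D C : H →L[ℂ] H} 
    (hC : ∀ h, (inner ℂ (D (C h)) (C h)).re ≤ (inner ℂ (D h) h).re)
    (hC1 : ∀ h, (inner ℂ (C h) (C h)).re ≤ (inner ℂ h h).re) (n : ℕ) :
    ∀ (x : List (Fin k) → H),
      (wForm D n (fun w => C (x w)) (fun w => C (x w))).re ≤ (wForm D n x x).re := by
  induction n with
  | zero => intro x; exact hC1 _
  | succ n ih =>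
    intro x
    simp only [wForm, Complex.add_re, Complex.re_sum]
    exact add_le_add (hC _) (Finset.sum_le_sum fun j _ => ih _)

theorem wForm_zero_left (D : H →L[ℂ] H) (n : ℕ) (y : List (Fin k) → H) :
    wForm D n (fun _ => 0) y = 0 := by
  have := wForm_smul_left D n 0 0 y
  rw [zero_smul, map_zero, zero_mul] at this
  exact this

theorem wForm_nonneg {D : H →L[ℂ] H} (hD : ∀ h, 0 ≤ (inner ℂ (D h) h).re) (n : ℕ)
    (x : List (Fin k) → H) : 0 ≤ (wForm D n x x).re := by
  have := wForm_le (k := k) (D := D) (C := 0) (by simpa using hD) (by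
    intro h
    have := inner_self_nonneg (𝕜 := ℂ) (x := h)
    simpa using this) n x
  have h0 := wForm_zero_left (k := k) D n (fun _ => 0)
  simp only [zero_apply] at this
  rw [h0] at this
  simpa using this

/-- The pre-Hilbert space. -/
def WSub (t : Fin k → H →L[ℂ] H) : Submodule ℂ (List (Fin k) → H) where
  carrier := {x | ∃ n, WEv t n x}
  add_mem' := by
    rintro x y ⟨n, hx⟩ ⟨m, hy⟩
    refine ⟨max n m, fun w hw j => ?_⟩
    simp [hx.mono (le_max_left n m) w hw j, hy.mono (le_max_right n m) w hw j]
  zero_mem' := ⟨0, fun w hw j => by simp⟩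
  smul_mem' := by
    rintro c x ⟨n, hx⟩
    exact ⟨n, fun w hw j => by simp [hx w hw j]⟩

open Classical in
/-- Index from which the recursion holds. -/
noncomputable def wIdx {t : Fin k → H →L[ℂ] H} (x : WSub t) : ℕ := Nat.find x.2

theorem wIdx_spec {t : Fin k → H →L[ℂ] H} (x : WSub t) : WEv t (wIdx x) x := by
  classical
  exact Nat.find_spec x.2

/-- The inner product. -/
noncomputable def wInner (D : H →L[ℂ] H) {t : Fin k → H →L[ℂ] H} (x y : WSub t) : ℂ :=
  wForm D (max (wIdx x) (wIdx y)) x.1 y.1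

theorem wInner_eq {D : H →L[ℂ] H} {t : Fin k → H →L[ℂ] H}
    (hD : ∀ h g, inner ℂ (D h) g + ∑ j, inner ℂ (t j h) (t j g) = inner ℂ h g) {n : ℕ}
    {x y : WSub t} (hx : WEv t n x) (hy : WEv t n y) : wInner D x y = wForm D n x.1 y.1 := by
  have h1 := (wIdx_spec x).mono (le_max_left (wIdx x) (wIdx y))
  have h2 := (wIdx_spec y).mono (le_max_right (wIdx x) (wIdx y))
  unfold wInner
  rcases le_total n (max (wIdx x) (wIdx y)) with h | h
  · exact wForm_stable hD h hx hy
  · exact (wForm_stable hD h h1 h2).symm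

/-- A common index for two elements. -/
theorem exists_common {t : Fin k → H →L[ℂ] H} (x y : WSub t) :
    ∃ n, WEv t n x ∧ WEv t n y :=
  ⟨_, (wIdx_spec x).mono (le_max_left (wIdx x) (wIdx y)),
    (wIdx_spec y).mono (le_max_right (wIdx x) (wIdx y))⟩

/-- The core. -/
@[reducible]
noncomputable def wCore {D : H →L[ℂ] H} {t : Fin k → H →L[ℂ] H}
    (hD : ∀ h g, inner ℂ (D h) g + ∑ j, inner ℂ (t j h) (t j g) = inner ℂ h g)
    (hD1 : ∀ h g, inner ℂ (D h) g = inner ℂ h (D g))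
    (hD2 : ∀ h, 0 ≤ (inner ℂ (D h) h).re) : PreInnerProductSpace.Core ℂ (WSub t) where
  inner := wInner D
  conj_inner_symm x y := by
    obtain ⟨n, hx, hy⟩ := exists_common x y
    rw [wInner_eq hD hx hy, wInner_eq hD hy hx, wForm_symm hD1]
  re_inner_nonneg x := wForm_nonneg hD2 _ _
  add_left x y z := by
    obtain ⟨n, hx, hy⟩ := exists_common x y
    have hz := wIdx_spec z
    have hx' := hx.mono (le_max_left n (wIdx z))
    have hy' := hy.mono (le_max_left n (wIdx z))
    have hz' := hz.mono (le_max_right n (wIdx z))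
    have hxy : WEv t (max n (wIdx z)) ((x + y : WSub t) : List (Fin k) → H) := by
      intro w hw j
      simp [hx' w hw j, hy' w hw j]
    rw [wInner_eq hD hx' hz', wInner_eq hD hy' hz', wInner_eq hD hxy hz', Submodule.coe_add,
      wForm_add_left]
  smul_left x y r := by
    obtain ⟨n, hx, hy⟩ := exists_common x y
    have hrx : WEv t n ((r • x : WSub t) : List (Fin k) → H) := by
      intro w hw j
      simp [hx w hw j]
    rw [wInner_eq hD hx hy, wInner_eq hD hrx hy, Submodule.coe_smul, wForm_smul_left]

/-- Pointwise action of an operator. -/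
def wPt {t : Fin k → H →L[ℂ] H} (C : H →L[ℂ] H) (hC : ∀ j h, C (t j h) = t j (C h)) :
    WSub t →ₗ[ℂ] WSub t where
  toFun x := ⟨fun w => C (x.1 w), by
    obtain ⟨n, hn⟩ := x.2
    exact ⟨n, fun w hw j => by
      change C (x.1 (w ++ [j])) = _
      rw [hn w hw j, hC]⟩⟩
  map_add' x y := by ext w; simp
  map_smul' r x := by ext w; simp

/-- Creation sequence. -/
def wShiftFun (j : Fin k) (x : List (Fin k) → H) : List (Fin k) → H
  | [] => 0
  | i :: w => if i = j then x w else 0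

theorem WEv.shift {t : Fin k → H →L[ℂ] H} {n : ℕ} {x : List (Fin k) → H} (hx : WEv t n x)
    (j : Fin k) : WEv t (n + 1) (wShiftFun j x) := by
  intro w hw i
  match w, hw with
  | [], hw => simp at hw
  | l :: w, hw =>
    have := hx w (by simpa using hw) i
    by_cases h : l = j <;> simp [wShiftFun, h, this]

/-- Creation operator. -/
def wShift (t : Fin k → H →L[ℂ] H) (j : Fin k) : WSub t →ₗ[ℂ] WSub t where
  toFun x := ⟨wShiftFun j x.1, by
    obtain ⟨n, hn⟩ := x.2
    exact ⟨n + 1, hn.shift j⟩⟩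
  map_add' x y := by
    ext w
    rcases w with _ | ⟨i, w⟩
    · simp [wShiftFun]
    · by_cases h : i = j <;> simp [wShiftFun, h]
  map_smul' r x := by
    ext w
    rcases w with _ | ⟨i, w⟩
    · simp [wShiftFun]
    · by_cases h : i = j <;> simp [wShiftFun, h]

/-- Annihilation operator. -/
def wTail (t : Fin k → H →L[ℂ] H) (j : Fin k) : WSub t →ₗ[ℂ] WSub t where
  toFun x := ⟨fun w => x.1 (j :: w), by
    obtain ⟨n, hn⟩ := x.2
    exact ⟨n, (hn.mono (Nat.le_succ n)).tail j⟩⟩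
  map_add' x y := by ext w; simp
  map_smul' r x := by ext w; simp

theorem wTail_wShift (t : Fin k → H →L[ℂ] H) (i j : Fin k) (x : WSub t) :
    wTail t i (wShift t j x) = if i = j then x else 0 := by
  ext w
  by_cases h : i = j <;> simp [wTail, wShift, wShiftFun, h]

theorem wInner_shift {D : H →L[ℂ] H} {t : Fin k → H →L[ℂ] H}
    (hD : ∀ h g, inner ℂ (D h) g + ∑ j, inner ℂ (t j h) (t j g) = inner ℂ h g) (j : Fin k)
    (x y : WSub t) : wInner D (wShift t j x) y = wInner D x (wTail t j y) := by
  obtain ⟨n, hx, hy⟩ := exists_common x y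
  have hy' := hy.mono (Nat.le_succ n)
  have h1 : WEv t (n + 1) (wShift t j x) := hx.shift j
  have h2 : WEv t n (wTail t j y) := hy'.tail j
  rw [wInner_eq hD h1 hy', wInner_eq hD hx h2, wForm]
  rw [Finset.sum_eq_single j]
  · simp [wShift, wTail, wShiftFun]
  · intro i _ hi
    simp only [wShift, LinearMap.coe_mk, AddHom.coe_mk, wShiftFun, hi, if_false]
    exact wForm_zero_left _ _ _
  · simp

/-- The orbit sequence of a vector. -/
def wOrbFun (t : Fin k → H →L[ℂ] H) (h : H) (w : List (Fin k)) : H :=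
  w.foldl (fun g j => t j g) h

/-- The embedding. -/
def wOrb (t : Fin k → H →L[ℂ] H) : H →ₗ[ℂ] WSub t where
  toFun h := ⟨wOrbFun t h, 0, fun w _ j => by simp [wOrbFun]⟩
  map_add' x y := by
    ext w
    simp only [wOrbFun, Submodule.coe_add, Pi.add_apply]
    induction w generalizing x y with
    | nil => rfl
    | cons j w ih => simp [ih]
  map_smul' r x := by
    ext w
    simp only [wOrbFun, Submodule.coe_smul, Pi.smul_apply, RingHom.id_apply]
    induction w generalizing x with
    | nil => rfl
    | cons j w ih => simp [ih]

theorem wTail_wOrb (t : Fin k → H →L[ℂ] H) (j : Fin k) (h : H) :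
    wTail t j (wOrb t h) = wOrb t (t j h) := by
  ext w
  simp [wTail, wOrb, wOrbFun]

theorem wPt_wOrb {t : Fin k → H →L[ℂ] H} (C : H →L[ℂ] H) (hC : ∀ j h, C (t j h) = t j (C h))
    (h : H) : wPt C hC (wOrb t h) = wOrb t (C h) := by
  ext w
  simp only [wPt, wOrb, wOrbFun, LinearMap.coe_mk, AddHom.coe_mk]
  induction w generalizing h with
  | nil => rfl
  | cons j w ih => simp [ih, hC]

theorem wInner_wOrb {D : H →L[ℂ] H} {t : Fin k → H →L[ℂ] H}
    (hD : ∀ h g, inner ℂ (D h) g + ∑ j, inner ℂ (t j h) (t j g) = inner ℂ h g) (h g : H) :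
    wInner D (wOrb t h) (wOrb t g) = inner ℂ h g := by
  have h1 : ∀ h, WEv t 0 (wOrb t h) := fun h w _ j => by simp [wOrb, wOrbFun]
  rw [wInner_eq hD (h1 h) (h1 g)]
  rfl

theorem wShift_wPt {t : Fin k → H →L[ℂ] H} (C : H →L[ℂ] H) (hC : ∀ j h, C (t j h) = t j (C h))
    (j : Fin k) (x : WSub t) : wPt C hC (wShift t j x) = wShift t j (wPt C hC x) := by
  ext w
  rcases w with _ | ⟨i, w⟩
  · simp [wPt, wShift, wShiftFun]
  · by_cases h : i = j <;> simp [wPt, wShift, wShiftFun, h]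

theorem wTail_wPt {t : Fin k → H →L[ℂ] H} (C : H →L[ℂ] H) (hC : ∀ j h, C (t j h) = t j (C h))
    (j : Fin k) (x : WSub t) : wPt C hC (wTail t j x) = wTail t j (wPt C hC x) := by
  ext w
  simp [wPt, wTail]

theorem wInner_wPt_le {D : H →L[ℂ] H} {t : Fin k → H →L[ℂ] H}
    (hD : ∀ h g, inner ℂ (D h) g + ∑ j, inner ℂ (t j h) (t j g) = inner ℂ h g)
    {C : H →L[ℂ] H} (hC : ∀ j h, C (t j h) = t j (C h))
    (hCD : ∀ h, (inner ℂ (D (C h)) (C h)).re ≤ (inner ℂ (D h) h).re)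
    (hC1 : ∀ h, (inner ℂ (C h) (C h)).re ≤ (inner ℂ h h).re) (x : WSub t) :
    (wInner D (wPt C hC x) (wPt C hC x)).re ≤ (wInner D x x).re := by
  obtain ⟨n, hx⟩ := x.2
  have h1 : WEv t n (wPt C hC x) := fun w hw j => by
    simp only [wPt, LinearMap.coe_mk, AddHom.coe_mk]
    rw [hx w hw j, hC]
  rw [wInner_eq hD h1 h1, wInner_eq hD hx hx]
  exact wForm_le hCD hC1 n _

/-- Lower levels of the form control the tail. -/
theorem wInner_wTail_le {D : H →L[ℂ] H} {t : Fin k → H →L[ℂ] H}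
    (hD : ∀ h g, inner ℂ (D h) g + ∑ j, inner ℂ (t j h) (t j g) = inner ℂ h g)
    (hD2 : ∀ h, 0 ≤ (inner ℂ (D h) h).re) (j : Fin k) (x : WSub t) :
    (wInner D (wTail t j x) (wTail t j x)).re ≤ (wInner D x x).re := by
  obtain ⟨n, hx⟩ := x.2
  have hx' := WEv.mono (Nat.le_succ n) hx
  have h1 : WEv t n (wTail t j x) := hx'.tail j
  rw [wInner_eq hD h1 h1, wInner_eq hD hx' hx', wForm, Complex.add_re, Complex.re_sum]
  refine le_add_of_nonneg_of_le (hD2 _) ?_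
  exact Finset.single_le_sum
    (f := fun i => (wForm D n (fun w => x.1 (i :: w)) (fun w => x.1 (i :: w))).re)
    (fun i _ => wForm_nonneg hD2 _ _) (Finset.mem_univ j)

end Words

theorem nonneg_re_inner {H : Type u} [NormedAddCommGroup H] [InnerProductSpace ℂ H]
    [CompleteSpace H] {A : H →L[ℂ] H} (hA : 0 ≤ A) (h : H) : 0 ≤ (inner ℂ (A h) h).re :=
  ((nonneg_iff_isPositive A).1 hA).re_inner_nonneg_left h

/-- Step A: dilation to a row isometry doubly commuting with commuting contractions. -/
theorem stepA {H : Type u} [NormedAddCommGroup H] [InnerProductSpace ℂ H]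
    [CompleteSpace H] {k : ℕ} (T : Fin k → (H →L[ℂ] H))
    (hTrow : ∑ j, T j * adjoint (T j) ≤ 1)
    (S : Fin 2 → (H →L[ℂ] H)) (hS : ∀ i, ‖S i‖ ≤ 1)
    (hScomm : S 0 * S 1 = S 1 * S 0)
    (hST : ∀ i j, S i * T j = T j * S i)
    (hpos : ∀ i, 0 ≤ 1 - S i * adjoint (S i) - ∑ j, T j * adjoint (T j)
        + ∑ j, S i * (T j * adjoint (T j)) * adjoint (S i)) :
    ∃ (K : Type u) (_ : NormedAddCommGroup K) (_ : InnerProductSpace ℂ K) (_ : CompleteSpace K)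
      (ι : H →ₗᵢ[ℂ] K) (Z : Fin 2 → (K →L[ℂ] K)) (W : Fin k → (K →L[ℂ] K)),
      (∀ i, ‖Z i‖ ≤ 1) ∧ Z 0 * Z 1 = Z 1 * Z 0 ∧
      (∀ i j, adjoint (W i) * W j = if i = j then 1 else 0) ∧
      (∀ i j, Z i * W j = W j * Z i) ∧ (∀ i j, adjoint (Z i) * W j = W j * adjoint (Z i)) ∧
      (∀ i (h : H), adjoint (Z i) (ι h) = ι (adjoint (S i) h)) ∧
      (∀ (j : Fin k) (h : H), adjoint (W j) (ι h) = ι (adjoint (T j) h)) := by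
  set D : H →L[ℂ] H := 1 - ∑ j, T j * adjoint (T j) with hDdef
  set t : Fin k → (H →L[ℂ] H) := fun j => adjoint (T j) with ht
  have hD0 : 0 ≤ D := sub_nonneg.2 hTrow
  have hDsa : adjoint D = D := ((nonneg_iff_isPositive D).1 hD0).isSelfAdjoint
  have hD : ∀ h g, inner ℂ (D h) g + ∑ j, inner ℂ (t j h) (t j g) = inner ℂ h g := by
    intro h g
    simp only [hDdef, ht, adjoint_inner_right, sub_apply, one_apply_eq_self, inner_sub_left, sum_apply,
      mul_def, comp_apply, sum_inner]
    ring
  have hD1 : ∀ h g, inner ℂ (D h) g = inner ℂ h (D g) := by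
    intro h g
    rw [← adjoint_inner_right, hDsa]
  have hD2 := nonneg_re_inner hD0
  have hC : ∀ i j h, adjoint (S i) (t j h) = t j (adjoint (S i) h) := by
    intro i j h
    have := congrArg adjoint (hST i j)
    simp only [mul_def, adjoint_comp] at this
    exact (congrArg (fun A : H →L[ℂ] H => A h) this).symm
  have hCD : ∀ i h, (inner ℂ (D (adjoint (S i) h)) (adjoint (S i) h)).re ≤ (inner ℂ (D h) h).re := by
    intro i h
    have h1 := nonneg_re_inner (hpos i) h
    have h2 : (1 - S i * adjoint (S i) - ∑ j, T j * adjoint (T j)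
        + ∑ j, S i * (T j * adjoint (T j)) * adjoint (S i)) = D - S i * D * adjoint (S i) := by
      rw [← Finset.sum_mul, ← Finset.mul_sum, hDdef]
      noncomm_ring
    rw [h2] at h1
    simp only [sub_apply, mul_def, comp_apply, inner_sub_left, Complex.sub_re] at h1
    rw [adjoint_inner_right]
    linarith
  have hC1 : ∀ i h, (inner ℂ (adjoint (S i) h) (adjoint (S i) h)).re ≤ (inner ℂ h h).re := by
    intro i h
    have h1 := inner_self_eq_norm_sq (𝕜 := ℂ) (adjoint (S i) h)
    have h2 := inner_self_eq_norm_sq (𝕜 := ℂ) h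
    simp only [RCLike.re_to_complex] at h1 h2
    rw [h1, h2]
    have h3 : ‖adjoint (S i) h‖ ≤ ‖h‖ := by
      refine (le_opNorm _ _).trans ?_
      rw [LinearIsometryEquiv.norm_map]
      exact mul_le_of_le_one_left (norm_nonneg _) (hS i)
    gcongr
  obtain ⟨K, _, _, _, e, he, hin⟩ := exists_hilbert_completion (wCore hD hD1 hD2)
  replace hin : ∀ x y, inner ℂ (e x) (e y) = wInner D x y := hin
  have hZ := fun i => exists_extend_contraction e he (wPt (adjoint (S i)) (hC i)) (by
    intro x
    rw [hin, hin]
    exact wInner_wPt_le hD (hC i) (hCD i) (hC1 i) x)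
  have hW := fun j => exists_extend_contraction e he (wShift t j) (by
    intro x
    rw [hin, hin, wInner_shift hD, wTail_wShift, if_pos rfl])
  have hW' := fun j => exists_extend_contraction e he (wTail t j) (by
    intro x
    rw [hin, hin]
    exact wInner_wTail_le hD hD2 j x)
  choose Y hY1 hY using hZ
  choose W _ hW using hW
  choose W' _ hW' using hW'
  have hadj : ∀ j, adjoint (W j) = W' j := by
    intro j
    refine adjoint_ext_dense he fun x y => ?_
    rw [hW, hW', hin, hin, wInner_shift hD]
  have hYW : ∀ i j, Y i * W j = W j * Y i := by
    intro i j
    refine clm_ext_dense he fun x => ?_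
    simp only [mul_def, comp_apply, hY, hW, wShift_wPt]
  have hYW' : ∀ i j, Y i * W' j = W' j * Y i := by
    intro i j
    refine clm_ext_dense he fun x => ?_
    simp only [mul_def, comp_apply, hY, hW', wTail_wPt]
  let ι : H →ₗᵢ[ℂ] K := (e ∘ₗ wOrb t).isometryOfInner (by
    intro x y
    simp only [LinearMap.comp_apply, hin, wInner_wOrb hD])
  have hι : ∀ h, ι h = e (wOrb t h) := fun h => rfl
  refine ⟨K, inferInstance, inferInstance, inferInstance, ι, fun i => adjoint (Y i), W,
    ?_, ?_, ?_, ?_, ?_, ?_, ?_⟩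
  · intro i
    rw [LinearIsometryEquiv.norm_map]
    exact hY1 i
  · simp only [mul_def]
    rw [← adjoint_comp, ← adjoint_comp]
    congr 1
    refine clm_ext_dense he fun x => ?_
    simp only [comp_apply, hY]
    congr 1
    ext w
    have := congrArg adjoint hScomm
    simp only [mul_def, adjoint_comp] at this
    exact congrArg (fun A : H →L[ℂ] H => A (x.1 w)) this
  · intro i j
    rw [hadj]
    refine clm_ext_dense he fun x => ?_
    rw [mul_def, comp_apply, hW, hW', wTail_wShift]
    split_ifs <;> simp
  · intro i j
    have := congrArg adjoint (hYW' i j)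
    simp only [mul_def, adjoint_comp, ← hadj, adjoint_adjoint] at this
    simp only [mul_def]
    exact this.symm
  · intro i j
    simp only [adjoint_adjoint]
    exact hYW i j
  · intro i h
    simp only [adjoint_adjoint, hι, hY, wPt_wOrb]
  · intro j h
    rw [hadj]
    simp only [hι, hW', wTail_wOrb, ht]

/-! ### Step B: a functorial Ando dilation -/

set_option linter.unusedSectionVars false

section Lp

variable {A : Type u} [NormedAddCommGroup A] [InnerProductSpace ℂ A]

/-- Square-summable sequences. -/
abbrev L2S (A : Type u) [NormedAddCommGroup A] : Type u := lp (fun _ : ℕ => A) 2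

theorem l2s_hasSum (f : L2S A) : HasSum (fun n => ‖f n‖ ^ 2) (‖f‖ ^ 2) := by
  have := lp.hasSum_norm (p := 2) (by simp) f
  simpa using this

theorem memℓp_two {f : ℕ → A} (h : Summable fun n => ‖f n‖ ^ 2) :
    Memℓp (E := fun _ : ℕ => A) f 2 := by
  rw [memℓp_gen_iff (by simp)]
  simpa using h

/-- Termwise application of an operator. -/
noncomputable def amp (C : A →L[ℂ] A) : L2S A →L[ℂ] L2S A :=
  LinearMap.mkContinuous
    { toFun := fun f => ⟨fun n => C (f n), memℓp_two (by
        refine Summable.of_nonneg_of_le (fun n => by positivity) (fun n => ?_)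
          ((l2s_hasSum f).summable.mul_left (‖C‖ ^ 2))
        rw [← mul_pow]
        gcongr
        exact C.le_opNorm _)⟩
      map_add' := fun f g => by ext n; exact map_add C _ _
      map_smul' := fun r f => by ext n; simp } ‖C‖ (by
    intro f
    refine (sq_le_sq₀ (norm_nonneg _) (by positivity)).1 ?_
    rw [mul_pow]
    refine hasSum_le (fun n => ?_) (l2s_hasSum _) ((l2s_hasSum f).mul_left (‖C‖ ^ 2))
    rw [← mul_pow]
    gcongr
    exact C.le_opNorm _)

@[simp] theorem amp_apply (C : A →L[ℂ] A) (f : L2S A) (n : ℕ) : amp C f n = C (f n) := rfl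

/-- Right shift of a sequence. -/
def shFun (f : ℕ → A) : ℕ → A
  | 0 => 0
  | n + 1 => f n

theorem shFun_hasSum (f : L2S A) : HasSum (fun n => ‖shFun f n‖ ^ 2) (‖f‖ ^ 2) := by
  rw [← hasSum_nat_add_iff' 1]
  simpa [shFun] using l2s_hasSum f

/-- Right shift. -/
noncomputable def sh : L2S A →L[ℂ] L2S A :=
  LinearMap.mkContinuous
    { toFun := fun f => ⟨shFun f, memℓp_two (shFun_hasSum f).summable⟩
      map_add' := fun f g => by
        ext n
        cases n
        · exact (add_zero (0 : A)).symm
        · rfl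
      map_smul' := fun r f => by ext n; cases n <;> simp [shFun] } 1 (by
    intro f
    rw [one_mul]
    refine (sq_le_sq₀ (norm_nonneg _) (by positivity)).1 ?_
    exact hasSum_le (fun n => le_rfl) (l2s_hasSum _) (shFun_hasSum f))

@[simp] theorem sh_zero (f : L2S A) : sh f 0 = 0 := rfl
@[simp] theorem sh_succ (f : L2S A) (n : ℕ) : sh f (n + 1) = f n := rfl

theorem norm_sh (f : L2S A) : ‖sh f‖ ^ 2 = ‖f‖ ^ 2 :=
  (l2s_hasSum (sh f)).unique (shFun_hasSum f)

/-- Embedding at the zeroth place. -/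
noncomputable def sg : A →L[ℂ] L2S A :=
  lp.singleContinuousLinearMap ℂ (fun _ : ℕ => A) 2 0

@[simp] theorem sg_zero (a : A) : sg a 0 = a := by simp [sg]
@[simp] theorem sg_succ (a : A) (n : ℕ) : sg a (n + 1) = 0 := by simp [sg]

theorem norm_sg (a : A) : ‖sg a‖ = ‖a‖ := by simp [sg]

theorem l2s_inner_zero {f g : L2S A} (h : ∀ n, inner ℂ (f n) (g n) = 0) : inner ℂ f g = 0 := by
  rw [lp.inner_eq_tsum]
  simp [h]

theorem norm_amp_add (P Q : A →L[ℂ] A) (h : ∀ a, ‖Q a‖ ^ 2 + ‖P a‖ ^ 2 = ‖a‖ ^ 2) (f : L2S A) :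
    ‖amp Q f‖ ^ 2 + ‖amp P f‖ ^ 2 = ‖f‖ ^ 2 := by
  refine ((l2s_hasSum (amp Q f)).add (l2s_hasSum (amp P f))).unique ?_
  simpa [h] using l2s_hasSum f

theorem norm_amp_iso (G : A →L[ℂ] A) (h : ∀ a, ‖G a‖ = ‖a‖) (f : L2S A) :
    ‖amp G f‖ = ‖f‖ := by
  refine (sq_eq_sq₀ (norm_nonneg _) (norm_nonneg _)).1 ?_
  refine (l2s_hasSum (amp G f)).unique ?_
  simpa [h] using l2s_hasSum f

theorem norm_sq_add3 {E : Type u} [NormedAddCommGroup E] [InnerProductSpace ℂ E] (x y z : E)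
    (h1 : inner ℂ x y = 0) (h2 : inner ℂ x z = 0) (h3 : inner ℂ y z = 0) :
    ‖x + y + z‖ ^ 2 = ‖x‖ ^ 2 + ‖y‖ ^ 2 + ‖z‖ ^ 2 := by
  have h4 : inner ℂ (x + y) z = 0 := by rw [inner_add_left, h2, h3, add_zero]
  have := norm_add_sq_eq_norm_sq_add_norm_sq_of_inner_eq_zero _ _ h4
  have h5 := norm_add_sq_eq_norm_sq_add_norm_sq_of_inner_eq_zero _ _ h1
  nlinarith

end Lp

section Pair

variable {E F E' F' : Type u} [NormedAddCommGroup E] [InnerProductSpace ℂ E]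
  [NormedAddCommGroup F] [InnerProductSpace ℂ F] [NormedAddCommGroup E'] [InnerProductSpace ℂ E']
  [NormedAddCommGroup F'] [InnerProductSpace ℂ F']

/-- Transport a map of pairs to the Hilbert sum. -/
noncomputable def pr (f : E × F →L[ℂ] E' × F') : WithLp 2 (E × F) →L[ℂ] WithLp 2 (E' × F') :=
  (WithLp.prodContinuousLinearEquiv 2 ℂ E' F').symm.toContinuousLinearMap ∘L f ∘L
    (WithLp.prodContinuousLinearEquiv 2 ℂ E F).toContinuousLinearMap

@[simp] theorem pr_fst (f : E × F →L[ℂ] E' × F') (x : WithLp 2 (E × F)) :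
    (pr f x).fst = (f (x.fst, x.snd)).1 := rfl
@[simp] theorem pr_snd (f : E × F →L[ℂ] E' × F') (x : WithLp 2 (E × F)) :
    (pr f x).snd = (f (x.fst, x.snd)).2 := rfl

theorem pair_ext {x y : WithLp 2 (E × F)} (h1 : x.fst = y.fst) (h2 : x.snd = y.snd) : x = y :=
  WithLp.ofLp_injective 2 (Prod.ext h1 h2)

/-- Embeds a map as the first component. -/
noncomputable def inlp : E →L[ℂ] WithLp 2 (E × F) :=
  (WithLp.prodContinuousLinearEquiv 2 ℂ E F).symm.toContinuousLinearMap ∘L inl ℂ E F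

@[simp] theorem inlp_fst (x : E) : (inlp x : WithLp 2 (E × F)).fst = x := rfl
@[simp] theorem inlp_snd (x : E) : (inlp x : WithLp 2 (E × F)).snd = 0 := rfl

theorem pair_norm (x : WithLp 2 (E × F)) : ‖x‖ ^ 2 = ‖x.fst‖ ^ 2 + ‖x.snd‖ ^ 2 :=
  WithLp.prod_norm_sq_eq_of_L2 x

theorem pair_inner (x y : WithLp 2 (E × F)) :
    inner ℂ x y = inner ℂ x.fst y.fst + inner ℂ x.snd y.snd := rfl

/-- Diagonal operators. -/
noncomputable def dg (f : E →L[ℂ] E) (g : F →L[ℂ] F) : WithLp 2 (E × F) →L[ℂ] WithLp 2 (E × F) :=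
  pr (f.prodMap g)

@[simp] theorem dg_fst (f : E →L[ℂ] E) (g : F →L[ℂ] F) (x : WithLp 2 (E × F)) :
    (dg f g x).fst = f x.fst := rfl
@[simp] theorem dg_snd (f : E →L[ℂ] E) (g : F →L[ℂ] F) (x : WithLp 2 (E × F)) :
    (dg f g x).snd = g x.snd := rfl

theorem dg_mul (f f' : E →L[ℂ] E) (g g' : F →L[ℂ] F) : dg (f * f') (g * g') = dg f g * dg f' g' :=
  rfl
theorem dg_one : dg (1 : E →L[ℂ] E) (1 : F →L[ℂ] F) = 1 := rfl
theorem dg_zero : dg (0 : E →L[ℂ] E) (0 : F →L[ℂ] F) = 0 := rfl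
theorem dg_adjoint [CompleteSpace E] [CompleteSpace F] (f : E →L[ℂ] E) (g : F →L[ℂ] F) :
    adjoint (dg f g) = dg (adjoint f) (adjoint g) := by
  symm
  rw [eq_adjoint_iff]
  intro x y
  simp [adjoint_inner_left]

end Pair

section LpAlg
variable {A : Type u} [NormedAddCommGroup A] [InnerProductSpace ℂ A]

theorem amp_mul (C C' : A →L[ℂ] A) : amp (C * C') = amp C * amp C' := rfl
theorem amp_one : amp (1 : A →L[ℂ] A) = 1 := rfl
theorem amp_zero : amp (0 : A →L[ℂ] A) = 0 := rfl
theorem amp_adjoint [CompleteSpace A] (C : A →L[ℂ] A) : adjoint (amp C) = amp (adjoint C) := by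
  symm
  rw [eq_adjoint_iff]
  intro x y
  simp [lp.inner_eq_tsum, adjoint_inner_left]

end LpAlg

/-- The partially isometric intertwiner. -/
theorem exists_partial {H X : Type u} [NormedAddCommGroup H] [InnerProductSpace ℂ H]
    [CompleteSpace H] [NormedAddCommGroup X] [InnerProductSpace ℂ X] [CompleteSpace X]
    (R₁ R₂ : H →L[ℂ] X) (hR : ∀ h, ‖R₁ h‖ = ‖R₂ h‖) :
    ∃ U : X →L[ℂ] X, (∀ h, U (R₁ h) = R₂ h) ∧ (∀ h, adjoint U (R₂ h) = R₁ h) ∧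
      (∀ x, U (adjoint U (U x)) = U x) ∧
      ∀ (w : H →L[ℂ] H) (v : X →L[ℂ] X), (∀ h, v (R₁ h) = R₁ (w h)) →
        (∀ h, v (R₂ h) = R₂ (w h)) → (∀ h, adjoint v (R₁ h) = R₁ (adjoint w h)) →
        ∀ x, U (v x) = v (U x) := by
  set M : Submodule ℂ X := (LinearMap.range R₁.toLinearMap).topologicalClosure with hM
  have hMem : ∀ h, R₁ h ∈ M := fun h =>
    Submodule.le_topologicalClosure _ (LinearMap.mem_range_self R₁.toLinearMap h)
  have : CompleteSpace M := (Submodule.isClosed_topologicalClosure _).completeSpace_coe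
  let e : H →ₗ[ℂ] M := R₁.toLinearMap.codRestrict M hMem
  have he : DenseRange e := by
    intro y
    rw [closure_subtype]
    have h1 : (y : X) ∈ closure (Set.range R₁) := y.2
    have h2 : ((↑) : M → X) '' Set.range e = Set.range R₁ := by
      rw [← Set.range_comp]
      rfl
    rw [h2]
    exact h1
  have hnorm : ∀ h, ‖R₂.toLinearMap h‖ ≤ 1 * ‖e h‖ := by
    intro h
    rw [one_mul]
    exact (hR h).symm.le
  let f : M →L[ℂ] X := R₂.toLinearMap.extendOfNorm e
  have hf : ∀ h, f (e h) = R₂ h := fun h => LinearMap.extendOfNorm_eq he ⟨1, hnorm⟩ h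
  have hfn : ∀ m, ‖f m‖ = ‖m‖ := by
    intro m
    refine congrFun (he.equalizer (f.continuous.norm) continuous_norm (funext fun h => ?_)) m
    simp only [Function.comp_apply, hf]
    exact (hR h).symm
  let fi : M →ₗᵢ[ℂ] X := ⟨f.toLinearMap, hfn⟩
  let p : X →L[ℂ] M := M.orthogonalProjectionOnto
  let U : X →L[ℂ] X := f ∘L p
  have hp : ∀ m : M, p m = m := fun m => Submodule.orthogonalProjectionOnto_mem_subspace_eq_self m
  have hU1 : ∀ h, U (R₁ h) = R₂ h := by
    intro h
    change f (p (e h)) = _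
    rw [hp, hf]
  have hUU : ∀ x, adjoint U (U x) = p x := by
    intro x
    refine ext_inner_right ℂ fun y => ?_
    rw [adjoint_inner_left]
    change inner ℂ (fi (p x)) (fi (p y)) = _
    rw [fi.inner_map_map, Submodule.coe_inner]
    have h5 : y - p y ∈ Mᗮ := Submodule.sub_starProjection_mem_orthogonal y
    have h6 := h5 _ (p x).2
    rw [inner_sub_right] at h6
    exact (sub_eq_zero.1 h6).symm
  refine ⟨U, hU1, ?_, ?_, ?_⟩
  · intro h
    rw [← hU1, hUU]
    exact congrArg Subtype.val (hp (e h))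
  · intro x
    rw [hUU]
    change f (p (p x)) = f (p x)
    rw [hp]
  · intro w v h1 h2 h3 x
    have hker : ∀ x ∈ Mᗮ, U x = 0 := by
      intro x hx
      change f (p x) = 0
      rw [show p x = 0 from Submodule.orthogonalProjectionOnto_apply_of_mem_orthogonal hx, map_zero]
    have hvM : ∀ x ∈ Mᗮ, v x ∈ Mᗮ := by
      intro x hx
      rw [hM, Submodule.orthogonal_closure, Submodule.mem_orthogonal]
      rintro _ ⟨h, rfl⟩
      change inner ℂ (R₁ h) (v x) = 0
      rw [← adjoint_inner_left, h3]
      exact hx _ (hMem _)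
    have hcl : M ≤ LinearMap.ker (U ∘L v - v ∘L U).toLinearMap := by
      refine Submodule.topologicalClosure_minimal _ ?_ (ContinuousLinearMap.isClosed_ker _)
      rintro _ ⟨h, rfl⟩
      change U (v (R₁ h)) - v (U (R₁ h)) = 0
      rw [h1, hU1, hU1, h2, sub_self]
    have hdec : x = (p x : X) + (x - p x) := by abel
    have h5 : x - p x ∈ Mᗮ := Submodule.sub_starProjection_mem_orthogonal x
    have h6 : U (v (p x)) - v (U (p x)) = 0 := hcl (p x).2
    rw [hdec, map_add, map_add, map_add, hker _ h5, hker _ (hvM _ h5), add_zero, add_zero]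
    exact sub_eq_zero.1 h6

/-- Defect operators. -/
theorem exists_defect {H : Type u} [NormedAddCommGroup H] [InnerProductSpace ℂ H]
    [CompleteSpace H] (S : H →L[ℂ] H) (hS : ‖S‖ ≤ 1) :
    ∃ D : H →L[ℂ] H, (∀ h, ‖D h‖ ^ 2 + ‖S h‖ ^ 2 = ‖h‖ ^ 2) ∧
      ∀ w : H →L[ℂ] H, w * S = S * w → w * adjoint S = adjoint S * w → ∀ h, w (D h) = D (w h) := by
  have hpos : 0 ≤ 1 - adjoint S * S := by
    have h0 : 0 ≤ adjoint S * S := star_mul_self_nonneg S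
    refine sub_nonneg.2 ((CStarAlgebra.norm_le_one_iff_of_nonneg _ h0).1 ?_)
    refine (norm_mul_le _ _).trans ?_
    rw [LinearIsometryEquiv.norm_map]
    exact mul_le_one₀ hS (norm_nonneg _) hS
  refine ⟨CFC.sqrt (1 - adjoint S * S), ?_, ?_⟩
  · intro h
    have h1 := CFC.sqrt_mul_sqrt_self (1 - adjoint S * S) hpos
    have h2 : adjoint (CFC.sqrt (1 - adjoint S * S)) = CFC.sqrt (1 - adjoint S * S) :=
      ((nonneg_iff_isPositive _).1 (CFC.sqrt_nonneg (1 - adjoint S * S))).isSelfAdjoint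
    set D := CFC.sqrt (1 - adjoint S * S)
    have h3 : inner ℂ (D h) (D h) + inner ℂ (S h) (S h) = inner ℂ h h := by
      rw [← adjoint_inner_right, h2, ← adjoint_inner_right S]
      have : D (D h) = h - adjoint S (S h) := congrArg (fun A : H →L[ℂ] H => A h) h1
      rw [this, inner_sub_right]
      ring
    simp only [inner_self_eq_norm_sq_to_K] at h3
    exact_mod_cast h3
  · intro w h1 h2 h
    have h3 : Commute (1 - adjoint S * S) w := by
      refine (Commute.one_left w).sub_left (Commute.mul_left ?_ ?_)
      · exact h2.symm
      · exact h1.symm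
    have h4 : Commute (CFC.sqrt (1 - adjoint S * S)) w := h3.cfcₙ_nnreal _
    exact (congrArg (fun A : H →L[ℂ] H => A h) h4.eq).symm

section Core

variable {H A : Type u} [NormedAddCommGroup H] [InnerProductSpace ℂ H]
  [NormedAddCommGroup A] [InnerProductSpace ℂ A]

/-- The basic isometric dilation. -/
noncomputable def wd (S : H →L[ℂ] H) (F : H →L[ℂ] A) (P Q : A →L[ℂ] A) :
    WithLp 2 (H × L2S A) →L[ℂ] WithLp 2 (H × L2S A) :=
  pr ((S ∘L fst ℂ H (L2S A)).prod (sg ∘L F ∘L fst ℂ H (L2S A) +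
    sh ∘L amp Q ∘L snd ℂ H (L2S A) + amp P ∘L snd ℂ H (L2S A)))

@[simp] theorem wd_fst (S : H →L[ℂ] H) (F : H →L[ℂ] A) (P Q : A →L[ℂ] A)
    (x : WithLp 2 (H × L2S A)) : (wd S F P Q x).fst = S x.fst := rfl

theorem wd_snd (S : H →L[ℂ] H) (F : H →L[ℂ] A) (P Q : A →L[ℂ] A)
    (x : WithLp 2 (H × L2S A)) :
    (wd S F P Q x).snd = sg (F x.fst) + sh (amp Q x.snd) + amp P x.snd := rfl

@[simp] theorem wd_snd_zero (S : H →L[ℂ] H) (F : H →L[ℂ] A) (P Q : A →L[ℂ] A)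
    (x : WithLp 2 (H × L2S A)) :
    (wd S F P Q x).snd 0 = F x.fst + P (x.snd 0) := by
  simp [wd_snd]

@[simp] theorem wd_snd_succ (S : H →L[ℂ] H) (F : H →L[ℂ] A) (P Q : A →L[ℂ] A)
    (x : WithLp 2 (H × L2S A)) (n : ℕ) :
    (wd S F P Q x).snd (n + 1) = Q (x.snd n) + P (x.snd (n + 1)) := by
  simp [wd_snd]

theorem norm_wd {S : H →L[ℂ] H} {F : H →L[ℂ] A} {P Q : A →L[ℂ] A}
    (hPQ : ∀ a b, inner ℂ (Q a) (P b) = 0) (hn : ∀ a, ‖Q a‖ ^ 2 + ‖P a‖ ^ 2 = ‖a‖ ^ 2)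
    (hFP : ∀ h a, inner ℂ (F h) (P a) = 0) (hF : ∀ h, ‖F h‖ ^ 2 + ‖S h‖ ^ 2 = ‖h‖ ^ 2)
    (x : WithLp 2 (H × L2S A)) : ‖wd S F P Q x‖ = ‖x‖ := by
  refine (sq_eq_sq₀ (norm_nonneg _) (norm_nonneg _)).1 ?_
  rw [pair_norm, pair_norm, wd_fst, wd_snd, norm_sq_add3, norm_sh, norm_sg]
  · have h1 := norm_amp_add P Q hn x.snd
    have h2 := hF x.fst
    linarith
  · refine l2s_inner_zero fun n => ?_
    cases n <;> simp
  · refine l2s_inner_zero fun n => ?_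
    cases n <;> simp [hFP]
  · refine l2s_inner_zero fun n => ?_
    cases n <;> simp [hPQ]

theorem adjoint_mul_self_of_norm {K : Type u} [NormedAddCommGroup K] [InnerProductSpace ℂ K]
    [CompleteSpace K] {V : K →L[ℂ] K} (h : ∀ x, ‖V x‖ = ‖x‖) : adjoint V * V = 1 := by
  let Vi : K →ₗᵢ[ℂ] K := ⟨V.toLinearMap, h⟩
  ext x
  refine ext_inner_right ℂ fun y => ?_
  rw [mul_def, comp_apply, adjoint_inner_left]
  exact Vi.inner_map_map x y

/-- Abstract form of the Ando dilation. -/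
theorem ando_core [CompleteSpace H] [CompleteSpace A] (S : Fin 2 → (H →L[ℂ] H))
    (F : Fin 2 → (H →L[ℂ] A)) (P Q G G' : A →L[ℂ] A)
    (hcomm : S 0 * S 1 = S 1 * S 0)
    (hPQ : ∀ a b, inner ℂ (Q a) (P b) = 0) (hn : ∀ a, ‖Q a‖ ^ 2 + ‖P a‖ ^ 2 = ‖a‖ ^ 2)
    (hFP : ∀ i h a, inner ℂ (F i h) (P a) = 0)
    (hF : ∀ i h, ‖F i h‖ ^ 2 + ‖S i h‖ ^ 2 = ‖h‖ ^ 2)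
    (hPP : ∀ a, P (P a) = 0) (hQQ : ∀ a, Q (Q a) = 0) (hQP : ∀ a, Q (P a) + P (Q a) = a)
    (hQF : ∀ i h, Q (F i h) = 0)
    (hG : ∀ a, ‖G a‖ = ‖a‖) (hG' : ∀ a, ‖G' a‖ = ‖a‖) (hGG' : ∀ a, G (G' a) = a)
    (hG'G : ∀ a, G' (G a) = a)
    (hGF : ∀ h, G (F 0 (S 1 h) + P (F 1 h)) = F 1 (S 0 h) + P (F 0 h))
    (α : (H →L[ℂ] H) → (A →L[ℂ] A)) (hα1 : α 1 = 1) (hα0 : α 0 = 0)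
    (hαm : ∀ w v, α (w * v) = α w * α v) (hαa : ∀ w, adjoint (α w) = α (adjoint w)) :
    ∃ (K : Type u) (_ : NormedAddCommGroup K) (_ : InnerProductSpace ℂ K) (_ : CompleteSpace K)
      (ι : H →ₗᵢ[ℂ] K) (V : Fin 2 → (K →L[ℂ] K)) (hat : (H →L[ℂ] H) → (K →L[ℂ] K)),
      (∀ i, adjoint (V i) * V i = 1) ∧ V 0 * V 1 = V 1 * V 0 ∧
      (∀ i h, adjoint (V i) (ι h) = ι (adjoint (S i) h)) ∧
      hat 1 = 1 ∧ hat 0 = 0 ∧ (∀ w v, hat (w * v) = hat w * hat v) ∧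
      (∀ w, adjoint (hat w) = hat (adjoint w)) ∧ (∀ w h, hat w (ι h) = ι (w h)) ∧
      (∀ w, (∀ i, S i * w = w * S i) → (∀ i h, F i (w h) = α w (F i h)) →
        (∀ a, P (α w a) = α w (P a)) → (∀ a, Q (α w a) = α w (Q a)) →
        (∀ a, G (α w a) = α w (G a)) → (∀ a, G' (α w a) = α w (G' a)) →
        ∀ i, V i * hat w = hat w * V i) := by
  let g : WithLp 2 (H × L2S A) →L[ℂ] WithLp 2 (H × L2S A) := dg 1 (amp G)
  let g' : WithLp 2 (H × L2S A) →L[ℂ] WithLp 2 (H × L2S A) := dg 1 (amp G')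
  let V : Fin 2 → (WithLp 2 (H × L2S A) →L[ℂ] WithLp 2 (H × L2S A)) :=
    ![g * wd (S 0) (F 0) P Q, wd (S 1) (F 1) P Q * g']
  have hgn : ∀ x, ‖g x‖ = ‖x‖ := by
    intro x
    refine (sq_eq_sq₀ (norm_nonneg _) (norm_nonneg _)).1 ?_
    rw [pair_norm, pair_norm]
    simp only [g, dg_fst, dg_snd, norm_amp_iso G hG]
    rfl
  have hgn' : ∀ x, ‖g' x‖ = ‖x‖ := by
    intro x
    refine (sq_eq_sq₀ (norm_nonneg _) (norm_nonneg _)).1 ?_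
    rw [pair_norm, pair_norm]
    simp only [g', dg_fst, dg_snd, norm_amp_iso G' hG']
    rfl
  have hwn : ∀ i x, ‖wd (S i) (F i) P Q x‖ = ‖x‖ := fun i =>
    norm_wd hPQ hn (hFP i) (hF i)
  have hVn : ∀ i x, ‖V i x‖ = ‖x‖ := by
    intro i x
    fin_cases i
    · exact (hgn _).trans (hwn 0 x)
    · exact (hwn 1 _).trans (hgn' x)
  have hVf : ∀ i x, (V i x).fst = S i x.fst := by
    intro i x
    fin_cases i
    · rfl
    · rfl
  let ι : H →ₗᵢ[ℂ] WithLp 2 (H × L2S A) := ⟨(inlp : H →L[ℂ] WithLp 2 (H × L2S A)).toLinearMap, by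
    intro x
    refine (sq_eq_sq₀ (norm_nonneg _) (norm_nonneg _)).1 ?_
    change ‖(inlp x : WithLp 2 (H × L2S A))‖ ^ 2 = _
    rw [pair_norm]
    simp⟩
  have hι : ∀ h, ι h = inlp h := fun h => rfl
  refine ⟨WithLp 2 (H × L2S A), inferInstance, inferInstance, inferInstance, ι, V,
    fun w => dg w (amp (α w)), ?_, ?_, ?_, ?_, ?_, ?_, ?_, ?_, ?_⟩
  · exact fun i => adjoint_mul_self_of_norm (hVn i)
  · have hg'g : g' * g = 1 := by
      simp only [g, g', ← dg_mul, ← amp_mul]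
      rw [show G' * G = 1 from by ext a; exact hG'G a]
      rfl
    have hgg' : g * g' = 1 := by
      simp only [g, g', ← dg_mul, ← amp_mul]
      rw [show G * G' = 1 from by ext a; exact hGG' a]
      rfl
    have e1 : ∀ a b c, Q c = 0 → Q (c + P a) + P (Q a + P b) = a := by
      intro a b c hc
      rw [map_add, map_add, hc, hPP, zero_add, add_zero, hQP]
    have key : g * (wd (S 0) (F 0) P Q * wd (S 1) (F 1) P Q) =
        wd (S 1) (F 1) P Q * wd (S 0) (F 0) P Q * g := by
      ext1 x
      simp only [mul_def, comp_apply]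
      refine pair_ext ?_ ?_
      · exact congrArg (fun A : H →L[ℂ] H => A x.fst) hcomm
      · ext n
        rcases n with _ | _ | n
        · have := hGF x.fst
          simp only [g, dg_snd, amp_apply, wd_snd_zero, wd_fst, dg_fst, map_add, hPP, add_zero]
          simpa using this
        · simp only [g, dg_snd, amp_apply, wd_snd_zero, wd_snd_succ, wd_fst, dg_fst]
          rw [e1 _ _ _ (hQF _ _), e1 _ _ _ (hQF _ _)]
        · simp only [g, dg_snd, amp_apply, wd_snd_zero, wd_snd_succ, wd_fst, dg_fst]
          rw [e1 _ _ _ (hQQ _), e1 _ _ _ (hQQ _)]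
    change g * wd (S 0) (F 0) P Q * (wd (S 1) (F 1) P Q * g') =
      wd (S 1) (F 1) P Q * g' * (g * wd (S 0) (F 0) P Q)
    calc _ = g * (wd (S 0) (F 0) P Q * wd (S 1) (F 1) P Q) * g' := by noncomm_ring
      _ = wd (S 1) (F 1) P Q * wd (S 0) (F 0) P Q * (g * g') := by rw [key]; noncomm_ring
      _ = wd (S 1) (F 1) P Q * (g' * g) * wd (S 0) (F 0) P Q := by rw [hgg', hg'g]; noncomm_ring
      _ = _ := by noncomm_ring
  · intro i h
    refine ext_inner_right ℂ fun y => ?_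
    rw [adjoint_inner_left, hι, hι, pair_inner, pair_inner, hVf]
    simp [adjoint_inner_left]
  · simp only [hα1, amp_one, dg_one]
  · simp only [hα0, amp_zero, dg_zero]
  · intro w v
    simp only [hαm, amp_mul, dg_mul]
  · intro w
    rw [dg_adjoint, amp_adjoint, hαa]
  · intro w h
    refine pair_ext ?_ ?_
    · rfl
    · simp [hι]
  · intro w hS hFw hP hQ hGw hGw' i
    have hw : ∀ i, wd (S i) (F i) P Q * dg w (amp (α w)) = dg w (amp (α w)) * wd (S i) (F i) P Q := by
      intro i
      ext1 x
      simp only [mul_def, comp_apply]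
      refine pair_ext ?_ ?_
      · exact congrArg (fun A : H →L[ℂ] H => A x.fst) (hS i)
      · ext n
        cases n <;> simp [hFw, hP, hQ]
    have hg : g * dg w (amp (α w)) = dg w (amp (α w)) * g := by
      simp only [g, ← dg_mul, ← amp_mul, one_mul, mul_one]
      rw [show G * α w = α w * G from by ext a; exact hGw a]
    have hg' : g' * dg w (amp (α w)) = dg w (amp (α w)) * g' := by
      simp only [g', ← dg_mul, ← amp_mul, one_mul, mul_one]
      rw [show G' * α w = α w * G' from by ext a; exact hGw' a]
    fin_cases i
    · change g * wd (S 0) (F 0) P Q * dg w (amp (α w)) = dg w (amp (α w)) * (g * wd (S 0) (F 0) P Q)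
      rw [mul_assoc, hw, ← mul_assoc, hg, mul_assoc]
    · change wd (S 1) (F 1) P Q * g' * dg w (amp (α w)) = dg w (amp (α w)) * (wd (S 1) (F 1) P Q * g')
      rw [mul_assoc, hg', ← mul_assoc, hw, mul_assoc]

end Core

section StepB

variable {E : Type u} [NormedAddCommGroup E] [InnerProductSpace ℂ E]

/-- Two-by-two operator matrices. -/
noncomputable def blk (a b c d : E →L[ℂ] E) : WithLp 2 (E × E) →L[ℂ] WithLp 2 (E × E) :=
  pr ((a ∘L fst ℂ E E + b ∘L snd ℂ E E).prod (c ∘L fst ℂ E E + d ∘L snd ℂ E E))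

@[simp] theorem blk_fst (a b c d : E →L[ℂ] E) (x : WithLp 2 (E × E)) :
    (blk a b c d x).fst = a x.fst + b x.snd := rfl
@[simp] theorem blk_snd (a b c d : E →L[ℂ] E) (x : WithLp 2 (E × E)) :
    (blk a b c d x).snd = c x.fst + d x.snd := rfl

theorem blk_adjoint [CompleteSpace E] (a b c d : E →L[ℂ] E) :
    adjoint (blk a b c d) = blk (adjoint a) (adjoint c) (adjoint b) (adjoint d) := by
  symm
  rw [eq_adjoint_iff]
  intro x y
  simp only [pair_inner, blk_fst, blk_snd, inner_add_left, inner_add_right, adjoint_inner_left]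
  ring

/-- The unitary (Halmos) dilation of a partial isometry. -/
noncomputable def hal (U U' : E →L[ℂ] E) : WithLp 2 (E × E) →L[ℂ] WithLp 2 (E × E) :=
  blk U (1 - U * U') (1 - U' * U) (-U')

theorem hal_mul {U U' : E →L[ℂ] E} (h : ∀ x, U (U' (U x)) = U x) (h' : ∀ x, U' (U (U' x)) = U' x)
    (x : WithLp 2 (E × E)) : hal U U' (hal U' U x) = x := by
  refine pair_ext ?_ ?_
  · simp [hal, h, h', mul_def]
  · simp [hal, h, h', mul_def]

theorem hal_adjoint [CompleteSpace E] (U : E →L[ℂ] E) :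
    adjoint (hal U (adjoint U)) = hal (adjoint U) U := by
  rw [hal, blk_adjoint, hal]
  have h1 : adjoint (1 : E →L[ℂ] E) = 1 := star_one _
  simp [mul_def, adjoint_comp, h1]

theorem hal_comm {U U' v : E →L[ℂ] E} (h : ∀ x, U (v x) = v (U x)) (h' : ∀ x, U' (v x) = v (U' x))
    (x : WithLp 2 (E × E)) : hal U U' (dg v v x) = dg v v (hal U U' x) := by
  refine pair_ext ?_ ?_
  · simp [hal, h, h', mul_def]
  · simp [hal, h, h', mul_def]

/-- Down shift of pairs. -/
noncomputable def nd : WithLp 2 (E × E) →L[ℂ] WithLp 2 (E × E) := blk 0 0 1 0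
/-- Up shift of pairs. -/
noncomputable def nu : WithLp 2 (E × E) →L[ℂ] WithLp 2 (E × E) := blk 0 1 0 0

@[simp] theorem nd_fst (x : WithLp 2 (E × E)) : (nd x).fst = 0 := by simp [nd]
@[simp] theorem nd_snd (x : WithLp 2 (E × E)) : (nd x).snd = x.fst := by simp [nd]
@[simp] theorem nu_fst (x : WithLp 2 (E × E)) : (nu x).fst = x.snd := by simp [nu]
@[simp] theorem nu_snd (x : WithLp 2 (E × E)) : (nu x).snd = 0 := by simp [nu]

/-- Ando dilation, functorial in the double commutant. -/
theorem stepB [CompleteSpace E] (S : Fin 2 → (E →L[ℂ] E)) (hS : ∀ i, ‖S i‖ ≤ 1)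
    (hcomm : S 0 * S 1 = S 1 * S 0) :
    ∃ (K : Type u) (_ : NormedAddCommGroup K) (_ : InnerProductSpace ℂ K) (_ : CompleteSpace K)
      (ι : E →ₗᵢ[ℂ] K) (V : Fin 2 → (K →L[ℂ] K)) (hat : (E →L[ℂ] E) → (K →L[ℂ] K)),
      (∀ i, adjoint (V i) * V i = 1) ∧ V 0 * V 1 = V 1 * V 0 ∧
      (∀ i h, adjoint (V i) (ι h) = ι (adjoint (S i) h)) ∧
      hat 1 = 1 ∧ hat 0 = 0 ∧ (∀ w v, hat (w * v) = hat w * hat v) ∧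
      (∀ w, adjoint (hat w) = hat (adjoint w)) ∧ (∀ w h, hat w (ι h) = ι (w h)) ∧
      (∀ w, (∀ i, S i * w = w * S i) → (∀ i, adjoint (S i) * w = w * adjoint (S i)) →
        ∀ i, V i * hat w = hat w * V i) := by
  choose D hD hDw using fun i => exists_defect (S i) (hS i)
  let R₁ : E →L[ℂ] WithLp 2 (E × E) := inlp ∘L D 0 ∘L S 1 + nd ∘L inlp ∘L D 1
  let R₂ : E →L[ℂ] WithLp 2 (E × E) := inlp ∘L D 1 ∘L S 0 + nd ∘L inlp ∘L D 0
  have h1f : ∀ h, (R₁ h).fst = D 0 (S 1 h) := fun h => by simp [R₁]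
  have h1s : ∀ h, (R₁ h).snd = D 1 h := fun h => by simp [R₁]
  have h2f : ∀ h, (R₂ h).fst = D 1 (S 0 h) := fun h => by simp [R₂]
  have h2s : ∀ h, (R₂ h).snd = D 0 h := fun h => by simp [R₂]
  have hc : ∀ h, S 0 (S 1 h) = S 1 (S 0 h) := fun h =>
    congrArg (fun A : E →L[ℂ] E => A h) hcomm
  have hR : ∀ h, ‖R₁ h‖ = ‖R₂ h‖ := by
    intro h
    refine (sq_eq_sq₀ (norm_nonneg _) (norm_nonneg _)).1 ?_
    rw [pair_norm, pair_norm, h1f, h1s, h2f, h2s]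
    have a1 := hD 0 (S 1 h)
    have a2 := hD 1 h
    have a3 := hD 1 (S 0 h)
    have a4 := hD 0 h
    rw [hc] at a1
    linarith
  obtain ⟨U, hU1, hU2, hU3, hUw⟩ := exists_partial R₁ R₂ hR
  have hU4 : ∀ x, adjoint U (U (adjoint U x)) = adjoint U x := by
    have : U ∘L adjoint U ∘L U = U := by ext1 x; exact hU3 x
    have := congrArg adjoint this
    simp only [adjoint_comp, adjoint_adjoint] at this
    exact fun x => congrArg (fun A : _ →L[ℂ] _ => A x) this
  have hGG' := fun x => hal_mul hU3 hU4 x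
  have hG'G := fun x => hal_mul hU4 hU3 x
  have hGa := hal_adjoint U
  have hGa' : adjoint (hal (adjoint U) U) = hal U (adjoint U) := by
    rw [← hGa, adjoint_adjoint]
  have hG : ∀ a, ‖hal U (adjoint U) a‖ = ‖a‖ := by
    intro a
    rw [← sq_eq_sq₀ (norm_nonneg _) (norm_nonneg _), apply_norm_sq_eq_inner_adjoint_left,
      hGa, comp_apply, hG'G, inner_self_eq_norm_sq]
  have hG' : ∀ a, ‖hal (adjoint U) U a‖ = ‖a‖ := by
    intro a
    rw [← sq_eq_sq₀ (norm_nonneg _) (norm_nonneg _), apply_norm_sq_eq_inner_adjoint_left,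
      hGa', comp_apply, hGG', inner_self_eq_norm_sq]
  obtain ⟨K, i1, i2, i3, ι, V, hat, b1, b2, b3, b4, b5, b6, b7, b8, b9⟩ := ando_core S
    (fun i => (inlp : WithLp 2 (E × E) →L[ℂ] WithLp 2 (WithLp 2 (E × E) × WithLp 2 (E × E))) ∘L
      inlp ∘L D i) (dg nd nd) (dg nu nu) (hal U (adjoint U)) (hal (adjoint U) U) hcomm
    (by intro a b; simp [pair_inner])
    (by intro a; simp only [pair_norm, dg_fst, dg_snd, nd_fst, nd_snd, nu_fst, nu_snd, norm_zero]; ring)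
    (by intro i h a; simp [pair_inner])
    (by
      intro i h
      rw [← hD i h]
      simp [pair_norm])
    (by intro a; refine pair_ext (pair_ext ?_ ?_) (pair_ext ?_ ?_) <;> simp)
    (by intro a; refine pair_ext (pair_ext ?_ ?_) (pair_ext ?_ ?_) <;> simp)
    (by intro a; refine pair_ext (pair_ext ?_ ?_) (pair_ext ?_ ?_) <;> simp)
    (by intro i a; refine pair_ext (pair_ext ?_ ?_) (pair_ext ?_ ?_) <;> simp)
    hG hG' hGG' hG'G
    (by
      intro h
      have e1 : (inlp (inlp (D 0 (S 1 h))) + dg nd nd (inlp (inlp (D 1 h))) :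
          WithLp 2 (WithLp 2 (E × E) × WithLp 2 (E × E))) = inlp (R₁ h) := by
        refine pair_ext (pair_ext ?_ ?_) (pair_ext ?_ ?_) <;> simp [h1f, h1s]
      have e2 : (inlp (inlp (D 1 (S 0 h))) + dg nd nd (inlp (inlp (D 0 h))) :
          WithLp 2 (WithLp 2 (E × E) × WithLp 2 (E × E))) = inlp (R₂ h) := by
        refine pair_ext (pair_ext ?_ ?_) (pair_ext ?_ ?_) <;> simp [h2f, h2s]
      simp only [comp_apply]
      rw [e1, e2]
      refine pair_ext ?_ ?_
      · simp [hal, hU1]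
      · simp [hal, hU1, hU2, mul_def])
    (fun w => dg (dg w w) (dg w w))
    (by simp only [dg_one]) (by simp only [dg_zero])
    (by intro w v; simp only [dg_mul]) (by intro w; simp only [dg_adjoint])
  refine ⟨K, i1, i2, i3, ι, V, hat, b1, b2, b3, b4, b5, b6, b7, b8, ?_⟩
  have hUv : ∀ w, (∀ i, S i * w = w * S i) → (∀ i, adjoint (S i) * w = w * adjoint (S i)) →
      ∀ x, U (dg w w x) = dg w w (U x) := by
    intro w h1 h2
    have hS' : ∀ i h, S i (w h) = w (S i h) := fun i h =>
      congrArg (fun A : E →L[ℂ] E => A h) (h1 i)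
    have hd := fun i => hDw i w (h1 i).symm (h2 i).symm
    have h1' : ∀ i, S i * adjoint w = adjoint w * S i := by
      intro i
      have := congrArg adjoint (h2 i)
      simp only [mul_def, adjoint_comp, adjoint_adjoint] at this
      exact this.symm
    have h2' : ∀ i, adjoint (S i) * adjoint w = adjoint w * adjoint (S i) := by
      intro i
      have := congrArg adjoint (h1 i)
      simp only [mul_def, adjoint_comp] at this
      exact this.symm
    have hS'' : ∀ i h, S i (adjoint w h) = adjoint w (S i h) := fun i h =>
      congrArg (fun A : E →L[ℂ] E => A h) (h1' i)
    have hd' := fun i => hDw i (adjoint w) (h1' i).symm (h2' i).symm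
    refine hUw w (dg w w) ?_ ?_ ?_
    · intro h
      refine pair_ext ?_ ?_ <;> simp [h1f, h1s, hd, hS']
    · intro h
      refine pair_ext ?_ ?_ <;> simp [h2f, h2s, hd, hS']
    · intro h
      rw [dg_adjoint]
      refine pair_ext ?_ ?_ <;> simp [h1f, h1s, hd', hS'']
  intro w h1 h2
  have hd := fun i => hDw i w (h1 i).symm (h2 i).symm
  have h1' : ∀ i, S i * adjoint w = adjoint w * S i := by
    intro i
    have := congrArg adjoint (h2 i)
    simp only [mul_def, adjoint_comp, adjoint_adjoint] at this
    exact this.symm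
  have h2' : ∀ i, adjoint (S i) * adjoint w = adjoint w * adjoint (S i) := by
    intro i
    have := congrArg adjoint (h1 i)
    simp only [mul_def, adjoint_comp] at this
    exact this.symm
  have k1 := hUv w h1 h2
  have k2 : ∀ x, adjoint U (dg w w x) = dg w w (adjoint U x) := by
    have := hUv (adjoint w) h1' h2'
    have : U ∘L dg (adjoint w) (adjoint w) = dg (adjoint w) (adjoint w) ∘L U := by
      ext1 x; exact this x
    have := congrArg adjoint this
    simp only [adjoint_comp, dg_adjoint, adjoint_adjoint] at this
    exact fun x => congrArg (fun A : _ →L[ℂ] _ => A x) this.symm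
  refine b9 w h1 ?_ ?_ ?_ (hal_comm k1 k2) (hal_comm k2 k1)
  · intro i h
    refine pair_ext (pair_ext ?_ ?_) (pair_ext ?_ ?_) <;> simp [hd]
  · intro a; refine pair_ext (pair_ext ?_ ?_) (pair_ext ?_ ?_) <;> simp
  · intro a; refine pair_ext (pair_ext ?_ ?_) (pair_ext ?_ ?_) <;> simp

end StepB
/-- Ando-type dilation on `ℕ² × 𝔽_k⁺`: given a row contraction `(T₁, …, T_k)` and commuting
contractions `S₁, S₂` commuting with each `T_j` and satisfying the Brehmer-type positivity
condition for `i = 1, 2`, there exist commuting isometric dilations `V₁, V₂` of `S₁, S₂` and a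
row isometric dilation `(W₁, …, W_k)` of `(T₁, …, T_k)` on a common Hilbert space `K ⊇ H`,
such that each `Vᵢ` doubly commutes with each `W_j`, `H` is invariant under all the adjoints,
and compressions of words are the corresponding words. -/
theorem ando_type_dilation_row {H : Type u} [NormedAddCommGroup H] [InnerProductSpace ℂ H]
    [CompleteSpace H] {k : ℕ}
    (T : Fin k → (H →L[ℂ] H)) (hTcontr : ∀ j, ‖T j‖ ≤ 1)
    (hTrow : ∑ j, T j * adjoint (T j) ≤ 1)
    (S₁ S₂ : H →L[ℂ] H) (hS₁ : ‖S₁‖ ≤ 1) (hS₂ : ‖S₂‖ ≤ 1)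
    (hScomm : S₁ * S₂ = S₂ * S₁)
    (hST₁ : ∀ j, S₁ * T j = T j * S₁) (hST₂ : ∀ j, S₂ * T j = T j * S₂)
    (hpos₁ : 0 ≤ 1 - S₁ * adjoint S₁ - ∑ j, T j * adjoint (T j)
        + ∑ j, S₁ * (T j * adjoint (T j)) * adjoint S₁)
    (hpos₂ : 0 ≤ 1 - S₂ * adjoint S₂ - ∑ j, T j * adjoint (T j)
        + ∑ j, S₂ * (T j * adjoint (T j)) * adjoint S₂) :
    ∃ (K : Type u) (_ : NormedAddCommGroup K) (_ : InnerProductSpace ℂ K) (_ : CompleteSpace K)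
      (ι : H →ₗᵢ[ℂ] K) (V₁ V₂ : K →L[ℂ] K) (W : Fin k → (K →L[ℂ] K)),
      -- V₁, V₂ are commuting isometries
      adjoint V₁ * V₁ = 1 ∧ adjoint V₂ * V₂ = 1 ∧ V₁ * V₂ = V₂ * V₁ ∧
      -- (W₁, …, W_k) is a row isometry
      (∀ j, adjoint (W j) * W j = 1) ∧ (∑ j, W j * adjoint (W j) ≤ 1) ∧
      -- (1) each Vᵢ doubly commutes with each W_j
      (∀ j, V₁ * W j = W j * V₁ ∧ adjoint V₁ * W j = W j * adjoint V₁) ∧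
      (∀ j, V₂ * W j = W j * V₂ ∧ adjoint V₂ * W j = W j * adjoint V₂) ∧
      -- (2) H is invariant under the adjoints, on which they restrict to the adjoints of
      -- the original operators
      (∀ h : H, adjoint V₁ (ι h) = ι (adjoint S₁ h)) ∧
      (∀ h : H, adjoint V₂ (ι h) = ι (adjoint S₂ h)) ∧
      (∀ (j : Fin k) (h : H), adjoint (W j) (ι h) = ι (adjoint (T j) h)) ∧
      -- in particular, compressions of words equal the corresponding words
      (∀ (n m : ℕ) (l : List (Fin k)),
        adjoint ι.toContinuousLinearMap ∘L
            ((V₁ ^ n * V₂ ^ m * (l.map W).prod) ∘L ι.toContinuousLinearMap) =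
          S₁ ^ n * S₂ ^ m * (l.map T).prod) := by
  obtain ⟨K0, j1, j2, j3, ι0, Z, W, a1, a2, a3, a4, a5, a6, a7⟩ := stepA T hTrow ![S₁, S₂]
    (by intro i; fin_cases i; exacts [hS₁, hS₂]) hScomm
    (by intro i; fin_cases i; exacts [hST₁, hST₂])
    (by intro i; fin_cases i; exacts [hpos₁, hpos₂])
  obtain ⟨K, i1, i2, i3, ι1, V, hat, b1, b2, b3, b4, b5, b6, b7, b8, b9⟩ := stepB Z a1 a2
  have hWW : ∀ i j, adjoint (hat (W i)) * hat (W j) = if i = j then 1 else 0 := by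
    intro i j
    rw [b7, ← b6, a3]
    split_ifs
    · exact b4
    · exact b5
  have hVW : ∀ i j, V i * hat (W j) = hat (W j) * V i :=
    fun i j => b9 (W j) (fun i => a4 i j) (fun i => a5 i j) i
  have hVW' : ∀ i j, adjoint (V i) * hat (W j) = hat (W j) * adjoint (V i) := by
    intro i j
    have h1 : ∀ i, Z i * adjoint (W j) = adjoint (W j) * Z i := by
      intro i
      have := congrArg adjoint (a5 i j)
      simp only [mul_def, adjoint_comp, adjoint_adjoint] at this
      exact this.symm
    have h2 : ∀ i, adjoint (Z i) * adjoint (W j) = adjoint (W j) * adjoint (Z i) := by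
      intro i
      have := congrArg adjoint (a4 i j)
      simp only [mul_def, adjoint_comp] at this
      exact this.symm
    have := congrArg adjoint (b9 (adjoint (W j)) h1 h2 i)
    simp only [mul_def, adjoint_comp, ← b7, adjoint_adjoint] at this
    exact this.symm
  have hV : ∀ i h, adjoint (V i) (ι1 (ι0 h)) = ι1 (ι0 (adjoint (![S₁, S₂] i) h)) := by
    intro i h
    rw [b3, a6]
  have hW : ∀ j h, adjoint (hat (W j)) (ι1 (ι0 h)) = ι1 (ι0 (adjoint (T j) h)) := by
    intro j h
    rw [b7, b8, a7]
  set ι : H →ₗᵢ[ℂ] K := ι1.comp ι0 with hι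
  have hinter : ∀ (X : K →L[ℂ] K) (Y : H →L[ℂ] H), (∀ h, adjoint X (ι h) = ι (adjoint Y h)) →
      adjoint ι.toContinuousLinearMap ∘L X = Y ∘L adjoint ι.toContinuousLinearMap := by
    intro X Y h
    have h1 : adjoint X ∘L ι.toContinuousLinearMap = ι.toContinuousLinearMap ∘L adjoint Y := by
      ext1 x; exact h x
    have := congrArg adjoint h1
    simpa only [adjoint_comp, adjoint_adjoint] using this
  have hiso : adjoint ι.toContinuousLinearMap ∘L ι.toContinuousLinearMap = 1 := by
    ext1 x
    refine ext_inner_right ℂ fun y => ?_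
    rw [comp_apply, adjoint_inner_left]
    exact ι.inner_map_map x y
  refine ⟨K, i1, i2, i3, ι, V 0, V 1, fun j => hat (W j), b1 0, b1 1, b2, ?_, ?_,
    fun j => ⟨hVW 0 j, hVW' 0 j⟩, fun j => ⟨hVW 1 j, hVW' 1 j⟩, hV 0, hV 1, hW, ?_⟩
  · intro j
    rw [hWW, if_pos rfl]
  · have hp2 : (∑ j, hat (W j) * adjoint (hat (W j))) * (∑ j, hat (W j) * adjoint (hat (W j))) =
        ∑ j, hat (W j) * adjoint (hat (W j)) := by
      rw [Finset.sum_mul_sum]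
      refine Finset.sum_congr rfl fun i _ => ?_
      have : ∀ j, hat (W i) * adjoint (hat (W i)) * (hat (W j) * adjoint (hat (W j))) =
          if i = j then hat (W j) * adjoint (hat (W j)) else 0 := by
        intro j
        rw [mul_assoc, ← mul_assoc (adjoint _), hWW]
        split_ifs with h
        · rw [one_mul, h]
        · rw [zero_mul, mul_zero]
      simp only [this, Finset.sum_ite_eq, Finset.mem_univ, if_true]
    have hps : star (∑ j, hat (W j) * adjoint (hat (W j))) =
        ∑ j, hat (W j) * adjoint (hat (W j)) := by
      rw [star_sum]
      refine Finset.sum_congr rfl fun i _ => ?_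
      rw [star_mul, ← star_eq_adjoint, star_star]
    generalize (∑ j, hat (W j) * adjoint (hat (W j))) = p at hp2 hps
    have h1 := star_mul_self_nonneg (1 - p)
    rw [star_sub, star_one, hps, sub_mul, mul_sub, mul_sub, hp2] at h1
    simpa using h1
  · intro n m l
    have hpow : ∀ i (n : ℕ), adjoint ι.toContinuousLinearMap ∘L (V i ^ n) =
        (![S₁, S₂] i ^ n) ∘L adjoint ι.toContinuousLinearMap := by
      intro i n
      induction n with
      | zero => rfl
      | succ n ih =>
        rw [pow_succ, pow_succ, mul_def, mul_def, ← comp_assoc, ih, comp_assoc,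
          hinter _ _ (hV i), comp_assoc]
    have hl : adjoint ι.toContinuousLinearMap ∘L ((l.map fun j => hat (W j)).prod) =
        (l.map T).prod ∘L adjoint ι.toContinuousLinearMap := by
      induction l with
      | nil => rfl
      | cons j l ih =>
        rw [List.map_cons, List.map_cons, List.prod_cons, List.prod_cons, mul_def, mul_def,
          ← comp_assoc, hinter _ _ (hW j), comp_assoc, ih, comp_assoc]
    have e0 := hpow 0 n
    have e1 := hpow 1 m
    change _ = (S₁ ^ n) ∘L _ at e0
    change _ = (S₂ ^ m) ∘L _ at e1
    rw [← comp_assoc, mul_def, mul_def, ← comp_assoc, ← comp_assoc, e0, comp_assoc (S₁ ^ n), e1,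
      comp_assoc, comp_assoc, comp_assoc, ← comp_assoc (adjoint _), hl, comp_assoc, hiso]
    rfl
end

section
/- Let S₁, S₂ be contractions on a complex Hilbert space H with S₁S₂ = S₂S₁, and let T₁, …, T_k be contractions on H (no commutation between the S's and T's is assumed). Suppose that for each i = 1, 2 the tuple (S_i, T₁, …, T_k) is a row contraction: S_iS_i* + ∑_{j=1}^k T_jT_j* ≤ I. Then there exist a Hilbert space K containing H as a closed subspace and isometries V₁, V₂, W₁, …, W_k on K such that: (1) V₁V₂ = V₂V₁; (2) for each i = 1, 2, the tuple (V_i, W₁, …, W_k) is a row isometry: V_iV_i* + ∑_{j=1}^k W_jW_j* ≤ I; (3) H is invariant under V₁*, V₂* and each W_j*, with V_i*|_H = S_i* and W_j*|_H = T_j*; in particular, the compression to H of any word in V₁, V₂, W₁, …, W_k equals the corresponding word in S₁, S₂, T₁, …, T_k. -/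
open ContinuousLinearMap

universe u

set_option linter.unusedSimpArgs false

namespace AndoFree

open scoped InnerProductSpace

/-- Square-summable sequences in `X`. -/
abbrev Sq (X : Type u) [NormedAddCommGroup X] [InnerProductSpace ℂ X] : Type u :=
  lp (fun _ : ℕ => X) 2

/-- Coordinate embedding. -/
noncomputable def sg {X : Type u} [NormedAddCommGroup X] [InnerProductSpace ℂ X] (n : ℕ) :
    X →L[ℂ] Sq X := lp.singleContinuousLinearMap ℂ (fun _ : ℕ => X) 2 n

section
variable {X Y Z : Type u} [NormedAddCommGroup X] [InnerProductSpace ℂ X]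
  [NormedAddCommGroup Y] [InnerProductSpace ℂ Y]
  [NormedAddCommGroup Z] [InnerProductSpace ℂ Z]

theorem inner_sg (n m : ℕ) (x y : X) :
    ⟪sg n x, sg m y⟫_ℂ = if n = m then ⟪x, y⟫_ℂ else 0 := by
  simp only [sg, lp.singleContinuousLinearMap_apply]
  rw [lp.inner_single_left, lp.single_apply]
  split_ifs with h
  · subst h; simp
  · simp [h]

theorem sg_ext {Y : Type*} [NormedAddCommGroup Y] [InnerProductSpace ℂ Y] {f g : Sq X →L[ℂ] Y} (h : ∀ n x, f (sg n x) = g (sg n x)) : f = g := by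
  apply lp.ext_continuousLinearMap (by simp)
  intro n
  ext x
  exact h n x

theorem sg_ext_inner (z : Z) (U : Sq X →L[ℂ] Z) (h : ∀ n x, ⟪z, U (sg n x)⟫_ℂ = 0) (f : Sq X) :
    ⟪z, U f⟫_ℂ = 0 := by
  have : (innerSL ℂ z) ∘L U = 0 := by
    apply sg_ext
    intro n x
    simpa using h n x
  simpa using congrArg (fun w => w f) this

theorem exists_fold [CompleteSpace Y] (w : ℕ → (X →L[ℂ] Y))
    (hw : ∀ n m x y, ⟪w n x, w m y⟫_ℂ = if n = m then ⟪x, y⟫_ℂ else 0) :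
    ∃ U : Sq X →L[ℂ] Y, (∀ f g, ⟪U f, U g⟫_ℂ = ⟪f, g⟫_ℂ) ∧ ∀ n x, U (sg n x) = w n x := by
  let V : ∀ n : ℕ, X →ₗᵢ[ℂ] Y := fun n => (w n).toLinearMap.isometryOfInner
    (by intro x y; simpa using hw n n x y)
  have hV : OrthogonalFamily ℂ (fun _ : ℕ => X) V := by
    intro n m hnm x y
    simpa [V, hnm] using hw n m x y
  refine ⟨hV.linearIsometry.toContinuousLinearMap, fun f g => ?_, fun n x => ?_⟩
  · simp
  · simp [sg, V]

/-- Hilbert direct sum embeddings. -/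
noncomputable def inL : X →L[ℂ] WithLp 2 (X × Y) :=
  (WithLp.prodContinuousLinearEquiv 2 ℂ X Y).symm.toContinuousLinearMap ∘L
    ContinuousLinearMap.inl ℂ X Y

noncomputable def inR : Y →L[ℂ] WithLp 2 (X × Y) :=
  (WithLp.prodContinuousLinearEquiv 2 ℂ X Y).symm.toContinuousLinearMap ∘L
    ContinuousLinearMap.inr ℂ X Y

noncomputable def join (f : X →L[ℂ] Z) (g : Y →L[ℂ] Z) : WithLp 2 (X × Y) →L[ℂ] Z :=
  (f.coprod g) ∘L (WithLp.prodContinuousLinearEquiv 2 ℂ X Y).toContinuousLinearMap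

@[simp] theorem join_inL (f : X →L[ℂ] Z) (g : Y →L[ℂ] Z) (x : X) : join f g (inL x) = f x := by
  simp [join, inL]

@[simp] theorem join_inR (f : X →L[ℂ] Z) (g : Y →L[ℂ] Z) (x : Y) : join f g (inR x) = g x := by
  simp [join, inR]

@[simp] theorem inner_inL_inL (x y : X) :
    ⟪(inL x : WithLp 2 (X × Y)), inL y⟫_ℂ = ⟪x, y⟫_ℂ := by
  simp [inL, WithLp.prod_inner_apply]

@[simp] theorem inner_inR_inR (x y : Y) :
    ⟪(inR x : WithLp 2 (X × Y)), inR y⟫_ℂ = ⟪x, y⟫_ℂ := by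
  simp [inR, WithLp.prod_inner_apply]

@[simp] theorem inner_inL_inR (x : X) (y : Y) :
    ⟪(inL x : WithLp 2 (X × Y)), inR y⟫_ℂ = 0 := by
  simp [inL, inR, WithLp.prod_inner_apply]

@[simp] theorem inner_inR_inL (x : X) (y : Y) :
    ⟪(inR y : WithLp 2 (X × Y)), inL x⟫_ℂ = 0 := by
  simp [inL, inR, WithLp.prod_inner_apply]

theorem exists_decomp (z : WithLp 2 (X × Y)) : ∃ x y, z = inL x + inR y := by
  refine ⟨z.fst, z.snd, ?_⟩
  apply (WithLp.prodContinuousLinearEquiv 2 ℂ X Y).injective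
  ext <;> simp [inL, inR]

/-- Julia unitary of a partial isometry. -/
theorem exists_julia [CompleteSpace X] (C : X →L[ℂ] X)
    (hC : ∀ x, C (adjoint C (C x)) = C x) :
    ∃ G : WithLp 2 (X × X) ≃ₗᵢ[ℂ] WithLp 2 (X × X),
      ∀ x, adjoint C (C x) = x → G (inL x) = inL (C x) := by
  have hC' : ∀ x, adjoint C (C (adjoint C x)) = adjoint C x := by
    intro x
    refine ext_inner_right ℂ fun y => ?_
    rw [adjoint_inner_left, ← adjoint_inner_right, adjoint_inner_left, hC, adjoint_inner_left]
  let g : WithLp 2 (X × X) →L[ℂ] WithLp 2 (X × X) :=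
    join (inL ∘L C + inR ∘L (1 - adjoint C ∘L C)) (inL ∘L (1 - C ∘L adjoint C) - inR ∘L adjoint C)
  let g' : WithLp 2 (X × X) →L[ℂ] WithLp 2 (X × X) :=
    join (inL ∘L adjoint C + inR ∘L (1 - C ∘L adjoint C)) (inL ∘L (1 - adjoint C ∘L C) - inR ∘L C)
  have h1 : ∀ z, g' (g z) = z := by
    intro z
    obtain ⟨x, y, rfl⟩ := exists_decomp z
    simp [g, g', hC, hC']
  have h2 : ∀ z, g (g' z) = z := by
    intro z
    obtain ⟨x, y, rfl⟩ := exists_decomp z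
    simp [g, g', hC, hC']
  have h3 : ∀ z w, ⟪g z, w⟫_ℂ = ⟪z, g' w⟫_ℂ := by
    intro z w
    obtain ⟨x, y, rfl⟩ := exists_decomp z
    obtain ⟨x', y', rfl⟩ := exists_decomp w
    have h4 : ⟪C (adjoint C y), x'⟫_ℂ = ⟪y, C (adjoint C x')⟫_ℂ := by
      rw [← adjoint_inner_right, adjoint_inner_left]
    simp [-WithLp.prod_inner_apply, h4, g, g', inner_add_left, inner_add_right, inner_sub_left, inner_sub_right,
      adjoint_inner_left, adjoint_inner_right]
    ring
  refine ⟨⟨LinearEquiv.ofLinearMap g.toLinearMap g'.toLinearMap (by ext1 z; exact h2 z)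
    (by ext1 z; exact h1 z), fun z => ?_⟩, fun x hx => ?_⟩
  · change ‖g z‖ = ‖z‖
    rw [@norm_eq_sqrt_re_inner ℂ, h3, h1, ← @norm_eq_sqrt_re_inner ℂ]
  · change g (inL x) = inL (C x)
    simp [g, hx]

/-- Partial isometry from equal Gram matrices. -/
theorem exists_partial {D : Type*} [AddCommGroup D] [Module ℂ D] [CompleteSpace X] (A B : D →ₗ[ℂ] X) (h : ∀ x, ‖A x‖ = ‖B x‖) :
    ∃ C : X →L[ℂ] X, (∀ x, C (adjoint C (C x)) = C x) ∧ (∀ x, C (A x) = B x) ∧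
      ∀ x, adjoint C (C (A x)) = A x := by
  let M : Submodule ℂ X := (LinearMap.range A).topologicalClosure
  have hM : ∀ x, A x ∈ M := fun x =>
    Submodule.le_topologicalClosure _ (LinearMap.mem_range_self A x)
  have : CompleteSpace M := (Submodule.isClosed_topologicalClosure _).completeSpace_coe
  let e : D →ₗ[ℂ] M := A.codRestrict M hM
  have hd : DenseRange e := by
    intro y
    have hy := y.2
    rw [Metric.mem_closure_iff]
    intro ε hε
    have : (y : X) ∈ closure (LinearMap.range A : Set X) := hy
    rw [Metric.mem_closure_iff] at this
    obtain ⟨_, ⟨x, rfl⟩, hx⟩ := this ε hε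
    exact ⟨e x, ⟨x, rfl⟩, hx⟩
  have hn : ∀ x, ‖B x‖ ≤ 1 * ‖e x‖ := by
    intro x
    rw [one_mul]
    exact (h x).ge
  let C1 : M →L[ℂ] X := B.extendOfNorm e
  have hC1 : ∀ x, C1 (e x) = B x := fun x => LinearMap.extendOfNorm_eq hd ⟨1, hn⟩ x
  have hiso : ∀ y, ‖C1 y‖ = ‖y‖ := by
    intro y
    refine hd.induction_on (p := fun y => ‖C1 y‖ = ‖y‖) y ?_ ?_
    · exact isClosed_eq (by fun_prop) (by fun_prop)
    · intro x
      rw [hC1]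
      exact (h x).symm
  have hadj : ∀ y, adjoint C1 (C1 y) = y := by
    have := (ContinuousLinearMap.norm_map_iff_adjoint_comp_self C1).1 hiso
    intro y
    exact congrArg (fun w => w y) this
  have hP : ∀ x, adjoint (C1 ∘L M.orthogonalProjectionOnto) (C1 x) = x := by
    intro x
    rw [adjoint_comp]
    simp [hadj, Submodule.adjoint_orthogonalProjectionOnto]
  have hA : ∀ x, M.orthogonalProjectionOnto (A x) = e x := by
    intro x
    exact Submodule.orthogonalProjectionOnto_mem_subspace_eq_self (e x)
  refine ⟨C1 ∘L M.orthogonalProjectionOnto, fun x => ?_, fun x => ?_, fun x => ?_⟩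
  · rw [ContinuousLinearMap.comp_apply C1 _ x, hP, ContinuousLinearMap.comp_apply,
      Submodule.orthogonalProjectionOnto_mem_subspace_eq_self]
  · simp [hA, hC1]
  · rw [ContinuousLinearMap.comp_apply, hP, hA]; rfl

theorem exists_sqrt [CompleteSpace X] (P : X →L[ℂ] X) (hP : 0 ≤ P) :
    ∃ D : X →L[ℂ] X, D * D = P ∧ adjoint D = D :=
  ⟨CFC.sqrt P, CFC.sqrt_mul_sqrt_self P hP, (CFC.sqrt_nonneg P).isSelfAdjoint⟩

theorem exists_defect [CompleteSpace X] {k : ℕ} (R : Fin k → (X →L[ℂ] X))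
    (hR : ∑ a, R a * adjoint (R a) ≤ 1) :
    ∃ y : Fin k → (X →L[ℂ] Sq X), ∀ a b u v,
      ⟪y a u, y b v⟫_ℂ = (if a = b then ⟪u, v⟫_ℂ else 0) - ⟪R a u, R b v⟫_ℂ := by
  let Q : Sq X →L[ℂ] X := ∑ a : Fin k, R a ∘L adjoint (sg (X := X) a)
  have hsg : ∀ (a b : ℕ) (x : X), adjoint (sg (X := X) a) (sg b x) = if a = b then x else 0 := by
    intro a b x
    refine ext_inner_left ℂ fun y => ?_
    rw [adjoint_inner_right, inner_sg]
    split_ifs <;> simp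
  have hQ : ∀ a x, Q (sg (a : Fin k) x) = R a x := by
    intro a x
    simp only [Q, sum_apply, ContinuousLinearMap.comp_apply, hsg]
    rw [Finset.sum_eq_single a]
    · simp
    · intro b _ hb
      simp [Fin.val_inj, hb]
    · simp
  have hQa : ∀ x, adjoint Q x = ∑ a : Fin k, sg (a : ℕ) (adjoint (R a) x) := by
    intro x
    refine ext_inner_left ℂ fun y => ?_
    rw [adjoint_inner_right]
    simp [Q, inner_sum, sum_inner, ← adjoint_inner_right, adjoint_inner_left]
  have hle : ∀ x, ‖adjoint Q x‖ ≤ 1 * ‖x‖ := by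
    intro x
    rw [one_mul]
    have h1 := ((ContinuousLinearMap.le_def _ _).1 hR).re_inner_nonneg_right x
    have h2 : Q (adjoint Q x) = (∑ a, R a * adjoint (R a)) x := by
      rw [hQa]; simp [hQ]
    have h3 : RCLike.re ⟪x, (∑ a, R a * adjoint (R a)) x⟫_ℂ = ‖adjoint Q x‖ ^ 2 := by
      rw [← h2, ← adjoint_inner_left, inner_self_eq_norm_sq]
    rw [sub_apply, inner_sub_right, map_sub, h3] at h1
    have h4 : RCLike.re ⟪x, (1 : X →L[ℂ] X) x⟫_ℂ = ‖x‖ ^ 2 := by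
      simp [inner_self_eq_norm_sq_to_K, ← Complex.ofReal_pow]
    rw [h4] at h1
    exact le_of_sq_le_sq (by linarith) (norm_nonneg _)
  have hQn : ‖Q‖ ≤ 1 := by
    have := ContinuousLinearMap.opNorm_le_bound _ zero_le_one hle
    rwa [LinearIsometryEquiv.norm_map] at this
  let P : Sq X →L[ℂ] Sq X := 1 - adjoint Q ∘L Q
  have hP : 0 ≤ P := by
    rw [ContinuousLinearMap.nonneg_iff_isPositive, ContinuousLinearMap.isPositive_iff_complex]
    intro x
    have : ⟪P x, x⟫_ℂ = ((‖x‖ ^ 2 - ‖Q x‖ ^ 2 : ℝ) : ℂ) := by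
      simp [P, inner_sub_left, adjoint_inner_left, inner_self_eq_norm_sq_to_K]
    rw [this]
    have h5 : ‖Q x‖ ≤ ‖x‖ := by simpa using Q.le_of_opNorm_le hQn x
    refine ⟨by rw [RCLike.re_to_complex, Complex.ofReal_re], ?_⟩
    have := pow_le_pow_left₀ (norm_nonneg _) h5 2
    simp only [RCLike.re_to_complex, Complex.ofReal_re]
    linarith
  obtain ⟨D, hD, hDs⟩ := exists_sqrt P hP
  refine ⟨fun a => D ∘L sg a, fun a b x z => ?_⟩
  have h6 : D (D (sg b z)) = P (sg b z) := congrArg (fun w => w (sg b z)) hD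
  rw [ContinuousLinearMap.comp_apply, ContinuousLinearMap.comp_apply, ← adjoint_inner_right, hDs, h6]
  simp [P, inner_sub_right, adjoint_inner_right, hQ, inner_sg, Fin.val_inj]


theorem exists_cuntz [CompleteSpace X] : ∃ c : ℕ → (Sq X →L[ℂ] Sq X),
    ∀ n m x y, ⟪c n x, c m y⟫_ℂ = if n = m then ⟪x, y⟫_ℂ else 0 := by
  have h : ∀ n : ℕ, ∃ U : Sq X →L[ℂ] Sq X, (∀ f g, ⟪U f, U g⟫_ℂ = ⟪f, g⟫_ℂ) ∧
      ∀ m x, U (sg m x) = sg (Nat.pair n m) x := by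
    intro n
    refine exists_fold (X := X) (Y := Sq X) (fun m => sg (X := X) (Nat.pair n m)) ?_
    intro m m' x y
    simp [inner_sg, Nat.pair_eq_pair]
  choose c hc hc' using h
  refine ⟨c, fun n m x y => ?_⟩
  split_ifs with hnm
  · subst hnm; exact hc n x y
  · refine sg_ext_inner _ _ (fun i z => ?_) y
    rw [← inner_conj_symm, map_eq_zero]
    refine sg_ext_inner _ _ (fun i' z' => ?_) x
    rw [hc', hc', inner_sg, if_neg]
    simp only [Nat.pair_eq_pair, not_and]
    exact fun h => absurd h.symm hnm

theorem exists_defect_row [CompleteSpace X] {k : ℕ} (S : X →L[ℂ] X) (T : Fin k → (X →L[ℂ] X))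
    (hR : S * adjoint S + ∑ a, T a * adjoint (T a) ≤ 1) :
    ∃ (v : X →L[ℂ] Sq X) (w : Fin k → (X →L[ℂ] Sq X)),
      (∀ x y, ⟪v x, v y⟫_ℂ = ⟪x, y⟫_ℂ - ⟪S x, S y⟫_ℂ) ∧
      (∀ j x y, ⟪v x, w j y⟫_ℂ = - ⟪S x, T j y⟫_ℂ) ∧
      (∀ i j x y, ⟪w i x, w j y⟫_ℂ = (if i = j then ⟪x, y⟫_ℂ else 0) - ⟪T i x, T j y⟫_ℂ) := by
  obtain ⟨y, hy⟩ := exists_defect (k := k + 1) (Fin.cons S T) (by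
    rw [Fin.sum_univ_succ]; simpa using hR)
  refine ⟨y 0, fun j => y j.succ, fun x z => ?_, fun j x z => ?_, fun i j x z => ?_⟩
  · simpa using hy 0 0 x z
  · have := hy 0 j.succ x z
    rw [if_neg (Fin.succ_ne_zero j).symm] at this
    simpa using this
  · simpa using hy i.succ j.succ x z

theorem defect_sum {k : ℕ} (S : X →L[ℂ] X) (T : Fin k → (X →L[ℂ] X))
    (v : X →L[ℂ] Y) (w : Fin k → (X →L[ℂ] Y))
    (h1 : ∀ x y, ⟪v x, v y⟫_ℂ = ⟪x, y⟫_ℂ - ⟪S x, S y⟫_ℂ)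
    (h2 : ∀ j x y, ⟪v x, w j y⟫_ℂ = - ⟪S x, T j y⟫_ℂ)
    (h3 : ∀ i j x y, ⟪w i x, w j y⟫_ℂ = (if i = j then ⟪x, y⟫_ℂ else 0) - ⟪T i x, T j y⟫_ℂ)
    (u : X) (x : Fin k → X) :
    ⟪v u + ∑ j, w j (x j), v u + ∑ j, w j (x j)⟫_ℂ =
      ⟪u, u⟫_ℂ + ∑ j, ⟪x j, x j⟫_ℂ - ⟪S u + ∑ j, T j (x j), S u + ∑ j, T j (x j)⟫_ℂ := by
  have h2' : ∀ j x y, ⟪w j x, v y⟫_ℂ = - ⟪T j x, S y⟫_ℂ := by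
    intro j x y
    rw [← inner_conj_symm, h2, map_neg, inner_conj_symm]
  simp only [inner_add_left, inner_add_right, sum_inner, inner_sum, h1, h2, h2', h3,
    Finset.sum_sub_distrib, Finset.sum_neg_distrib, Finset.sum_ite_eq, Finset.mem_univ, if_true]
  simp [Finset.sum_add_distrib, Finset.sum_sub_distrib]
  ring

theorem exists_proj [CompleteSpace X] [CompleteSpace Y] (x y : X →L[ℂ] Y)
    (hx : ∀ u v, ⟪x u, x v⟫_ℂ = ⟪u, v⟫_ℂ) (hy : ∀ u v, ⟪y u, y v⟫_ℂ = ⟪u, v⟫_ℂ)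
    (hxy : ∀ u v, ⟪x u, y v⟫_ℂ = 0) :
    ∃ p : Y →L[ℂ] Y, (∀ z, p (p z) = p z) ∧ (∀ z w, ⟪p z, w⟫_ℂ = ⟪z, p w⟫_ℂ) ∧
      (∀ u, p (x u) = x u) ∧ (∀ u, p (y u) = y u) ∧
      ∀ z, (∀ u, ⟪x u, z⟫_ℂ = 0) → (∀ u, ⟪y u, z⟫_ℂ = 0) → p z = 0 := by
  have hx' : ∀ u, adjoint x (x u) = u := fun u => ext_inner_left ℂ fun v => by
    rw [adjoint_inner_right, hx]
  have hy' : ∀ u, adjoint y (y u) = u := fun u => ext_inner_left ℂ fun v => by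
    rw [adjoint_inner_right, hy]
  have hxy' : ∀ u, adjoint x (y u) = 0 := fun u => ext_inner_left ℂ fun v => by
    rw [adjoint_inner_right, hxy, inner_zero_right]
  have hyx' : ∀ u, adjoint y (x u) = 0 := fun u => ext_inner_left ℂ fun v => by
    rw [adjoint_inner_right, ← inner_conj_symm, hxy, inner_zero_right, map_zero]
  refine ⟨x ∘L adjoint x + y ∘L adjoint y, ?_, ?_, ?_, ?_, ?_⟩
  · intro z; simp [hx', hy', hxy', hyx']
  · intro z w
    simp [inner_add_left, inner_add_right, ← adjoint_inner_right x, ← adjoint_inner_right y,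
      ← adjoint_inner_left x, ← adjoint_inner_left y]
  · intro z; simp [hx', hy', hxy', hyx']
  · intro z; simp [hx', hy', hxy', hyx']
  · intro z h1 h2
    have e1 : adjoint x z = 0 := ext_inner_left ℂ fun v => by
      rw [adjoint_inner_right, h1, inner_zero_right]
    have e2 : adjoint y z = 0 := ext_inner_left ℂ fun v => by
      rw [adjoint_inner_right, h2, inner_zero_right]
    simp [e1, e2]

theorem exists_shift [CompleteSpace X] (r t : X →L[ℂ] X) (h0 : ∀ x y, ⟪r x, t y⟫_ℂ = 0)
    (h1 : ∀ x y, ⟪r x, r y⟫_ℂ + ⟪t x, t y⟫_ℂ = ⟪x, y⟫_ℂ) :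
    ∃ U : Sq X →L[ℂ] Sq X, (∀ f g, ⟪U f, U g⟫_ℂ = ⟪f, g⟫_ℂ) ∧
      ∀ n x, U (sg n x) = sg n (r x) + sg (n + 1) (t x) := by
  have h0' : ∀ x y, ⟪t x, r y⟫_ℂ = 0 := by
    intro x y; rw [← inner_conj_symm, h0, map_zero]
  refine exists_fold (fun n => sg n ∘L r + sg (n + 1) ∘L t) ?_
  intro n m x y
  simp only [add_apply, ContinuousLinearMap.comp_apply, inner_add_left, inner_add_right,
    inner_sg, h0, h0', ite_self, add_left_inj]
  split_ifs <;> simp [h1]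

theorem row_le_one [CompleteSpace X] {n : ℕ} (U : Fin n → (X →L[ℂ] X))
    (h : ∀ a b x y, ⟪U a x, U b y⟫_ℂ = if a = b then ⟪x, y⟫_ℂ else 0) :
    ∑ a, U a * adjoint (U a) ≤ 1 := by
  apply IsStarProjection.le_one
  have h' : ∀ a b y, adjoint (U a) (U b y) = if a = b then y else 0 := by
    intro a b y
    refine ext_inner_left ℂ fun z => ?_
    rw [adjoint_inner_right, h]
    split_ifs <;> simp
  constructor
  · ext x
    simp [h', sum_apply, map_sum]
    refine Finset.sum_congr rfl fun a _ => ?_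
    rw [Finset.sum_eq_single a]
    · simp
    · intro b _ hb
      simp [hb]
    · simp
  · rw [IsSelfAdjoint, star_sum]
    refine Finset.sum_congr rfl fun a _ => ?_
    rw [star_mul, star_eq_adjoint, star_eq_adjoint, adjoint_adjoint]

theorem row_le_one' [CompleteSpace X] {k : ℕ} (V : X →L[ℂ] X) (W : Fin k → (X →L[ℂ] X))
    (h1 : ∀ x y, ⟪V x, V y⟫_ℂ = ⟪x, y⟫_ℂ) (h2 : ∀ j x y, ⟪V x, W j y⟫_ℂ = 0)
    (h3 : ∀ a b x y, ⟪W a x, W b y⟫_ℂ = if a = b then ⟪x, y⟫_ℂ else 0) :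
    V * adjoint V + ∑ a, W a * adjoint (W a) ≤ 1 := by
  have := row_le_one (Fin.cons V W : Fin (k + 1) → (X →L[ℂ] X)) (by
    intro a b x y
    refine Fin.cases ?_ (fun i => ?_) a <;> refine Fin.cases ?_ (fun j => ?_) b
    · simpa using h1 x y
    · rw [if_neg (Fin.succ_ne_zero j).symm]; simpa using h2 j x y
    · rw [if_neg (Fin.succ_ne_zero i), ← inner_conj_symm, map_eq_zero]; exact h2 i y x
    · simpa using h3 i j x y)
  rw [Fin.sum_univ_succ] at this
  simpa using this

theorem adjoint_mul_self [CompleteSpace X] (V : X →L[ℂ] X)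
    (h1 : ∀ x y, ⟪V x, V y⟫_ℂ = ⟪x, y⟫_ℂ) : adjoint V * V = 1 := by
  ext x
  refine ext_inner_left ℂ fun y => ?_
  change ⟪y, adjoint V (V x)⟫_ℂ = ⟪y, x⟫_ℂ
  rw [adjoint_inner_right, h1]


theorem exists_gadget [CompleteSpace X] {k : ℕ} (S₁ S₂ : X →L[ℂ] X) (hc : S₁ * S₂ = S₂ * S₁)
    (T : Fin k → (X →L[ℂ] X))
    (hrow₁ : S₁ * adjoint S₁ + ∑ j, T j * adjoint (T j) ≤ 1)
    (hrow₂ : S₂ * adjoint S₂ + ∑ j, T j * adjoint (T j) ≤ 1) :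
    ∃ (E : Type u) (_ : NormedAddCommGroup E) (_ : InnerProductSpace ℂ E) (_ : CompleteSpace E)
      (p : E →L[ℂ] E) (G : E ≃ₗᵢ[ℂ] E) (v₁ v₂ : X →L[ℂ] E) (x₁ x₂ : Fin k → (X →L[ℂ] E))
      (w : Fin k → (Sq E →L[ℂ] E)),
      (∀ z, p (p z) = p z) ∧ (∀ z z', ⟪p z, z'⟫_ℂ = ⟪z, p z'⟫_ℂ) ∧
      (∀ h, p (v₁ h) = v₁ h) ∧ (∀ h, p (v₂ h) = 0) ∧
      (∀ j h, p (x₁ j h) = x₁ j h) ∧ (∀ j h, p (x₂ j h) = 0) ∧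
      (∀ h, G (v₁ (S₂ h)) + G (v₂ h) = v₁ h + v₂ (S₁ h)) ∧
      (∀ j h, G (x₁ j h) = x₂ j h) ∧
      (∀ h h', ⟪v₁ h, v₁ h'⟫_ℂ = ⟪h, h'⟫_ℂ - ⟪S₁ h, S₁ h'⟫_ℂ) ∧
      (∀ h h', ⟪v₂ h, v₂ h'⟫_ℂ = ⟪h, h'⟫_ℂ - ⟪S₂ h, S₂ h'⟫_ℂ) ∧
      (∀ j h h', ⟪v₁ h, x₁ j h'⟫_ℂ = - ⟪S₁ h, T j h'⟫_ℂ) ∧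
      (∀ j h h', ⟪v₂ h, x₂ j h'⟫_ℂ = - ⟪S₂ h, T j h'⟫_ℂ) ∧
      (∀ i j h h', ⟪x₂ i h, x₂ j h'⟫_ℂ =
        (if i = j then ⟪h, h'⟫_ℂ else 0) - ⟪T i h, T j h'⟫_ℂ) ∧
      (∀ i j f g, ⟪w i f, w j g⟫_ℂ = if i = j then ⟪f, g⟫_ℂ else 0) ∧
      (∀ j h f, ⟪v₂ h, w j f⟫_ℂ = 0) ∧
      (∀ i j h f, ⟪x₂ i h, w j f⟫_ℂ = 0) ∧
      (∀ j f, p (w j f) = 0) ∧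
      (∀ j f, p (G.symm (w j f)) = G.symm (w j f)) ∧
      (∀ j h f, ⟪G (v₁ h), w j f⟫_ℂ = 0) := by
  obtain ⟨c, hcz⟩ := exists_cuntz (X := X)
  obtain ⟨y, x, hy, hyx, hx⟩ := exists_defect_row S₁ T hrow₁
  obtain ⟨y', x', hy', hyx', hx'⟩ := exists_defect_row S₂ T hrow₂
  have hcc : ∀ h, S₁ (S₂ h) = S₂ (S₁ h) := fun h => congrArg (fun w => w h) hc
  let A : X × (Fin k → X) × Sq X →ₗ[ℂ] Sq X :=
    (c 0).toLinearMap ∘ₗ ((y.toLinearMap ∘ₗ S₂.toLinearMap ∘ₗ LinearMap.fst ℂ _ _)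
      + ∑ j, (x j).toLinearMap ∘ₗ LinearMap.proj j ∘ₗ LinearMap.fst ℂ _ _ ∘ₗ LinearMap.snd ℂ _ _)
    + (c 1).toLinearMap ∘ₗ y'.toLinearMap ∘ₗ LinearMap.fst ℂ _ _
    + (c 2).toLinearMap ∘ₗ LinearMap.snd ℂ _ _ ∘ₗ LinearMap.snd ℂ _ _
  let B : X × (Fin k → X) × Sq X →ₗ[ℂ] Sq X :=
    (c 1).toLinearMap ∘ₗ ((y'.toLinearMap ∘ₗ S₁.toLinearMap ∘ₗ LinearMap.fst ℂ _ _)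
      + ∑ j, (x' j).toLinearMap ∘ₗ LinearMap.proj j ∘ₗ LinearMap.fst ℂ _ _ ∘ₗ LinearMap.snd ℂ _ _)
    + (c 0).toLinearMap ∘ₗ y.toLinearMap ∘ₗ LinearMap.fst ℂ _ _
    + (c 3).toLinearMap ∘ₗ LinearMap.snd ℂ _ _ ∘ₗ LinearMap.snd ℂ _ _
  have hA : ∀ h t b, A (h, t, b) = c 0 (y (S₂ h) + ∑ j, x j (t j)) + c 1 (y' h) + c 2 b := by
    intro h t b; simp [A, LinearMap.sum_apply]
  have hB : ∀ h t b, B (h, t, b) = c 1 (y' (S₁ h) + ∑ j, x' j (t j)) + c 0 (y h) + c 3 b := by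
    intro h t b; simp [B, LinearMap.sum_apply]
  have hAB : ∀ d, ‖A d‖ = ‖B d‖ := by
    rintro ⟨h, t, b⟩
    have key : ⟪A (h, t, b), A (h, t, b)⟫_ℂ = ⟪B (h, t, b), B (h, t, b)⟫_ℂ := by
      have e1 := defect_sum S₁ T y x hy hyx hx (S₂ h) t
      have e2 := defect_sum S₂ T y' x' hy' hyx' hx' (S₁ h) t
      rw [hA, hB]
      generalize y (S₂ h) + ∑ j, x j (t j) = r at *
      generalize y' (S₁ h) + ∑ j, x' j (t j) = r' at *
      simp only [inner_add_left, inner_add_right, hcz]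
      norm_num only [if_true, if_false]
      rw [e1, e2, hy, hy', hcc]
      ring
    rw [@norm_eq_sqrt_re_inner ℂ, key, ← @norm_eq_sqrt_re_inner ℂ]
  obtain ⟨C, hC1, hC2, hC3⟩ := exists_partial A B hAB
  obtain ⟨G, hG⟩ := exists_julia C hC1
  have hGA : ∀ d, G (inL (A d)) = inL (B d) := by
    intro d; rw [hG _ (hC3 d), hC2]
  have hG1 : ∀ h, G (inL (c 0 (y (S₂ h)))) + G (inL (c 1 (y' h))) =
      inL (c 0 (y h)) + inL (c 1 (y' (S₁ h))) := by
    intro h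
    have := hGA (h, 0, 0)
    rw [hA, hB] at this
    simp only [Pi.zero_apply, map_zero, Finset.sum_const_zero, add_zero, map_add] at this
    rw [this, add_comm]
  have hG2 : ∀ j h, G (inL (c 0 (x j h))) = inL (c 1 (x' j h)) := by
    intro j h
    have := hGA (0, Pi.single j h, 0)
    rw [hA, hB, Finset.sum_eq_single j, Finset.sum_eq_single j] at this
    · simpa using this
    · intro i _ hi; simp [hi]
    · simp
    · intro i _ hi; simp [hi]
    · simp
  have hG3 : ∀ b, G (inL (c 2 b)) = inL (c 3 b) := by
    intro b
    have := hGA (0, 0, b)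
    rw [hA, hB] at this
    simpa using this
  have hE : ∀ z z' : WithLp 2 (Sq X × Sq X), ⟪join (c 0) (c 1) z, join (c 0) (c 1) z'⟫_ℂ
      = ⟪z, z'⟫_ℂ := by
    intro z z'
    obtain ⟨r, s, rfl⟩ := exists_decomp z
    obtain ⟨r', s', rfl⟩ := exists_decomp z'
    simp [-WithLp.prod_inner_apply, inner_add_left, inner_add_right, hcz]
  obtain ⟨U, hU, -⟩ := exists_fold (fun n => c n ∘L join (c 0) (c 1)) (by
    intro n m z z'
    simp only [ContinuousLinearMap.comp_apply, hcz, hE])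
  obtain ⟨p, hp1, hp2, hp3, hp4, hp5⟩ := exists_proj (X := Sq X) (Y := WithLp 2 (Sq X × Sq X))
    (inL ∘L c 0) (inL ∘L c 2)
    (by intro a b; simp only [ContinuousLinearMap.comp_apply, inner_inL_inL, hcz]; simp)
    (by intro a b; simp only [ContinuousLinearMap.comp_apply, inner_inL_inL, hcz]; simp)
    (by intro a b; simp only [ContinuousLinearMap.comp_apply, inner_inL_inL, hcz]; simp)
  simp only [ContinuousLinearMap.comp_apply] at hp3 hp4 hp5
  have hp1' : ∀ b, p (inL (c 1 b)) = 0 := by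
    intro b
    apply hp5 <;> intro u <;> rw [inner_inL_inL, hcz] <;> simp
  have hp3' : ∀ b, p (inL (c 3 b)) = 0 := by
    intro b
    apply hp5 <;> intro u <;> rw [inner_inL_inL, hcz] <;> simp
  have hGs : ∀ b, G.symm (inL (c 3 b)) = inL (c 2 b) := by
    intro b; rw [← hG3, LinearIsometryEquiv.symm_apply_apply]
  refine ⟨WithLp 2 (Sq X × Sq X), inferInstance, inferInstance, inferInstance, p, G,
    inL ∘L c 0 ∘L y, inL ∘L c 1 ∘L y', fun j => inL ∘L c 0 ∘L x j, fun j => inL ∘L c 1 ∘L x' j,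
    fun j => inL ∘L c 3 ∘L c j ∘L U, hp1, hp2, ?_⟩
  simp only [ContinuousLinearMap.comp_apply, inner_inL_inL, hcz, hp3, hp1', hp3', hG1, hG2, hGs, hp4,
    hy, hy', hyx, hyx', hx', hU, if_true, implies_true, true_and, Fin.val_inj]
  refine ⟨by simp, by simp, ?_⟩
  intro j h f
  rw [← hG3, LinearIsometryEquiv.inner_map_map, inner_inL_inL, hcz]
  simp


/-- A row isometry on `X ⊕ ℓ²(E)` given by lower triangular blocks: inner product computation. -/
theorem inner_join (f f' : X →L[ℂ] X) (g g' : X →L[ℂ] Y) (m m' : Y →L[ℂ] Y)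
    (δ : ℂ) (h1 : ∀ u v, ⟪f u, f' v⟫_ℂ + ⟪g u, g' v⟫_ℂ = δ * ⟪u, v⟫_ℂ)
    (h2 : ∀ u v, ⟪g u, m' v⟫_ℂ = 0) (h3 : ∀ u v, ⟪g' u, m v⟫_ℂ = 0)
    (h4 : ∀ u v, ⟪m u, m' v⟫_ℂ = δ * ⟪u, v⟫_ℂ) (z z' : WithLp 2 (X × Y)) :
    ⟪join (inL ∘L f + inR ∘L g) (inR ∘L m) z, join (inL ∘L f' + inR ∘L g') (inR ∘L m') z'⟫_ℂ
      = δ * ⟪z, z'⟫_ℂ := by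
  have h3' : ∀ u v, ⟪m u, g' v⟫_ℂ = 0 := by
    intro u v; rw [← inner_conj_symm, h3, map_zero]
  obtain ⟨r, s, rfl⟩ := exists_decomp z
  obtain ⟨r', s', rfl⟩ := exists_decomp z'
  simp only [map_add, join_inL, join_inR, add_apply, ContinuousLinearMap.comp_apply,
    inner_add_left, inner_add_right, inner_inL_inL, inner_inL_inR, inner_inR_inL, inner_inR_inR,
    h2, h3', h4, add_zero, zero_add]
  rw [h1]
  ring

theorem adjoint_join [CompleteSpace X] [CompleteSpace Y] (f : X →L[ℂ] X) (g : X →L[ℂ] Y)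
    (m : Y →L[ℂ] Y) (h : X) :
    adjoint (join (inL ∘L f + inR ∘L g) (inR ∘L m)) (inL h) = inL (adjoint f h) := by
  refine ext_inner_right ℂ fun z => ?_
  obtain ⟨r, s, rfl⟩ := exists_decomp z
  rw [adjoint_inner_left]
  simp only [map_add, join_inL, join_inR, add_apply, ContinuousLinearMap.comp_apply,
    inner_add_left, inner_add_right, inner_inL_inL, inner_inL_inR, inner_inR_inL, inner_inR_inR,
    add_zero, adjoint_inner_left]

theorem word_compression [CompleteSpace X] [CompleteSpace Y] {I : Type*} (ι : X →ₗᵢ[ℂ] Y)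
    (V : I → (Y →L[ℂ] Y)) (S : I → (X →L[ℂ] X))
    (h : ∀ i x, adjoint (V i) (ι x) = ι (adjoint (S i) x)) (l : List I) :
    adjoint ι.toContinuousLinearMap ∘L ((l.map V).prod ∘L ι.toContinuousLinearMap) =
      (l.map S).prod := by
  have h1 : ∀ i y, adjoint ι.toContinuousLinearMap (V i y) =
      S i (adjoint ι.toContinuousLinearMap y) := by
    intro i y
    refine ext_inner_left ℂ fun x => ?_
    rw [adjoint_inner_right, ← adjoint_inner_left]
    change ⟪adjoint (V i) (ι x), y⟫_ℂ = _
    rw [h, ← adjoint_inner_left (S i), adjoint_inner_right]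
    rfl
  have h2 : ∀ y, adjoint ι.toContinuousLinearMap ((l.map V).prod y) =
      (l.map S).prod (adjoint ι.toContinuousLinearMap y) := by
    induction l with
    | nil => intro y; rfl
    | cons i l ih =>
      intro y
      simp only [List.map_cons, List.prod_cons]
      change adjoint ι.toContinuousLinearMap (V i ((l.map V).prod y)) = S i ((l.map S).prod _)
      rw [h1, ih]
  ext x
  rw [ContinuousLinearMap.comp_apply, ContinuousLinearMap.comp_apply, h2]
  congr 1
  refine ext_inner_left ℂ fun y => ?_
  rw [adjoint_inner_right]
  exact ι.inner_map_map y x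

end
end AndoFree

/-- Ando-type dilation on `ℕ² ∗ 𝔽_k⁺`: if `S₁, S₂` are commuting contractions and
`T₁, …, T_k` are contractions (with no commutation assumed between the `S`'s and `T`'s)
such that `(Sᵢ, T₁, …, T_k)` is a row contraction for `i = 1, 2`, then there exist isometries
`V₁, V₂, W₁, …, W_k` on some `K ⊇ H` with `V₁V₂ = V₂V₁`, each `(Vᵢ, W₁, …, W_k)` a row
isometry, `H` invariant under all adjoints (restricting to the original adjoints), and in
particular the compression to `H` of any word in `V₁, V₂, W₁, …, W_k` equals the
corresponding word in `S₁, S₂, T₁, …, T_k`. -/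
theorem ando_type_dilation_free_row {H : Type u} [NormedAddCommGroup H]
    [InnerProductSpace ℂ H] [CompleteSpace H] {k : ℕ}
    (S₁ S₂ : H →L[ℂ] H) (hS₁ : ‖S₁‖ ≤ 1) (hS₂ : ‖S₂‖ ≤ 1) (hScomm : S₁ * S₂ = S₂ * S₁)
    (T : Fin k → (H →L[ℂ] H)) (hTcontr : ∀ j, ‖T j‖ ≤ 1)
    (hrow₁ : S₁ * adjoint S₁ + ∑ j, T j * adjoint (T j) ≤ 1)
    (hrow₂ : S₂ * adjoint S₂ + ∑ j, T j * adjoint (T j) ≤ 1) :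
    ∃ (K : Type u) (_ : NormedAddCommGroup K) (_ : InnerProductSpace ℂ K) (_ : CompleteSpace K)
      (ι : H →ₗᵢ[ℂ] K) (V₁ V₂ : K →L[ℂ] K) (W : Fin k → (K →L[ℂ] K)),
      -- all are isometries
      adjoint V₁ * V₁ = 1 ∧ adjoint V₂ * V₂ = 1 ∧ (∀ j, adjoint (W j) * W j = 1) ∧
      -- (1) V₁ and V₂ commute
      V₁ * V₂ = V₂ * V₁ ∧
      -- (2) each (Vᵢ, W₁, …, W_k) is a row isometry
      (V₁ * adjoint V₁ + ∑ j, W j * adjoint (W j) ≤ 1) ∧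
      (V₂ * adjoint V₂ + ∑ j, W j * adjoint (W j) ≤ 1) ∧
      -- (3) H is invariant under all the adjoints, restricting to the original adjoints
      (∀ h : H, adjoint V₁ (ι h) = ι (adjoint S₁ h)) ∧
      (∀ h : H, adjoint V₂ (ι h) = ι (adjoint S₂ h)) ∧
      (∀ (j : Fin k) (h : H), adjoint (W j) (ι h) = ι (adjoint (T j) h)) ∧
      -- in particular, compressions of arbitrary words equal the corresponding words
      (∀ l : List (Fin 2 ⊕ Fin k),
        adjoint ι.toContinuousLinearMap ∘L
            ((l.map (Sum.elim ![V₁, V₂] W)).prod ∘L ι.toContinuousLinearMap) =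
          (l.map (Sum.elim ![S₁, S₂] T)).prod) := by
  classical
  obtain ⟨E, _, _, _, p, G, v₁, v₂, x₁, x₂, w, hp1, hp2, hpv1, hpv2, hpx1, hpx2, hG1, hG2,
    hv1, hv2, hvx1, hvx2, hx2, hw, hv2w, hx2w, hpw, hpGw, hGw⟩ :=
    AndoFree.exists_gadget S₁ S₂ hScomm T hrow₁ hrow₂
  have hcc : ∀ h, S₁ (S₂ h) = S₂ (S₁ h) := fun h => congrArg (fun w => w h) hScomm
  let Gc : E →L[ℂ] E := G.toContinuousLinearEquiv.toContinuousLinearMap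
  let Gs : E →L[ℂ] E := G.symm.toContinuousLinearEquiv.toContinuousLinearMap
  have hGc : ∀ z, Gc z = G z := fun _ => rfl
  have hGs : ∀ z, Gs z = G.symm z := fun _ => rfl
  have hpq : ∀ z z', inner ℂ (p z) (p z') = inner ℂ z (p z') := by
    intro z z'; rw [hp2, hp1]
  have hpq' : ∀ z z', inner ℂ (p z) z' = inner ℂ z (p z') := hp2
  have hone : ∀ z : E, (1 : E →L[ℂ] E) z = z := fun _ => rfl
  obtain ⟨M₁, hM1, hM1s⟩ := AndoFree.exists_shift (Gc ∘L (1 - p)) (Gc ∘L p)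
    (by
      intro z z'
      simp only [ContinuousLinearMap.comp_apply, hGc, LinearIsometryEquiv.inner_map_map, sub_apply,
        hone, inner_sub_left, hpq, sub_self])
    (by
      intro z z'
      simp only [ContinuousLinearMap.comp_apply, hGc, LinearIsometryEquiv.inner_map_map, sub_apply,
        hone, inner_sub_left, inner_sub_right, hpq, hpq', hp1]
      ring)
  obtain ⟨M₂, hM2, hM2s⟩ := AndoFree.exists_shift (p ∘L Gs) ((1 - p) ∘L Gs)
    (by
      intro z z'
      simp only [ContinuousLinearMap.comp_apply, hGs, sub_apply,
        hone, inner_sub_right, hpq, hpq', map_sub, hp1, sub_self, inner_zero_right])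
    (by
      intro z z'
      rw [← LinearIsometryEquiv.inner_map_map G.symm z z']
      simp only [ContinuousLinearMap.comp_apply, hGs, sub_apply,
        hone, inner_sub_left, inner_sub_right, hpq, hpq', hp1]
      ring)
  simp only [ContinuousLinearMap.comp_apply, hGs, hGc, sub_apply, hone]
    at hM1s hM2s
  -- vectors at position zero orthogonal to the ranges of the shifts
  have o1 : ∀ z, p (G.symm z) = G.symm z →
      ∀ f, inner ℂ (AndoFree.sg 0 z) (M₁ f) = 0 := by
    intro z hz f
    refine AndoFree.sg_ext_inner _ _ (fun n u => ?_) f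
    have e : inner ℂ z (G u) - inner ℂ z (G (p u)) = 0 := by
      rw [← LinearIsometryEquiv.inner_map_map G.symm, ← LinearIsometryEquiv.inner_map_map G.symm z]
      simp only [LinearIsometryEquiv.symm_apply_apply]
      rw [← hp2, hz, sub_self]
    rw [hM1s, inner_add_right, AndoFree.inner_sg, AndoFree.inner_sg]
    simp [inner_sub_right, map_sub, e]
  have o2 : ∀ z, p z = 0 →
      ∀ f, inner ℂ (AndoFree.sg 0 z) (M₂ f) = 0 := by
    intro z hz f
    refine AndoFree.sg_ext_inner _ _ (fun n u => ?_) f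
    rw [hM2s, inner_add_right, AndoFree.inner_sg, AndoFree.inner_sg, ← hp2, hz]
    simp
  have hsg : ∀ z z' : E, inner ℂ (AndoFree.sg 0 z) (AndoFree.sg 0 z') = inner ℂ z z' := by
    intro z z'; rw [AndoFree.inner_sg, if_pos rfl]
  have hGx : ∀ j h, G.symm (x₂ j h) = x₁ j h := by
    intro j h; rw [← hG2, LinearIsometryEquiv.symm_apply_apply]
  let V₁ := AndoFree.join (AndoFree.inL ∘L S₁ + AndoFree.inR ∘L (AndoFree.sg 0 ∘L Gc ∘L v₁))
    (AndoFree.inR ∘L M₁)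
  let V₂ := AndoFree.join (AndoFree.inL ∘L S₂ + AndoFree.inR ∘L (AndoFree.sg 0 ∘L v₂))
    (AndoFree.inR ∘L M₂)
  let W := fun j => AndoFree.join
    (AndoFree.inL ∘L T j + AndoFree.inR ∘L (AndoFree.sg 0 ∘L x₂ j))
    (AndoFree.inR ∘L (AndoFree.sg 0 ∘L w j))
  have hV1 : ∀ z z', inner ℂ (V₁ z) (V₁ z') = inner ℂ z z' := by
    intro z z'
    have := AndoFree.inner_join S₁ S₁ (AndoFree.sg 0 ∘L Gc ∘L v₁) (AndoFree.sg 0 ∘L Gc ∘L v₁)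
      M₁ M₁ 1 ?_ ?_ ?_ ?_ z z'
    · rwa [one_mul] at this
    · intro a b
      simp only [ContinuousLinearMap.comp_apply, hsg, hGc, LinearIsometryEquiv.inner_map_map, hv1]
      ring
    · intro a b; exact o1 _ (by simp [hGc, hpv1]) b
    · intro a b; exact o1 _ (by simp [hGc, hpv1]) b
    · intro a b; rw [hM1, one_mul]
  have hV2 : ∀ z z', inner ℂ (V₂ z) (V₂ z') = inner ℂ z z' := by
    intro z z'
    have := AndoFree.inner_join S₂ S₂ (AndoFree.sg 0 ∘L v₂) (AndoFree.sg 0 ∘L v₂)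
      M₂ M₂ 1 ?_ ?_ ?_ ?_ z z'
    · rwa [one_mul] at this
    · intro a b
      simp only [ContinuousLinearMap.comp_apply, hsg, hv2]
      ring
    · intro a b; exact o2 _ (hpv2 _) b
    · intro a b; exact o2 _ (hpv2 _) b
    · intro a b; rw [hM2, one_mul]
  have hW : ∀ i j z z', inner ℂ (W i z) (W j z') = if i = j then inner ℂ z z' else 0 := by
    intro i j z z'
    have := AndoFree.inner_join (T i) (T j) (AndoFree.sg 0 ∘L x₂ i) (AndoFree.sg 0 ∘L x₂ j)
      (AndoFree.sg 0 ∘L w i) (AndoFree.sg 0 ∘L w j) (if i = j then 1 else 0) ?_ ?_ ?_ ?_ z z'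
    · rwa [ite_mul, one_mul, zero_mul] at this
    · intro a b
      simp only [ContinuousLinearMap.comp_apply, hsg, hx2, ite_mul, one_mul, zero_mul]
      ring
    · intro a b; simp only [ContinuousLinearMap.comp_apply, hsg, hx2w]
    · intro a b; simp only [ContinuousLinearMap.comp_apply, hsg, hx2w]
    · intro a b
      simp only [ContinuousLinearMap.comp_apply, hsg, hw, ite_mul, one_mul, zero_mul]
  have hV1W : ∀ j z z', inner ℂ (V₁ z) (W j z') = 0 := by
    intro j z z'
    have := AndoFree.inner_join S₁ (T j) (AndoFree.sg 0 ∘L Gc ∘L v₁) (AndoFree.sg 0 ∘L x₂ j)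
      M₁ (AndoFree.sg 0 ∘L w j) 0 ?_ ?_ ?_ ?_ z z'
    · rwa [zero_mul] at this
    · intro a b
      simp only [ContinuousLinearMap.comp_apply, hsg, hGc, ← hG2,
        LinearIsometryEquiv.inner_map_map, hvx1]
      ring
    · intro a b; simp only [ContinuousLinearMap.comp_apply, hsg, hGc, hGw]
    · intro a b; exact o1 (x₂ j a) (by rw [hGx, hpx1]) b
    · intro a b
      rw [← inner_conj_symm, zero_mul, map_eq_zero]
      exact o1 _ (hpGw j b) a
  have hV2W : ∀ j z z', inner ℂ (V₂ z) (W j z') = 0 := by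
    intro j z z'
    have := AndoFree.inner_join S₂ (T j) (AndoFree.sg 0 ∘L v₂) (AndoFree.sg 0 ∘L x₂ j)
      M₂ (AndoFree.sg 0 ∘L w j) 0 ?_ ?_ ?_ ?_ z z'
    · rwa [zero_mul] at this
    · intro a b
      simp only [ContinuousLinearMap.comp_apply, hsg, hvx2]
      ring
    · intro a b; simp only [ContinuousLinearMap.comp_apply, hsg, hv2w]
    · intro a b; exact o2 _ (hpx2 _ _) b
    · intro a b
      rw [← inner_conj_symm, zero_mul, map_eq_zero]
      exact o2 _ (hpw j b) a
  have hMM : M₁ ∘L M₂ = M₂ ∘L M₁ := by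
    apply AndoFree.sg_ext
    intro n z
    simp only [ContinuousLinearMap.comp_apply, hM1s, hM2s, map_add, map_sub, hp1,
      LinearIsometryEquiv.symm_apply_apply, LinearIsometryEquiv.apply_symm_apply]
    abel
  have hcomm : V₁ * V₂ = V₂ * V₁ := by
    ext1 z
    obtain ⟨h, f, rfl⟩ := AndoFree.exists_decomp z
    have hf : M₁ (M₂ f) = M₂ (M₁ f) := congrArg (fun w => w f) hMM
    have hg : AndoFree.sg 0 (G (v₁ (S₂ h))) + AndoFree.sg 0 (G (v₂ h)) =
        AndoFree.sg 0 (v₁ h) + AndoFree.sg 0 (v₂ (S₁ h)) := by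
      rw [← map_add, hG1, map_add]
    change V₁ (V₂ _) = V₂ (V₁ _)
    have e1 : M₁ (AndoFree.sg 0 (v₂ h)) = AndoFree.sg 0 (G (v₂ h)) := by
      rw [hM1s, hpv2]; simp
    have e2 : M₂ (AndoFree.sg 0 (G (v₁ h))) = AndoFree.sg 0 (v₁ h) := by
      rw [hM2s, LinearIsometryEquiv.symm_apply_apply, hpv1]; simp
    simp only [V₁, V₂, map_add, AndoFree.join_inL, AndoFree.join_inR, add_apply,
      ContinuousLinearMap.comp_apply, hGc, e1, e2, hf, hcc]
    rw [add_assoc (AndoFree.inL _), ← map_add AndoFree.inR, hg, map_add]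
    abel
  let ι : H →ₗᵢ[ℂ] WithLp 2 (H × AndoFree.Sq E) :=
    (AndoFree.inL (X := H) (Y := AndoFree.Sq E)).toLinearMap.isometryOfInner
      (fun a b => AndoFree.inner_inL_inL a b)
  have a1 : ∀ h : H, adjoint V₁ (ι h) = ι (adjoint S₁ h) :=
    fun h => AndoFree.adjoint_join _ _ _ h
  have a2 : ∀ h : H, adjoint V₂ (ι h) = ι (adjoint S₂ h) :=
    fun h => AndoFree.adjoint_join _ _ _ h
  have a3 : ∀ (j : Fin k) (h : H), adjoint (W j) (ι h) = ι (adjoint (T j) h) :=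
    fun j h => AndoFree.adjoint_join _ _ _ h
  refine ⟨WithLp 2 (H × AndoFree.Sq E), inferInstance, inferInstance, inferInstance, ι, V₁, V₂, W,
    AndoFree.adjoint_mul_self V₁ hV1, AndoFree.adjoint_mul_self V₂ hV2,
    fun j => AndoFree.adjoint_mul_self (W j) (fun z z' => by simpa using hW j j z z'),
    hcomm, AndoFree.row_le_one' V₁ W hV1 hV1W hW, AndoFree.row_le_one' V₂ W hV2 hV2W hW,
    a1, a2, a3, ?_⟩
  refine AndoFree.word_compression ι _ _ ?_
  rintro (i | j) h
  · fin_cases i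
    · exact a1 h
    · exact a2 h
  · exact a3 j h
end

section
/- Let P be a countable right LCM monoid and let ℓ²(P) be the Hilbert space with canonical orthonormal basis {e_q : q ∈ P}. For each p ∈ P there is a unique bounded operator λ(p) on ℓ²(P) with λ(p)e_q = e_{pq} for all q ∈ P, and p ↦ λ(p) is an isometric Nica-covariant representation of P: each λ(p) is an isometry, λ(p)λ(q) = λ(pq), and for all p, q ∈ P, λ(p)λ(p)*λ(q)λ(q)* = λ(r)λ(r)* whenever pP ∩ qP = rP, while λ(p)λ(p)*λ(q)λ(q)* = 0 whenever pP ∩ qP = ∅. -/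
open ContinuousLinearMap

/-- The right ideal `pP = {p * x : x ∈ P}` of a monoid. -/
def rightSet {M : Type*} [Monoid M] (p : M) : Set M := Set.range fun x => p * x

/-- A right LCM monoid: a left-cancellative monoid in which the intersection of two
principal right ideals is either empty or again a principal right ideal. -/
def IsRightLCMMonoid (M : Type*) [Monoid M] : Prop :=
  (∀ a b c : M, a * b = a * c → b = c) ∧
    ∀ p q : M, rightSet p ∩ rightSet q = ∅ ∨ ∃ r : M, rightSet p ∩ rightSet q = rightSet r

/-- Nica covariance for an (isometric) operator-valued map on a right LCM monoid. -/
def IsNicaCovariant {M : Type*} [Monoid M] {K : Type*} [NormedAddCommGroup K]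
    [InnerProductSpace ℂ K] [CompleteSpace K] (W : M → (K →L[ℂ] K)) : Prop :=
  ∀ p q : M,
    (rightSet p ∩ rightSet q = ∅ → W p * adjoint (W p) * (W q * adjoint (W q)) = 0) ∧
    ∀ r : M, rightSet p ∩ rightSet q = rightSet r →
      W p * adjoint (W p) * (W q * adjoint (W q)) = W r * adjoint (W r)

theorem lrAux_ext {P : Type*} [DecidableEq P]
    {A B : lp (fun _ : P => ℂ) 2 →L[ℂ] lp (fun _ : P => ℂ) 2}
    (h : ∀ q : P, A (lp.single 2 q (1 : ℂ)) = B (lp.single 2 q (1 : ℂ))) : A = B := by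
  ext1 f
  have hf := lp.hasSum_single (E := fun _ : P => ℂ) (p := 2) (by simp) f
  have hA := hf.mapL A
  have hB := hf.mapL B
  have key : ∀ i, A (lp.single 2 i (f i)) = B (lp.single 2 i (f i)) := by
    intro i
    have : lp.single (E := fun _ : P => ℂ) 2 i (f i)
        = (f i) • lp.single (E := fun _ : P => ℂ) 2 i (1 : ℂ) := by
      rw [← lp.single_smul]; simp
    rw [this, map_smul, map_smul, h]
  simp only [key] at hA
  exact hA.unique hB

theorem lrAux_orth {P : Type*} [DecidableEq P] :
    Orthonormal ℂ (fun q : P => lp.single (E := fun _ : P => ℂ) 2 q (1 : ℂ)) := by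
  rw [orthonormal_iff_ite]
  intro i j
  rw [lp.inner_single_left, lp.single_apply]
  by_cases h : i = j
  · subst h; simp
  · simp [h]

theorem lrAux_adj {P : Type*} [Monoid P] [DecidableEq P] (p : P)
    (A : lp (fun _ : P => ℂ) 2 →L[ℂ] lp (fun _ : P => ℂ) 2)
    (h : ∀ q : P, A (lp.single 2 q (1 : ℂ)) = lp.single 2 (p * q) (1 : ℂ)) (s i : P) :
    (adjoint A (lp.single 2 s (1 : ℂ))) i = if p * i = s then (1 : ℂ) else 0 := by
  have h1 := lp.inner_single_left (𝕜 := ℂ) (G := fun _ : P => ℂ) i (1 : ℂ)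
    (adjoint A (lp.single 2 s (1 : ℂ)))
  rw [adjoint_inner_right, h, orthonormal_iff_ite.1 lrAux_orth] at h1
  simpa using h1.symm

theorem lrAux_proj {P : Type*} [Monoid P] [DecidableEq P]
    (hc : ∀ a b c : P, a * b = a * c → b = c) (p : P)
    (A : lp (fun _ : P => ℂ) 2 →L[ℂ] lp (fun _ : P => ℂ) 2)
    (h : ∀ q : P, A (lp.single 2 q (1 : ℂ)) = lp.single 2 (p * q) (1 : ℂ)) :
    (∀ q, adjoint A (lp.single 2 (p * q) (1 : ℂ)) = lp.single 2 q (1 : ℂ)) ∧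
    (∀ s, s ∈ rightSet p → (A * adjoint A) (lp.single 2 s (1 : ℂ)) = lp.single 2 s (1 : ℂ)) ∧
    (∀ s, s ∉ rightSet p → (A * adjoint A) (lp.single 2 s (1 : ℂ)) = 0) := by
  have h1 : ∀ q, adjoint A (lp.single 2 (p * q) (1 : ℂ)) = lp.single 2 q (1 : ℂ) := by
    intro q
    ext i
    rw [lrAux_adj p A h, lp.single_apply]
    by_cases hi : i = q
    · subst hi; simp
    · rw [if_neg (fun e => hi (hc _ _ _ e))]; simp [hi]
  refine ⟨h1, ?_, ?_⟩
  · rintro s ⟨x, rfl⟩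
    rw [mul_apply_eq_comp, h1, h]
  · intro s hs
    have : adjoint A (lp.single 2 s (1 : ℂ)) = 0 := by
      ext i
      rw [lrAux_adj p A h, if_neg (fun e => hs ⟨i, e⟩)]; simp
    rw [mul_apply_eq_comp, this, map_zero]

/-- The left regular representation of a countable right LCM monoid `P` on `ℓ²(P)`:
for each `p ∈ P` there is a unique bounded operator `λ(p)` with `λ(p) e_q = e_{pq}` for all
`q`, and any such family of operators is an isometric Nica-covariant representation of `P`. -/
theorem leftRegular_isometric_nicaCovariant {P : Type*} [Monoid P] [Countable P]
    [DecidableEq P] (hP : IsRightLCMMonoid P) :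
    (∀ p : P, ∃! lamp : lp (fun _ : P => ℂ) 2 →L[ℂ] lp (fun _ : P => ℂ) 2,
      ∀ q : P, lamp (lp.single 2 q (1 : ℂ)) = lp.single 2 (p * q) (1 : ℂ)) ∧
    ∀ lam : P → (lp (fun _ : P => ℂ) 2 →L[ℂ] lp (fun _ : P => ℂ) 2),
      (∀ p q : P, lam p (lp.single 2 q (1 : ℂ)) = lp.single 2 (p * q) (1 : ℂ)) →
      (∀ p : P, adjoint (lam p) * lam p = 1) ∧
      (∀ p q : P, lam p * lam q = lam (p * q)) ∧
      IsNicaCovariant lam := by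
  obtain ⟨hc, -⟩ := hP
  refine ⟨fun p => ?_, fun lam hl => ⟨fun p => ?_, fun p q => ?_, fun p q => ⟨fun he => ?_, fun r hr => ?_⟩⟩⟩
  · have ho : Orthonormal ℂ (fun q : P => lp.single (E := fun _ : P => ℂ) 2 (p * q) (1 : ℂ)) :=
      lrAux_orth.comp (fun q => p * q) (fun a b e => hc _ _ _ e)
    refine ⟨ho.orthogonalFamily.linearIsometry.toContinuousLinearMap, fun q => ?_,
      fun B hB => lrAux_ext fun q => ?_⟩
    · simp [OrthogonalFamily.linearIsometry_apply_single]
    · rw [hB]; simp [OrthogonalFamily.linearIsometry_apply_single]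
  · refine lrAux_ext fun q => ?_
    rw [mul_apply_eq_comp, hl, (lrAux_proj hc p _ (hl p)).1]; rfl
  · refine lrAux_ext fun s => ?_
    rw [mul_apply_eq_comp, hl, hl, hl, mul_assoc]
  · obtain ⟨-, p1, p2⟩ := lrAux_proj hc p _ (hl p)
    obtain ⟨-, q1, q2⟩ := lrAux_proj hc q _ (hl q)
    refine lrAux_ext fun s => ?_
    rw [mul_apply_eq_comp]
    by_cases hq : s ∈ rightSet q
    · have hp : s ∉ rightSet p := fun hp => by
        have : s ∈ rightSet p ∩ rightSet q := ⟨hp, hq⟩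
        rw [he] at this; exact this
      rw [q1 s hq, p2 s hp]; rfl
    · rw [q2 s hq, map_zero]; rfl
  · obtain ⟨-, p1, p2⟩ := lrAux_proj hc p _ (hl p)
    obtain ⟨-, q1, q2⟩ := lrAux_proj hc q _ (hl q)
    obtain ⟨-, r1, r2⟩ := lrAux_proj hc r _ (hl r)
    refine lrAux_ext fun s => ?_
    rw [mul_apply_eq_comp]
    by_cases hq : s ∈ rightSet q
    · by_cases hp : s ∈ rightSet p
      · rw [q1 s hq, p1 s hp, r1 s (hr ▸ ⟨hp, hq⟩)]
      · rw [q1 s hq, p2 s hp, r2 s (fun h => hp (hr.symm ▸ h : s ∈ rightSet p ∩ rightSet q).1)]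
    · rw [q2 s hq, map_zero, r2 s (fun h => hq (hr.symm ▸ h : s ∈ rightSet p ∩ rightSet q).2)]
end
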